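/- arXiv:math/0303151 — 2 statements merged into one kernel-verified Lean document; each statement's English description precedes it below -/
import Mathlib

section
/- Let φ be a 3×3 matrix over S whose entries are homogeneous linear forms with det φ = f₄. Then the R₄-module Coker φ is isomorphic to one of the modules Coker α(b,c,d,ε), Coker β(b,c,d,ε), Coker η(a,b,c,ε), or Coker θ(a,b,c) for suitable parameters b³ = c³ = d³ = −1, ε³ = 1, ε ≠ 1, and (a,b,c) a permutation of the cube roots of −1. -/
open MvPolynomial Matrix TensorProduct

set_option maxHeartbeats 1000000
set_option synthInstance.maxHeartbeats 400000

noncomputable section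

/-- The polynomial ring `S = K[Y₁,Y₂,Y₃,Y₄]`. -/
abbrev S (K : Type) [Field K] := MvPolynomial (Fin 4) K

/-- The variables `Y₁,…,Y₄` (indexed by `1,…,4`). -/
def Yv (K : Type) [Field K] : ℕ → S K
  | 1 => X 0
  | 2 => X 1
  | 3 => X 2
  | 4 => X 3
  | _ => 0

/-- `f₄ = Y₁³+Y₂³+Y₃³+Y₄³`. -/
def f4 (K : Type) [Field K] : S K :=
  Yv K 1 ^ 3 + Yv K 2 ^ 3 + Yv K 3 ^ 3 + Yv K 4 ^ 3

/-- The hypersurface ring `R₄ = S/(f₄)`. -/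
abbrev R4 (K : Type) [Field K] := S K ⧸ Ideal.span {f4 K}

/-- The canonical projection `S → R₄`. -/
abbrev proj (K : Type) [Field K] : S K →+* R4 K := Ideal.Quotient.mk (Ideal.span {f4 K})

/-- The `R₄`-linear map `R₄ⁿ → R₄ⁿ` induced by an `n × n` matrix over `S`. -/
abbrev mbar (K : Type) [Field K] {n : ℕ} (M : Matrix (Fin n) (Fin n) (S K)) :
    (Fin n → R4 K) →ₗ[R4 K] (Fin n → R4 K) :=
  Matrix.mulVecLin (M.map ⇑(proj K))

/-- The cokernel of the `R₄`-linear map induced by a matrix over `S`. -/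
abbrev coker (K : Type) [Field K] {n : ℕ} (M : Matrix (Fin n) (Fin n) (S K)) :=
  (Fin n → R4 K) ⧸ LinearMap.range (mbar K M)

/-- The matrix `φ_ij(a,b)`. -/
def phiM (K : Type) [Field K] (a b : K) (i j s : ℕ) : Matrix (Fin 2) (Fin 2) (S K) :=
  !![Yv K 1 - C a * Yv K s, -(Yv K i ^ 2 + C b * Yv K i * Yv K j + C b ^ 2 * Yv K j ^ 2);
     Yv K i - C b * Yv K j, Yv K 1 ^ 2 + C a * Yv K 1 * Yv K s + C a ^ 2 * Yv K s ^ 2]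

/-- The matrix `ψ_ij(a,b)`. -/
def psiM (K : Type) [Field K] (a b : K) (i j s : ℕ) : Matrix (Fin 2) (Fin 2) (S K) :=
  !![Yv K 1 ^ 2 + C a * Yv K 1 * Yv K s + C a ^ 2 * Yv K s ^ 2,
       Yv K i ^ 2 + C b * Yv K i * Yv K j + C b ^ 2 * Yv K j ^ 2;
     -(Yv K i - C b * Yv K j), Yv K 1 - C a * Yv K s]

/-- The set `𝓛_i` of linear forms `Y_i - a Y_j` with `a³ = -1` and `i < j ≤ 4`. -/
def Lset (K : Type) [Field K] (i : ℕ) : Set (S K) :=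
  {p | ∃ (a : K) (j : ℕ), a ^ 3 = -1 ∧ i < j ∧ j ≤ 4 ∧ p = Yv K i - C a * Yv K j}

/-- The matrix `α(b,c,d,ε)`, where `a = ε²bcd`. -/
def alphaM (K : Type) [Field K] (b c d ε : K) : Matrix (Fin 3) (Fin 3) (S K) :=
  let a := ε ^ 2 * b * c * d
  !![0, Yv K 1 - C a * Yv K 4, Yv K 2 - C b * Yv K 3;
     Yv K 1 - C c * Yv K 2, -(C (b ^ 2) * Yv K 3) - C (a * b * c ^ 2 * ε ^ 2) * Yv K 4,
       C (b ^ 2 * c ^ 2) * Yv K 3 - C (a * b * c * ε ^ 2) * Yv K 4;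
     Yv K 3 - C d * Yv K 4, C (c ^ 2) * Yv K 2 + C (b * c ^ 2) * Yv K 3 + C (a * c) * Yv K 4,
       -(Yv K 1) - C c * Yv K 2 - C a * Yv K 4]

/-- The matrix `β(b,c,d,ε)`, the transpose of `α(b,c,d,ε)`. -/
def betaM (K : Type) [Field K] (b c d ε : K) : Matrix (Fin 3) (Fin 3) (S K) :=
  (alphaM K b c d ε).transpose

/-- The matrix `η(a,b,c,ε)`. -/
def etaM (K : Type) [Field K] (a b c ε : K) : Matrix (Fin 3) (Fin 3) (S K) :=
  !![0, Yv K 1 + Yv K 2, Yv K 3 - C a * Yv K 4;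
     Yv K 1 + C ε * Yv K 2, -(Yv K 3) + C c * Yv K 4, 0;
     Yv K 3 - C b * Yv K 4, 0, -(Yv K 1) - C (ε ^ 2) * Yv K 2]

/-- The matrix `θ(a,b,c)` (denoted `ϑ(a,b,c)` in the paper). -/
def thetaM (K : Type) [Field K] (a b c : K) : Matrix (Fin 3) (Fin 3) (S K) :=
  !![0, Yv K 1 + Yv K 3, Yv K 2 - C a * Yv K 4;
     Yv K 1 - C (a ^ 2 * b) * Yv K 3, -(Yv K 2) + C c * Yv K 4, 0;
     Yv K 2 - C b * Yv K 4, 0, -(Yv K 1) + C (a * b ^ 2) * Yv K 3]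

/-- The matrix `D((a,b,c),(p,q,r))`. -/
def DM (K : Type) [Field K] (a b c p q r : K) : Matrix (Fin 3) (Fin 3) (S K) :=
  !![0, Yv K 1 - C a * Yv K 2, Yv K 3 - C p * Yv K 4;
     Yv K 1 - C c * Yv K 2, -(Yv K 3) + C r * Yv K 4, 0;
     Yv K 3 - C q * Yv K 4, 0, -(Yv K 1) + C b * Yv K 2]

/-- `(a,b,c)` is a permutation (i.e. an enumeration) of the three cube roots of `-1` in `K`. -/
def cubePerm (K : Type) [Field K] (a b c : K) : Prop :=
  a ^ 3 = -1 ∧ b ^ 3 = -1 ∧ c ^ 3 = -1 ∧ a ≠ b ∧ a ≠ c ∧ b ≠ c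


section LinAlg
variable {K : Type} [Field K]

/-- A nonzero vector is the first column of some invertible matrix. -/
lemma exists_first_col (v : Fin 3 → K) (hv : v ≠ 0) :
    ∃ G : Matrix (Fin 3) (Fin 3) K, G.det ≠ 0 ∧ ∀ i, G i 0 = v i := by
  by_cases h0 : v 0 = 0
  · by_cases h1 : v 1 = 0
    · have h2 : v 2 ≠ 0 := by
        intro h2
        apply hv
        funext i
        fin_cases i <;> simp [h0, h1, h2]
      refine ⟨!![v 0, 1, 0; v 1, 0, 1; v 2, 0, 0], ?_, ?_⟩
      · simp [Matrix.det_fin_three, h2]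
      · intro i; fin_cases i <;> rfl
    · refine ⟨!![v 0, 1, 0; v 1, 0, 0; v 2, 0, 1], ?_, ?_⟩
      · simp [Matrix.det_fin_three, h1]
      · intro i; fin_cases i <;> rfl
  · refine ⟨!![v 0, 0, 0; v 1, 1, 0; v 2, 0, 1], ?_, ?_⟩
    · simp [Matrix.det_fin_three, h0]
    · intro i; fin_cases i <;> rfl

/-- An invertible matrix sending a nonzero vector to the first basis vector. -/
lemma exists_to_first (u : Fin 3 → K) (hu : u ≠ 0) :
    ∃ U : Matrix (Fin 3) (Fin 3) K, U.det ≠ 0 ∧ U *ᵥ u = ![1, 0, 0] := by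
  obtain ⟨G, hG, hc⟩ := exists_first_col u hu
  refine ⟨G⁻¹, ?_, ?_⟩
  · rw [Matrix.det_nonsing_inv]
    simpa using hG
  · have : u = G *ᵥ ![1, 0, 0] := by
      funext i
      simp [Matrix.mulVec, dotProduct, Fin.sum_univ_three, hc]
    rw [this, Matrix.mulVec_mulVec, Matrix.nonsing_inv_mul _ (by simpa using hG), Matrix.one_mulVec]

variable {V : Type} [AddCommGroup V] [Module K V]

/-- A functional vanishing on the kernel of `g` is a multiple of `g`. -/
lemma func_factor {W : Type} [AddCommGroup W] [Module K W] (g : V →ₗ[K] K) (h : V →ₗ[K] W)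
    (s : V) (hs : g s = 1) (hk : ∀ x, g x = 0 → h x = 0) (x : V) : h x = g x • h s := by
  have := hk (x - g x • s) (by simp [hs])
  rw [map_sub, map_smul] at this
  exact sub_eq_zero.mp this

lemma exists_one (g : V →ₗ[K] K) (s : V) (hs : g s ≠ 0) : ∃ s, g s = 1 :=
  ⟨(g s)⁻¹ • s, by simp [hs]⟩

/-- Spaces of singular 2 by 2 matrices, case with a nonzero first entry. -/
lemma sing2_aux [CharZero K] (a b c d : V →ₗ[K] K) (h : ∀ x, a x * d x = b x * c x) (x0 : V) (h0 : a x0 ≠ 0) :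
    (∃ p q : K, (p ≠ 0 ∨ q ≠ 0) ∧ ∀ x, p * a x + q * b x = 0 ∧ p * c x + q * d x = 0) ∨
    (∃ p q : K, (p ≠ 0 ∨ q ≠ 0) ∧ ∀ x, p * a x + q * c x = 0 ∧ p * b x + q * d x = 0) := by
  have hpol : ∀ x y, a x * d y + a y * d x = b x * c y + b y * c x := by
    intro x y
    have h1 := h (x + y)
    simp only [map_add] at h1
    linear_combination h1 - h x - h y
  set m := b x0 / a x0 with hm
  set n := c x0 / a x0 with hn
  have hb0 : b x0 = m * a x0 := by rw [hm]; field_simp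
  have hc0 : c x0 = n * a x0 := by rw [hn]; field_simp
  have hd0 : d x0 = m * n * a x0 := by
    have := h x0
    rw [hb0, hc0] at this
    apply mul_left_cancel₀ h0
    linear_combination this
  have hd : ∀ y, d y = m * c y + n * b y - m * n * a y := by
    intro y
    have := hpol x0 y
    rw [hb0, hc0, hd0] at this
    apply mul_left_cancel₀ h0
    linear_combination this
  have hprod : ∀ y, (b y - m * a y) * (c y - n * a y) = 0 := by
    intro y
    have := h y
    rw [hd y] at this
    linear_combination -this
  have hcase : (∀ y, b y - m * a y = 0) ∨ (∀ y, c y - n * a y = 0) := by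
    by_contra hcon
    push Not at hcon
    obtain ⟨⟨y, hy⟩, ⟨z, hz⟩⟩ := hcon
    have hy' := (mul_eq_zero.mp (hprod y)).resolve_left hy
    have hz' := (mul_eq_zero.mp (hprod z)).resolve_right hz
    have := hprod (y + z)
    simp only [map_add] at this
    have h2 : (b y - m * a y) * (c z - n * a z) = 0 := by
      linear_combination this - (b y - m * a y) * hy' - (c y - n * a y) * hz' - (c z - n * a z) * hz'
    rcases mul_eq_zero.mp h2 with h3 | h3
    · exact hy h3
    · exact hz h3
  rcases hcase with hB | hC
  · left
    refine ⟨-m, 1, Or.inr one_ne_zero, fun x => ⟨?_, ?_⟩⟩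
    · linear_combination hB x
    · rw [hd x]; linear_combination n * hB x
  · right
    refine ⟨-n, 1, Or.inr one_ne_zero, fun x => ⟨?_, ?_⟩⟩
    · linear_combination hC x
    · rw [hd x]; linear_combination m * hC x

/-- A linear space of singular 2 by 2 matrices has a common kernel or a common left kernel. -/
lemma sing2 [CharZero K] (a b c d : V →ₗ[K] K) (h : ∀ x, a x * d x = b x * c x) :
    (∃ p q : K, (p ≠ 0 ∨ q ≠ 0) ∧ ∀ x, p * a x + q * b x = 0 ∧ p * c x + q * d x = 0) ∨
    (∃ p q : K, (p ≠ 0 ∨ q ≠ 0) ∧ ∀ x, p * a x + q * c x = 0 ∧ p * b x + q * d x = 0) := by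
  by_cases ha : ∃ x, a x ≠ 0
  · obtain ⟨x0, h0⟩ := ha
    exact sing2_aux a b c d h x0 h0
  by_cases hb : ∃ x, b x ≠ 0
  · obtain ⟨x0, h0⟩ := hb
    rcases sing2_aux b a d c (fun x => (h x).symm) x0 h0 with ⟨p, q, hpq, H⟩ | ⟨p, q, hpq, H⟩
    · left
      refine ⟨q, p, hpq.symm, fun x => ⟨?_, ?_⟩⟩
      · linear_combination (H x).1
      · linear_combination (H x).2
    · right
      exact ⟨p, q, hpq, fun x => ⟨(H x).2, (H x).1⟩⟩
  by_cases hc : ∃ x, c x ≠ 0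
  · obtain ⟨x0, h0⟩ := hc
    rcases sing2_aux c d a b (fun x => by linear_combination -(h x)) x0 h0 with ⟨p, q, hpq, H⟩ | ⟨p, q, hpq, H⟩
    · left
      exact ⟨p, q, hpq, fun x => ⟨(H x).2, (H x).1⟩⟩
    · right
      refine ⟨q, p, hpq.symm, fun x => ⟨?_, ?_⟩⟩
      · linear_combination (H x).1
      · linear_combination (H x).2
  push Not at ha hb hc
  left
  exact ⟨1, 0, Or.inl one_ne_zero, fun x => ⟨by rw [ha x]; ring, by rw [hc x]; ring⟩⟩

/-- Column type: `φ` kills a common nonzero vector at all points satisfying `P`. -/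
def Cty (φ : V →ₗ[K] Matrix (Fin 3) (Fin 3) K) (P : V → Prop) : Prop :=
  ∃ v : Fin 3 → K, v ≠ 0 ∧ ∀ x, P x → φ x *ᵥ v = 0

/-- The transposed family of matrices. -/
def tr (φ : V →ₗ[K] Matrix (Fin 3) (Fin 3) K) : V →ₗ[K] Matrix (Fin 3) (Fin 3) K :=
  (Matrix.transposeLinearEquiv (Fin 3) (Fin 3) K K).toLinearMap ∘ₗ φ

lemma tr_apply (φ : V →ₗ[K] Matrix (Fin 3) (Fin 3) K) (x : V) : tr φ x = (φ x)ᵀ := rfl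

lemma tr_tr (φ : V →ₗ[K] Matrix (Fin 3) (Fin 3) K) : tr (tr φ) = φ := by
  ext x; simp [tr_apply]

/-- The family `U φ G`. -/
def conj2 (U G : Matrix (Fin 3) (Fin 3) K) (φ : V →ₗ[K] Matrix (Fin 3) (Fin 3) K) :
    V →ₗ[K] Matrix (Fin 3) (Fin 3) K where
  toFun x := U * φ x * G
  map_add' x y := by simp [Matrix.mul_add, Matrix.add_mul]
  map_smul' c x := by simp

lemma conj2_apply (U G : Matrix (Fin 3) (Fin 3) K) (φ : V →ₗ[K] Matrix (Fin 3) (Fin 3) K) (x : V) :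
    conj2 U G φ x = U * φ x * G := rfl

/-- An entry of a family of matrices, as a functional. -/
def ent (φ : V →ₗ[K] Matrix (Fin 3) (Fin 3) K) (i j : Fin 3) : V →ₗ[K] K where
  toFun x := φ x i j
  map_add' x y := by simp
  map_smul' c x := by simp

lemma ent_apply (φ : V →ₗ[K] Matrix (Fin 3) (Fin 3) K) (i j : Fin 3) (x : V) : ent φ i j x = φ x i j := rfl

/-- Left kernel vectors can be pulled back along an equivalence. -/
lemma left_kernel_back (U G A : Matrix (Fin 3) (Fin 3) K) (hG : G.det ≠ 0) (w : Fin 3 → K)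
    (h : w ᵥ* (U * A * G) = 0) : Aᵀ *ᵥ (w ᵥ* U) = 0 := by
  rw [Matrix.mulVec_transpose]
  have h1 : ((w ᵥ* U) ᵥ* A) ᵥ* G = 0 := by
    rw [Matrix.vecMul_vecMul, Matrix.vecMul_vecMul, ← Matrix.mul_assoc]
    exact h
  have h2 : (((w ᵥ* U) ᵥ* A) ᵥ* G) ᵥ* G⁻¹ = 0 := by rw [h1, Matrix.zero_vecMul]
  rwa [Matrix.vecMul_vecMul, Matrix.mul_nonsing_inv _ (by simpa using hG), Matrix.vecMul_one] at h2

lemma vecMul_ne_zero' (U : Matrix (Fin 3) (Fin 3) K) (hU : U.det ≠ 0) (w : Fin 3 → K) (hw : w ≠ 0) :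
    w ᵥ* U ≠ 0 := by
  intro h
  apply hw
  have h2 : (w ᵥ* U) ᵥ* U⁻¹ = 0 := by rw [h, Matrix.zero_vecMul]
  rwa [Matrix.vecMul_vecMul, Matrix.mul_nonsing_inv _ (by simpa using hU), Matrix.vecMul_one] at h2

lemma three_nonzero [CharZero K] (g1 g2 g3 : V →ₗ[K] K) (s1 s2 s3 : V) (h1 : g1 s1 ≠ 0) (h2 : g2 s2 ≠ 0)
    (h3 : g3 s3 ≠ 0) : ∃ x, g1 x ≠ 0 ∧ g2 x ≠ 0 ∧ g3 x ≠ 0 := by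
  obtain ⟨f, hf⟩ := Module.Dual.exists_forall_ne_zero_of_forall_exists ![g1, g2, g3]
    (by intro i; fin_cases i
        · exact ⟨s1, h1⟩
        · exact ⟨s2, h2⟩
        · exact ⟨s3, h3⟩)
  exact ⟨f, hf 0, hf 1, hf 2⟩

/-- The key step: in a plane section splitting into three lines, a line of column type
forces one of the other two to be of row type. -/
lemma plane_step [CharZero K] (φ : V →ₗ[K] Matrix (Fin 3) (Fin 3) K) (g1 g2 g3 : V →ₗ[K] K)
    (s1 s2 s3 : V) (h1 : g1 s1 ≠ 0) (h2 : g2 s2 ≠ 0) (h3 : g3 s3 ≠ 0)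
    (hdet : ∀ x, (φ x).det = g1 x * g2 x * g3 x)
    (hC : Cty φ (fun x => g1 x = 0)) :
    Cty (tr φ) (fun x => g2 x = 0) ∨ Cty (tr φ) (fun x => g3 x = 0) := by
  obtain ⟨x0, n1, n2, n3⟩ := three_nonzero g1 g2 g3 s1 s2 s3 h1 h2 h3
  obtain ⟨v, hv, hC⟩ := hC
  obtain ⟨s, hs⟩ := exists_one g1 s1 h1
  obtain ⟨t, ht⟩ := exists_one g2 s2 h2
  obtain ⟨G, hG, hGv⟩ := exists_first_col v hv
  have hfac : ∀ x, φ x *ᵥ v = g1 x • (φ s *ᵥ v) := by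
    intro x
    have := hC (x - g1 x • s) (by simp [hs])
    rw [map_sub, map_smul, Matrix.sub_mulVec, Matrix.smul_mulVec] at this
    exact sub_eq_zero.mp this
  have hu : φ s *ᵥ v ≠ 0 := by
    intro hu
    have h4 : φ x0 *ᵥ v = 0 := by rw [hfac, hu, smul_zero]
    have h5 : (φ x0).det = 0 := Matrix.exists_mulVec_eq_zero_iff.mp ⟨v, hv, h4⟩
    rw [hdet] at h5
    exact mul_ne_zero (mul_ne_zero n1 n2) n3 h5
  obtain ⟨U, hU, hUu⟩ := exists_to_first _ hu
  set ψ := conj2 U G φ with hψ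
  have hcol : ∀ x i, ψ x i 0 = g1 x * (![1, 0, 0] : Fin 3 → K) i := by
    intro x i
    have e1 : ψ x i 0 = (U *ᵥ (φ x *ᵥ v)) i := by
      rw [hψ, conj2_apply, Matrix.mul_assoc, Matrix.mul_apply]
      simp only [Matrix.mulVec, dotProduct, Matrix.mul_apply, hGv]
    rw [e1, hfac, Matrix.mulVec_smul, hUu]
    simp
  have c0 : ∀ x, ψ x 0 0 = g1 x := fun x => by simpa using hcol x 0
  have c1 : ∀ x, ψ x 1 0 = 0 := fun x => by simpa using hcol x 1
  have c2 : ∀ x, ψ x 2 0 = 0 := fun x => by simpa using hcol x 2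
  set k := U.det * G.det with hk
  have hk0 : k ≠ 0 := mul_ne_zero hU hG
  have hdψ : ∀ x, (ψ x).det = k * (g1 x * g2 x * g3 x) := by
    intro x
    rw [hψ, conj2_apply, Matrix.det_mul, Matrix.det_mul, hdet]
    ring
  set a := ent ψ 1 1 with hA
  set b := ent ψ 1 2 with hB
  set c := ent ψ 2 1 with hCc
  set d := ent ψ 2 2 with hD
  have hq1 : ∀ x, g1 x ≠ 0 → a x * d x - b x * c x - k * (g2 x * g3 x) = 0 := by
    intro x hx
    have := hdψ x
    rw [Matrix.det_fin_three, c0, c1, c2] at this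
    apply mul_left_cancel₀ hx
    simp only [hA, hB, hCc, hD, ent_apply]
    linear_combination this
  have hq : ∀ x, a x * d x - b x * c x = k * (g2 x * g3 x) := by
    intro x
    by_cases hx : g1 x = 0
    · have e1 := hq1 (x + s) (by simp [hx, hs])
      have e2 := hq1 (x + (2 : K) • s) (by simp [hx, hs])
      have e3 := hq1 (x + (3 : K) • s) (by simp [hx, hs])
      simp only [map_add, map_smul, smul_eq_mul] at e1 e2 e3
      linear_combination 3 * e1 - 3 * e2 + e3
    · linear_combination hq1 x hx
  -- restrict to the kernel of `g2`
  let W := LinearMap.ker g2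
  have hW : ∀ x : W, (a ∘ₗ W.subtype) x * (d ∘ₗ W.subtype) x = (b ∘ₗ W.subtype) x * (c ∘ₗ W.subtype) x := by
    rintro ⟨x, hx⟩
    have hx' : g2 x = 0 := hx
    have := hq x
    rw [hx'] at this
    simp only [LinearMap.comp_apply, Submodule.subtype_apply]
    linear_combination this
  have mkL : ∀ (g : V →ₗ[K] K) (p q : K), (p ≠ 0 ∨ q ≠ 0) →
      (∀ x, g x = 0 → p * a x + q * c x = 0 ∧ p * b x + q * d x = 0) →
      Cty (tr φ) (fun x => g x = 0) := by
    intro g p q hpq H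
    refine ⟨![0, p, q] ᵥ* U, vecMul_ne_zero' U hU _ ?_, ?_⟩
    · intro h0
      have e1 := congrFun h0 1
      have e2 := congrFun h0 2
      simp at e1 e2
      rcases hpq with hp | hp
      · exact hp e1
      · exact hp e2
    · intro x hx
      rw [tr_apply]
      apply left_kernel_back U G _ hG
      rw [← conj2_apply, ← hψ]
      obtain ⟨H1, H2⟩ := H x hx
      simp only [hA, hB, hCc, hD, ent_apply] at H1 H2
      funext j
      fin_cases j
      · simp [Matrix.vecMul, dotProduct, Fin.sum_univ_three, c1, c2]
      · simpa [Matrix.vecMul, dotProduct, Fin.sum_univ_three] using H1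
      · simpa [Matrix.vecMul, dotProduct, Fin.sum_univ_three] using H2
  rcases sing2 _ _ _ _ hW with ⟨p, q, hpq, H⟩ | ⟨p, q, hpq, H⟩
  · right
    have f1 := func_factor g2 (p • a + q • b) t ht (fun x hx => by
      have := (H ⟨x, hx⟩).1
      simpa using this)
    have f2 := func_factor g2 (p • c + q • d) t ht (fun x hx => by
      have := (H ⟨x, hx⟩).2
      simpa using this)
    set l := (p • a + q • b) t
    set m := (p • c + q • d) t
    simp only [LinearMap.add_apply, LinearMap.smul_apply, smul_eq_mul] at f1 f2
    have hpd : ∀ x, p * (k * (g2 x * g3 x)) = g2 x * (l * d x - m * b x) := by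
      intro x
      rw [← hq]
      linear_combination d x * f1 x - b x * f2 x
    have hqd : ∀ x, q * (k * (g2 x * g3 x)) = g2 x * (m * a x - l * c x) := by
      intro x
      rw [← hq]
      linear_combination a x * f2 x - c x * f1 x
    have hlm : -m ≠ 0 ∨ l ≠ 0 := by
      by_contra hcon
      push Not at hcon
      obtain ⟨hm, hl⟩ := hcon
      have hm : m = 0 := by simpa using hm
      have e1 := hpd x0
      have e2 := hqd x0
      rw [hm, hl] at e1 e2
      have hn := mul_ne_zero hk0 (mul_ne_zero n2 n3)
      rcases hpq with hp | hp
      · exact mul_ne_zero hp hn (by linear_combination e1)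
      · exact mul_ne_zero hp hn (by linear_combination e2)
    have lin : ∀ (h : V →ₗ[K] K), (∀ x, g2 x * h x = 0) → ∀ x, h x = 0 := by
      intro h hh x
      by_cases hx : g2 x = 0
      · have e1 := hh (x + t)
        have e2 := hh t
        simp only [map_add, hx, ht] at e1 e2
        linear_combination e1 - e2
      · exact (mul_eq_zero.mp (hh x)).resolve_left hx
    have L1 : ∀ x, l * d x - m * b x - p * k * g3 x = 0 := by
      intro x
      have := lin (l • d - m • b - (p * k) • g3) (fun x => by
        simp only [LinearMap.sub_apply, LinearMap.smul_apply, smul_eq_mul]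
        linear_combination -(hpd x)) x
      simpa using this
    have L2 : ∀ x, m * a x - l * c x - q * k * g3 x = 0 := by
      intro x
      have := lin (m • a - l • c - (q * k) • g3) (fun x => by
        simp only [LinearMap.sub_apply, LinearMap.smul_apply, smul_eq_mul]
        linear_combination -(hqd x)) x
      simpa using this
    apply mkL g3 (-m) l hlm
    intro x hx
    have e1 := L1 x
    have e2 := L2 x
    rw [hx] at e1 e2
    exact ⟨by linear_combination -e2, by linear_combination e1⟩
  · left
    exact mkL g2 p q hpq (fun x hx => by simpa using H ⟨x, hx⟩)

end LinAlg

section Geometry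
variable {K : Type} [Field K]
variable {V : Type} [AddCommGroup V] [Module K V]

/-- The Fermat cubic as a function. -/
def FF (x : Fin 4 → K) : K := ∑ i, x i ^ 3

lemma FF_eq (x : Fin 4 → K) : FF x = x 0 ^ 3 + x 1 ^ 3 + x 2 ^ 3 + x 3 ^ 3 := by
  simp [FF, Fin.sum_univ_four]

/-- Smoothness of the Fermat cubic: the matrix has corank at most one away from the origin. -/
lemma smooth_pt [CharZero K] (Φ : (Fin 4 → K) →ₗ[K] Matrix (Fin 3) (Fin 3) K)
    (hΦ : ∀ x, (Φ x).det = FF x) (P : Fin 4 → K) (v1 v2 : Fin 3 → K) (hv1 : v1 ≠ 0)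
    (hind : ∀ k : K, v2 ≠ k • v1) (h1 : Φ P *ᵥ v1 = 0) (h2 : Φ P *ᵥ v2 = 0) : P = 0 := by
  obtain ⟨G, hG, hGv⟩ := exists_first_col v1 hv1
  obtain ⟨y, hy⟩ : ∃ y, v2 = G *ᵥ y := ⟨G⁻¹ *ᵥ v2, by
    rw [Matrix.mulVec_mulVec, Matrix.mul_nonsing_inv _ (by simpa using hG), Matrix.one_mulVec]⟩
  have hyn : y 1 ≠ 0 ∨ y 2 ≠ 0 := by
    by_contra hcon
    push Not at hcon
    apply hind (y 0)
    rw [hy]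
    funext i
    simp [Matrix.mulVec, dotProduct, Fin.sum_univ_three, hGv, hcon.1, hcon.2, mul_comm]
  set ψ := conj2 1 G Φ with hψ
  have hc : ∀ i, ψ P i 0 = 0 := by
    intro i
    have := congrFun h1 i
    rw [hψ, conj2_apply, Matrix.one_mul, Matrix.mul_apply]
    simpa only [Matrix.mulVec, dotProduct, hGv, Pi.zero_apply] using this
  have hd : ∀ i, ψ P i 1 * y 1 + ψ P i 2 * y 2 = 0 := by
    intro i
    have h3 : (ψ P *ᵥ y) i = 0 := by
      rw [hψ, conj2_apply, Matrix.one_mul, ← Matrix.mulVec_mulVec, ← hy, h2]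
      rfl
    simpa [Matrix.mulVec, dotProduct, Fin.sum_univ_three, hc] using h3
  have hdet : ∀ x, (ψ x).det = G.det * FF x := by
    intro x
    rw [hψ, conj2_apply, Matrix.one_mul, Matrix.det_mul, hΦ, mul_comm]
  have h00 : FF P = 0 := by
    rw [← hΦ]
    exact Matrix.exists_mulVec_eq_zero_iff.mp ⟨v1, hv1, h1⟩
  have key : ∀ E : Fin 4 → K, ψ E 0 0 * (ψ P 1 1 * ψ P 2 2 - ψ P 1 2 * ψ P 2 1)
      - ψ E 1 0 * (ψ P 0 1 * ψ P 2 2 - ψ P 0 2 * ψ P 2 1)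
      + ψ E 2 0 * (ψ P 0 1 * ψ P 1 2 - ψ P 0 2 * ψ P 1 1) = 0 := by
    intro E
    have m01 : ∀ i j, ψ P i 1 * ψ P j 2 - ψ P i 2 * ψ P j 1 = 0 := by
      intro i j
      rcases hyn with h | h
      · apply mul_left_cancel₀ h
        linear_combination ψ P j 2 * hd i - ψ P i 2 * hd j
      · apply mul_left_cancel₀ h
        linear_combination -ψ P j 1 * hd i + ψ P i 1 * hd j
    rw [m01, m01, m01]
    ring
  have main : ∀ E : Fin 4 → K, ∑ i, P i ^ 2 * E i = 0 := by
    intro E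
    have ex : ∀ t : K, t * (∑ i, 3 * P i ^ 2 * E i) + t ^ 2 * (∑ i, 3 * P i * E i ^ 2)
        + t ^ 3 * FF E = FF (P + t • E) := by
      intro t
      have : FF (P + t • E) = FF (P + t • E) - FF P := by rw [h00, sub_zero]
      rw [this]
      simp only [FF_eq, Fin.sum_univ_four, Pi.add_apply, Pi.smul_apply, smul_eq_mul]
      ring
    have ed : ∀ t : K, G.det * FF (P + t • E) = t ^ 2 * (
        (ψ E 0 0 * (ψ P 1 1 * ψ E 2 2 + ψ E 1 1 * ψ P 2 2 - ψ P 1 2 * ψ E 2 1 - ψ E 1 2 * ψ P 2 1)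
      - ψ E 1 0 * (ψ P 0 1 * ψ E 2 2 + ψ E 0 1 * ψ P 2 2 - ψ P 0 2 * ψ E 2 1 - ψ E 0 2 * ψ P 2 1)
      + ψ E 2 0 * (ψ P 0 1 * ψ E 1 2 + ψ E 0 1 * ψ P 1 2 - ψ P 0 2 * ψ E 1 1 - ψ E 0 2 * ψ P 1 1))
      ) + t ^ 3 * (ψ E).det := by
      intro t
      rw [← hdet, map_add, map_smul, Matrix.det_fin_three, Matrix.det_fin_three]
      simp only [Matrix.add_apply, Matrix.smul_apply, smul_eq_mul, hc]
      linear_combination t * key E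
    have d1 := ed 1
    have d2 := ed 2
    have d3 := ed 3
    rw [← ex] at d1 d2 d3
    have : 6 * (G.det * ∑ i, 3 * P i ^ 2 * E i) = 0 := by
      linear_combination 18 * d1 - 9 * d2 + 2 * d3
    have h6 : (6 : K) ≠ 0 := by norm_num
    have h3 : (3 : K) ≠ 0 := by norm_num
    have e1 := (mul_eq_zero.mp ((mul_eq_zero.mp this).resolve_left h6)).resolve_left hG
    have e2 : (3 : K) * ∑ i, P i ^ 2 * E i = 0 := by
      rw [← e1, Finset.mul_sum]
      exact Finset.sum_congr rfl (fun i _ => by ring)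
    exact (mul_eq_zero.mp e2).resolve_left h3
  funext i
  have := main (Pi.single i 1)
  simpa [Pi.single_apply] using this

/-- Two concurrent lines in a plane section cannot both be of column type. -/
lemma excl [CharZero K] (Φ : (Fin 4 → K) →ₗ[K] Matrix (Fin 3) (Fin 3) K)
    (hΦ : ∀ x, (Φ x).det = FF x) (ι : V →ₗ[K] (Fin 4 → K)) (g1 g2 : V →ₗ[K] K)
    (y : V) (hy : ι y ≠ 0) (hy1 : g1 y = 0) (hy2 : g2 y = 0) (s : V) (hs2 : g2 s = 0) (hs1 : g1 s ≠ 0)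
    (x0 : V) (hx0 : FF (ι x0) ≠ 0) (c1 : Cty (Φ ∘ₗ ι) (fun x => g1 x = 0))
    (c2 : Cty (Φ ∘ₗ ι) (fun x => g2 x = 0)) : False := by
  obtain ⟨v1, hv1, h1⟩ := c1
  obtain ⟨v2, hv2, h2⟩ := c2
  by_cases hk : ∃ k : K, v2 = k • v1
  · obtain ⟨k, hk⟩ := hk
    have hk0 : k ≠ 0 := by
      rintro rfl
      exact hv2 (by simpa using hk)
    have e1 : (Φ ∘ₗ ι) s *ᵥ v1 = 0 := by
      have := h2 s hs2
      rw [hk, Matrix.mulVec_smul] at this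
      exact (smul_eq_zero.mp this).resolve_left hk0
    have e2 : (Φ ∘ₗ ι) x0 *ᵥ v1 = 0 := by
      have := h1 (x0 - (g1 x0 / g1 s) • s) (by simp [hs1])
      rw [map_sub, map_smul, Matrix.sub_mulVec, Matrix.smul_mulVec, e1, smul_zero, sub_zero] at this
      exact this
    apply hx0
    rw [← hΦ]
    exact Matrix.exists_mulVec_eq_zero_iff.mp ⟨v1, hv1, e2⟩
  · push Not at hk
    exact hy (smooth_pt Φ hΦ (ι y) v1 v2 hv1 hk (h1 y hy1) (h2 y hy2))

open Classical in
/-- The type of a line: `1` for column type, `-1` for row type, `0` otherwise. -/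
noncomputable def dd (Φ : V →ₗ[K] Matrix (Fin 3) (Fin 3) K) (P : V → Prop) : ℤ :=
  if Cty Φ P then 1 else if Cty (tr Φ) P then -1 else 0

lemma cty_iff {W : Type} [AddCommGroup W] [Module K W] (Φ : W →ₗ[K] Matrix (Fin 3) (Fin 3) K)
    (ι : V →ₗ[K] W) (P : W → Prop) (g : V →ₗ[K] K) (h : ∀ x, P x ↔ ∃ y, ι y = x ∧ g y = 0) :
    Cty Φ P ↔ Cty (Φ ∘ₗ ι) (fun x => g x = 0) := by
  constructor
  · rintro ⟨v, hv, H⟩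
    exact ⟨v, hv, fun x hx => H _ ((h _).mpr ⟨x, rfl, hx⟩)⟩
  · rintro ⟨v, hv, H⟩
    refine ⟨v, hv, fun x hx => ?_⟩
    obtain ⟨y, rfl, hy⟩ := (h x).mp hx
    exact H y hy

open Classical in
lemma sum_aux {c1 c2 c3 r1 r2 r3 : Prop} (e1 : ¬ (c1 ∧ c2)) (e2 : ¬ (c2 ∧ c3)) (e3 : ¬ (c1 ∧ c3))
    (e4 : c1 → r2 ∨ r3) (e5 : c2 → r1 ∨ r3) (e6 : c3 → r1 ∨ r2)
    (f1 : ¬ (r1 ∧ r2)) (f2 : ¬ (r2 ∧ r3)) (f3 : ¬ (r1 ∧ r3))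
    (f4 : r1 → c2 ∨ c3) (f5 : r2 → c1 ∨ c3) (f6 : r3 → c1 ∨ c2) :
    (if c1 then (1 : ℤ) else if r1 then -1 else 0) + (if c2 then (1 : ℤ) else if r2 then -1 else 0)
      + (if c3 then (1 : ℤ) else if r3 then -1 else 0) = 0 := by
  by_cases h1 : c1 <;> by_cases h2 : c2 <;> by_cases h3 : c3 <;> simp_all
  all_goals
    by_cases k1 : r1 <;> by_cases k2 : r2 <;> by_cases k3 : r3 <;> simp_all

/-- In a plane section splitting into three lines, the types sum to zero. -/
lemma tri_sum [CharZero K] (Φ : (Fin 4 → K) →ₗ[K] Matrix (Fin 3) (Fin 3) K)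
    (hΦ : ∀ x, (Φ x).det = FF x) (ι : V →ₗ[K] (Fin 4 → K)) (g1 g2 g3 : V →ₗ[K] K)
    (P1 P2 P3 : (Fin 4 → K) → Prop)
    (hP1 : ∀ x, P1 x ↔ ∃ y, ι y = x ∧ g1 y = 0)
    (hP2 : ∀ x, P2 x ↔ ∃ y, ι y = x ∧ g2 y = 0)
    (hP3 : ∀ x, P3 x ↔ ∃ y, ι y = x ∧ g3 y = 0)
    (hF : ∀ y, FF (ι y) = g1 y * g2 y * g3 y)
    (h12 : ∃ y, ι y ≠ 0 ∧ g1 y = 0 ∧ g2 y = 0)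
    (h13 : ∃ y, ι y ≠ 0 ∧ g1 y = 0 ∧ g3 y = 0)
    (h23 : ∃ y, ι y ≠ 0 ∧ g2 y = 0 ∧ g3 y = 0)
    (k12 : ∃ y, g1 y ≠ 0 ∧ g2 y = 0)
    (k23 : ∃ y, g2 y ≠ 0 ∧ g3 y = 0)
    (k31 : ∃ y, g3 y ≠ 0 ∧ g1 y = 0) : dd Φ P1 + dd Φ P2 + dd Φ P3 = 0 := by
  obtain ⟨y12, a12, b12, c12⟩ := h12
  obtain ⟨y13, a13, b13, c13⟩ := h13
  obtain ⟨y23, a23, b23, c23⟩ := h23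
  obtain ⟨s1, p1, q1⟩ := k12
  obtain ⟨s2, p2, q2⟩ := k23
  obtain ⟨s3, p3, q3⟩ := k31
  obtain ⟨x0, n1, n2, n3⟩ := three_nonzero g1 g2 g3 s1 s2 s3 p1 p2 p3
  have hx0 : FF (ι x0) ≠ 0 := by
    rw [hF]
    exact mul_ne_zero (mul_ne_zero n1 n2) n3
  have gen : ∀ Ψ : (Fin 4 → K) →ₗ[K] Matrix (Fin 3) (Fin 3) K, (∀ x, (Ψ x).det = FF x) →
      (¬ (Cty Ψ P1 ∧ Cty Ψ P2)) ∧ (¬ (Cty Ψ P2 ∧ Cty Ψ P3)) ∧ (¬ (Cty Ψ P1 ∧ Cty Ψ P3)) ∧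
      (Cty Ψ P1 → Cty (tr Ψ) P2 ∨ Cty (tr Ψ) P3) ∧ (Cty Ψ P2 → Cty (tr Ψ) P1 ∨ Cty (tr Ψ) P3) ∧
      (Cty Ψ P3 → Cty (tr Ψ) P1 ∨ Cty (tr Ψ) P2) := by
    intro Ψ hΨ
    rw [cty_iff Ψ ι P1 g1 hP1, cty_iff Ψ ι P2 g2 hP2, cty_iff Ψ ι P3 g3 hP3,
      cty_iff (tr Ψ) ι P1 g1 hP1, cty_iff (tr Ψ) ι P2 g2 hP2, cty_iff (tr Ψ) ι P3 g3 hP3]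
    have hd : ∀ y, ((Ψ ∘ₗ ι) y).det = g1 y * g2 y * g3 y := fun y => by
      rw [← hF, ← hΨ]; rfl
    refine ⟨?_, ?_, ?_, ?_, ?_, ?_⟩
    · rintro ⟨u1, u2⟩
      exact excl Ψ hΨ ι g1 g2 y12 a12 b12 c12 s1 q1 p1 x0 hx0 u1 u2
    · rintro ⟨u1, u2⟩
      exact excl Ψ hΨ ι g2 g3 y23 a23 b23 c23 s2 q2 p2 x0 hx0 u1 u2
    · rintro ⟨u1, u2⟩
      exact excl Ψ hΨ ι g3 g1 y13 a13 c13 b13 s3 q3 p3 x0 hx0 u2 u1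
    · exact plane_step _ g1 g2 g3 s1 s2 s3 p1 p2 p3 hd
    · exact plane_step _ g2 g1 g3 s2 s1 s3 p2 p1 p3 (fun y => by rw [hd]; ring)
    · exact plane_step _ g3 g1 g2 s3 s1 s2 p3 p1 p2 (fun y => by rw [hd]; ring)
  obtain ⟨e1, e2, e3, e4, e5, e6⟩ := gen Φ hΦ
  obtain ⟨f1, f2, f3, f4, f5, f6⟩ := gen (tr Φ) (fun x => by rw [tr_apply, Matrix.det_transpose, hΦ])
  rw [tr_tr] at f4 f5 f6
  exact sum_aux e1 e2 e3 e4 e5 e6 f1 f2 f3 f4 f5 f6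

/-- A linear functional on `K^3` with given coefficients. -/
def lf (c0 c1 c2 : K) : (Fin 3 → K) →ₗ[K] K where
  toFun y := c0 * y 0 + c1 * y 1 + c2 * y 2
  map_add' x y := by simp; ring
  map_smul' c x := by simp; ring

lemma lf_apply (c0 c1 c2 : K) (y : Fin 3 → K) : lf c0 c1 c2 y = c0 * y 0 + c1 * y 1 + c2 * y 2 := rfl

/-- Lines of the Fermat cubic, for an arbitrary ordering of the variables. -/
def Ln (σ : Equiv.Perm (Fin 4)) (a b : K) (x : Fin 4 → K) : Prop :=
  x (σ 0) = a * x (σ 1) ∧ x (σ 2) = b * x (σ 3)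

/-- The map parametrizing the plane `x (σ 0) = a * x (σ 1)`. -/
def eckMap (σ : Equiv.Perm (Fin 4)) (a : K) : (Fin 3 → K) →ₗ[K] (Fin 4 → K) where
  toFun y := fun i => (![a * y 0, y 0, y 1, y 2] : Fin 4 → K) (σ.symm i)
  map_add' x y := by
    funext i
    simp only [Pi.add_apply]
    generalize σ.symm i = j
    fin_cases j <;> simp [mul_add]
  map_smul' c x := by
    funext i
    simp only [Pi.smul_apply, RingHom.id_apply]
    generalize σ.symm i = j
    fin_cases j <;> simp [mul_left_comm]

lemma eckMap_apply (σ : Equiv.Perm (Fin 4)) (a : K) (y : Fin 3 → K) (j : Fin 4) :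
    eckMap σ a y (σ j) = (![a * y 0, y 0, y 1, y 2] : Fin 4 → K) j := by
  simp [eckMap]

lemma eck_sum [CharZero K] (Φ : (Fin 4 → K) →ₗ[K] Matrix (Fin 3) (Fin 3) K)
    (hΦ : ∀ x, (Φ x).det = FF x) (σ : Equiv.Perm (Fin 4)) (a r0 r1 r2 : K) (ha : a ^ 3 = -1)
    (hr : ∀ u v : K, u ^ 3 + v ^ 3 = (u - r0 * v) * (u - r1 * v) * (u - r2 * v))
    (h01 : r0 ≠ r1) (h12 : r1 ≠ r2) (h02 : r0 ≠ r2) :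
    dd Φ (Ln σ a r0) + dd Φ (Ln σ a r1) + dd Φ (Ln σ a r2) = 0 := by
  have hP : ∀ r x, Ln σ a r x ↔ ∃ y, eckMap σ a y = x ∧ lf 0 1 (-r) y = 0 := by
    intro r x
    constructor
    · rintro ⟨h1, h2⟩
      refine ⟨![x (σ 1), x (σ 2), x (σ 3)], ?_, ?_⟩
      · funext i
        obtain ⟨j, rfl⟩ := σ.surjective i
        rw [eckMap_apply]
        fin_cases j <;> simp [h1]
      · simp [lf_apply, h2]
    · rintro ⟨y, rfl, hy⟩
      simp only [Ln, eckMap_apply]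
      simp only [lf_apply] at hy
      refine ⟨by simp, ?_⟩
      simp
      linear_combination hy
  have hne : eckMap σ a ![1, 0, 0] ≠ 0 := by
    intro h
    have := congrFun h (σ 1)
    rw [eckMap_apply] at this
    simp at this
  apply tri_sum Φ hΦ (eckMap σ a) (lf 0 1 (-r0)) (lf 0 1 (-r1)) (lf 0 1 (-r2)) _ _ _ (hP r0) (hP r1) (hP r2)
  · intro y
    have : FF (eckMap σ a y) = FF (![a * y 0, y 0, y 1, y 2] : Fin 4 → K) := by
      simp only [FF]
      rw [← Equiv.sum_comp σ]
      simp only [eckMap_apply]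
    rw [this, FF_eq]
    simp only [lf_apply]
    simp
    linear_combination (y 0) ^ 3 * ha + hr (y 1) (y 2)
  · exact ⟨![1, 0, 0], hne, by simp [lf_apply], by simp [lf_apply]⟩
  · exact ⟨![1, 0, 0], hne, by simp [lf_apply], by simp [lf_apply]⟩
  · exact ⟨![1, 0, 0], hne, by simp [lf_apply], by simp [lf_apply]⟩
  · refine ⟨![0, r1, 1], ?_, by simp [lf_apply]⟩
    simp [lf_apply]
    intro h
    exact h01 (by linear_combination -h)
  · refine ⟨![0, r2, 1], ?_, by simp [lf_apply]⟩
    simp [lf_apply]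
    intro h
    exact h12 (by linear_combination -h)
  · refine ⟨![0, r0, 1], ?_, by simp [lf_apply]⟩
    simp [lf_apply]
    intro h
    exact h02 (by linear_combination h)

/-- The map parametrizing a plane containing one line from each group. -/
def crossMap (a b c : K) : (Fin 3 → K) →ₗ[K] (Fin 4 → K) :=
  LinearMap.pi ![lf a c (-(b * c)), lf 1 0 0, lf 0 1 0, lf 0 0 1]

lemma crossMap_apply (a b c : K) (y : Fin 3 → K) :
    crossMap a b c y = ![a * y 0 + c * y 1 - b * c * y 2, y 0, y 1, y 2] := by
  funext i
  fin_cases i <;> simp [crossMap, lf_apply] ; ring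

/-- The three groups of lines. -/
def lnx (a b : K) (x : Fin 4 → K) : Prop := x 0 = a * x 1 ∧ x 2 = b * x 3
/-- Second group of lines. -/
def lny (a b : K) (x : Fin 4 → K) : Prop := x 0 = a * x 2 ∧ x 1 = b * x 3
/-- Third group of lines. -/
def lnz (a b : K) (x : Fin 4 → K) : Prop := x 0 = a * x 3 ∧ x 1 = b * x 2

lemma cross_sum [CharZero K] (Φ : (Fin 4 → K) →ₗ[K] Matrix (Fin 3) (Fin 3) K)
    (hΦ : ∀ x, (Φ x).det = FF x) (a b c : K) (ha : a ^ 3 = -1) (hb : b ^ 3 = -1) (hc : c ^ 3 = -1) :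
    dd Φ (lnx a b) + dd Φ (lny c (-(a ^ 2 * b * c))) + dd Φ (lnz (-(b * c)) (a ^ 2 * c)) = 0 := by
  have ha0 : a ≠ 0 := by rintro rfl; simp at ha
  have hb0 : b ≠ 0 := by rintro rfl; simp at hb
  have hc0 : c ≠ 0 := by rintro rfl; simp at hc
  have hmem : ∀ x : Fin 4 → K, x 0 = a * x 1 + c * x 2 - b * c * x 3 →
      crossMap a b c ![x 1, x 2, x 3] = x := by
    intro x hx
    rw [crossMap_apply]
    funext i
    fin_cases i <;> simp [hx]
  have h2 : (2 : K) ≠ 0 := two_ne_zero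
  have h3 : (3 : K) ≠ 0 := three_ne_zero
  have hne : ∀ y : Fin 3 → K, y ≠ 0 → crossMap a b c y ≠ 0 := by
    intro y hy h
    apply hy
    rw [crossMap_apply] at h
    funext i
    fin_cases i
    · simpa using congrFun h 1
    · simpa using congrFun h 2
    · simpa using congrFun h 3
  have nz : ∀ p q r : K, r ≠ 0 → (![p, q, r] : Fin 3 → K) ≠ 0 := by
    intro p q r hr h
    exact hr (by simpa using congrFun h 2)
  apply tri_sum Φ hΦ (crossMap a b c) (lf 0 c (-(b * c))) (lf a 0 (-(b * c))) (lf (3 * a) (3 * c) 0)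
  · intro x
    constructor
    · rintro ⟨e1, e2⟩
      refine ⟨![x 1, x 2, x 3], hmem x (by rw [e1, e2]; ring), ?_⟩
      simp [lf_apply, e2]
      ring
    · rintro ⟨y, rfl, hy⟩
      rw [crossMap_apply]
      simp only [lf_apply] at hy
      refine ⟨?_, ?_⟩
      · simp
        linear_combination hy
      · simp
        apply mul_left_cancel₀ hc0
        linear_combination hy
  · intro x
    constructor
    · rintro ⟨e1, e2⟩
      refine ⟨![x 1, x 2, x 3], hmem x (by rw [e1, e2]; linear_combination b * c * x 3 * ha), ?_⟩
      simp [lf_apply, e2]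
      linear_combination -b * c * x 3 * ha
    · rintro ⟨y, rfl, hy⟩
      rw [crossMap_apply]
      simp only [lf_apply] at hy
      refine ⟨?_, ?_⟩
      · simp
        linear_combination hy
      · simp
        linear_combination -a ^ 2 * hy + y 0 * ha
  · intro x
    constructor
    · rintro ⟨e1, e2⟩
      refine ⟨![x 1, x 2, x 3], hmem x (by rw [e1, e2]; linear_combination -c * x 2 * ha), ?_⟩
      simp [lf_apply, e2]
      linear_combination 3 * c * x 2 * ha
    · rintro ⟨y, rfl, hy⟩
      rw [crossMap_apply]
      simp only [lf_apply] at hy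
      have hy' : a * y 0 + c * y 1 = 0 := by
        apply mul_left_cancel₀ h3
        linear_combination hy
      refine ⟨?_, ?_⟩
      · simp
        linear_combination hy'
      · simp
        linear_combination -a ^ 2 * hy' + y 0 * ha
  · intro y
    rw [crossMap_apply, FF_eq]
    simp only [lf_apply]
    simp
    linear_combination (y 0) ^ 3 * ha + (y 1) ^ 3 * hc - (y 2) ^ 3 * (b ^ 3 * hc - hb)
  · refine ⟨![b * c, a * b, a], hne _ (nz _ _ _ ha0), ?_, ?_⟩ <;> simp [lf_apply] <;> ring
  · refine ⟨![-(b * c), a * b, a], hne _ (nz _ _ _ ha0), ?_, ?_⟩ <;> simp [lf_apply] <;> ring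
  · refine ⟨![b * c, - (a * b), a], hne _ (nz _ _ _ ha0), ?_, ?_⟩ <;> simp [lf_apply] <;> ring
  · refine ⟨![0, 1, 0], ?_, ?_⟩ <;> simp [lf_apply, hc0]
  · refine ⟨![0, 0, 1], ?_, ?_⟩ <;> simp [lf_apply, hc0, hb0]
  · refine ⟨![1, 0, 0], ?_, ?_⟩ <;> simp [lf_apply, ha0]

end Geometry

section Existence
variable {K : Type} [Field K]

lemma line_coeffs (α β γ δ : K) (e1 : 1 + α ^ 3 + γ ^ 3 = 0) (e2 : α ^ 2 * β + γ ^ 2 * δ = 0)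
    (e3 : α * β ^ 2 + γ * δ ^ 2 = 0) (e4 : 1 + β ^ 3 + δ ^ 3 = 0) :
    (α = 0 ∧ δ = 0 ∧ β ^ 3 = -1 ∧ γ ^ 3 = -1) ∨ (β = 0 ∧ γ = 0 ∧ α ^ 3 = -1 ∧ δ ^ 3 = -1) := by
  have main : α * β = 0 := by
    by_contra h
    have hα : α ≠ 0 := left_ne_zero_of_mul h
    have hβ : β ≠ 0 := right_ne_zero_of_mul h
    have h1 : γ * (α * δ - β * γ) * δ = 0 := by linear_combination α * e3 - β * e2
    have h2 : γ * δ ≠ 0 := by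
      intro h0
      have : α ^ 2 * β = 0 := by linear_combination e2 - γ * h0
      simp_all
    have hγ : γ ≠ 0 := left_ne_zero_of_mul h2
    have hδ : δ ≠ 0 := right_ne_zero_of_mul h2
    have h3 : α * δ - β * γ = 0 := by simpa [hγ, hδ] using h1
    have h4 : β * (α ^ 3 + γ ^ 3) = 0 := by linear_combination α * e2 - γ ^ 2 * h3
    have h5 : α ^ 3 + γ ^ 3 = 0 := by simpa [hβ] using h4
    have : (1 : K) = 0 := by linear_combination e1 - h5
    exact one_ne_zero this
  rcases mul_eq_zero.mp main with h | h
  · subst h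
    have hγ : γ ^ 3 = -1 := by linear_combination e1
    have hγ0 : γ ≠ 0 := by rintro rfl; simp at hγ
    have hδ : δ = 0 := by
      have : γ ^ 2 * δ = 0 := by linear_combination e2
      simpa [hγ0] using this
    subst hδ
    exact Or.inl ⟨rfl, rfl, by linear_combination e4, hγ⟩
  · subst h
    have hδ : δ ^ 3 = -1 := by linear_combination e4
    have hδ0 : δ ≠ 0 := by rintro rfl; simp at hδ
    have hγ : γ = 0 := by
      have : γ * δ ^ 2 = 0 := by linear_combination e3
      simpa [hδ0] using this
    subst hγ
    exact Or.inr ⟨rfl, rfl, by linear_combination e1, hδ⟩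

/-- Being in the span of two vectors. -/
def Sp (X Y : Fin 4 → K) (x : Fin 4 → K) : Prop := ∃ s t : K, x = s • X + t • Y

lemma line_of_minor [CharZero K] (X Y : Fin 4 → K) (hF : ∀ s t : K, FF (s • X + t • Y) = 0)
    (i j k l : Fin 4) (hall : ∀ m, m = i ∨ m = j ∨ m = k ∨ m = l)
    (hs : ∀ x : Fin 4 → K, FF x = x i ^ 3 + x j ^ 3 + x k ^ 3 + x l ^ 3)
    (hm : X i * Y j - X j * Y i ≠ 0) :
    ∃ u v : K, u ^ 3 = -1 ∧ v ^ 3 = -1 ∧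
      ((∀ x : Fin 4 → K, x k = u * x j → x l = v * x i → Sp X Y x) ∨
       (∀ x : Fin 4 → K, x k = u * x i → x l = v * x j → Sp X Y x)) := by
  obtain ⟨Δ, hΔ⟩ : ∃ Δ : K, Δ * (X i * Y j - X j * Y i) = 1 := ⟨_, inv_mul_cancel₀ hm⟩
  have hF' : ∀ s t : K, s ^ 3 + t ^ 3 + (s * (Δ * (Y j * X k - X j * Y k)) + t * (Δ * (X i * Y k - Y i * X k))) ^ 3
      + (s * (Δ * (Y j * X l - X j * Y l)) + t * (Δ * (X i * Y l - Y i * X l))) ^ 3 = 0 := by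
    intro s t
    have := hF (Δ * (s * Y j - t * Y i)) (Δ * (t * X i - s * X j))
    rw [hs] at this
    simp only [Pi.add_apply, Pi.smul_apply, smul_eq_mul] at this
    have e1 : Δ * (s * Y j - t * Y i) * X i + Δ * (t * X i - s * X j) * Y i = s := by
      linear_combination s * hΔ
    have e2 : Δ * (s * Y j - t * Y i) * X j + Δ * (t * X i - s * X j) * Y j = t := by
      linear_combination t * hΔ
    rw [e1, e2] at this
    rw [← this]
    ring
  have hmem : ∀ x : Fin 4 → K,
      x k = x i * (Δ * (Y j * X k - X j * Y k)) + x j * (Δ * (X i * Y k - Y i * X k)) →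
      x l = x i * (Δ * (Y j * X l - X j * Y l)) + x j * (Δ * (X i * Y l - Y i * X l)) → Sp X Y x := by
    intro x hk hl
    refine ⟨Δ * (x i * Y j - x j * Y i), Δ * (x j * X i - x i * X j), ?_⟩
    funext m
    simp only [Pi.add_apply, Pi.smul_apply, smul_eq_mul]
    rcases hall m with rfl | rfl | rfl | rfl
    · linear_combination -x m * hΔ
    · linear_combination -x m * hΔ
    · rw [hk]; ring
    · rw [hl]; ring
  set α := Δ * (Y j * X k - X j * Y k)
  set β := Δ * (X i * Y k - Y i * X k)
  set γ := Δ * (Y j * X l - X j * Y l)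
  set δ := Δ * (X i * Y l - Y i * X l)
  have q1 := hF' 1 0
  have q2 := hF' 0 1
  have q3 := hF' 1 1
  have q4 := hF' 1 (-1)
  have h6 : (6 : K) ≠ 0 := by norm_num
  have e2 : α ^ 2 * β + γ ^ 2 * δ = 0 := by
    apply mul_left_cancel₀ h6
    linear_combination q3 - q4 - 2 * q2
  have e3 : α * β ^ 2 + γ * δ ^ 2 = 0 := by
    apply mul_left_cancel₀ h6
    linear_combination q3 + q4 - 2 * q1
  rcases line_coeffs α β γ δ (by linear_combination q1) e2 e3 (by linear_combination q2) with
    ⟨hα, hδ, hβ, hγ⟩ | ⟨hβ, hγ, hα, hδ⟩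
  · refine ⟨β, γ, hβ, hγ, Or.inl (fun x hk hl => hmem x ?_ ?_)⟩
    · rw [hk, hα]; ring
    · rw [hl, hδ]; ring
  · refine ⟨α, δ, hα, hδ, Or.inr (fun x hk hl => hmem x ?_ ?_)⟩
    · rw [hk, hβ]; ring
    · rw [hl, hγ]; ring

lemma flip_root {u x y : K} (hu : u ^ 3 = -1) (h : x = -u ^ 2 * y) : y = u * x := by
  rw [h]; linear_combination y * hu

lemma flip_cube {u : K} (hu : u ^ 3 = -1) : (-u ^ 2) ^ 3 = -1 := by
  linear_combination (-u ^ 3 + 1) * hu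

/-- A two dimensional subspace on which the Fermat cubic vanishes is one of the 27 lines. -/
lemma line_class [CharZero K] (X Y : Fin 4 → K) (hind : ∀ s t : K, s • X + t • Y = 0 → s = 0 ∧ t = 0)
    (hF : ∀ s t : K, FF (s • X + t • Y) = 0) :
    ∃ a b : K, a ^ 3 = -1 ∧ b ^ 3 = -1 ∧
      ((∀ x, lnx a b x → Sp X Y x) ∨ (∀ x, lny a b x → Sp X Y x) ∨ (∀ x, lnz a b x → Sp X Y x)) := by
  by_cases m01 : X 0 * Y 1 - X 1 * Y 0 ≠ 0
  · obtain ⟨u, v, hu, hv, H | H⟩ := line_of_minor X Y hF 0 1 2 3 (by decide) FF_eq m01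
    · exact ⟨-v ^ 2, -u ^ 2, flip_cube hv, flip_cube hu, Or.inr (Or.inr (fun x hx =>
        H x (flip_root hu hx.2) (flip_root hv hx.1)))⟩
    · exact ⟨-u ^ 2, -v ^ 2, flip_cube hu, flip_cube hv, Or.inr (Or.inl (fun x hx =>
        H x (flip_root hu hx.1) (flip_root hv hx.2)))⟩
  by_cases m02 : X 0 * Y 2 - X 2 * Y 0 ≠ 0
  · obtain ⟨u, v, hu, hv, H | H⟩ := line_of_minor X Y hF 0 2 1 3 (by decide)
      (fun x => by rw [FF_eq]; ring) m02
    · exact ⟨-v ^ 2, u, flip_cube hv, hu, Or.inr (Or.inr (fun x hx =>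
        H x hx.2 (flip_root hv hx.1)))⟩
    · exact ⟨-u ^ 2, -v ^ 2, flip_cube hu, flip_cube hv, Or.inl (fun x hx =>
        H x (flip_root hu hx.1) (flip_root hv hx.2))⟩
  by_cases m03 : X 0 * Y 3 - X 3 * Y 0 ≠ 0
  · obtain ⟨u, v, hu, hv, H | H⟩ := line_of_minor X Y hF 0 3 1 2 (by decide)
      (fun x => by rw [FF_eq]; ring) m03
    · exact ⟨-v ^ 2, u, flip_cube hv, hu, Or.inr (Or.inl (fun x hx =>
        H x hx.2 (flip_root hv hx.1)))⟩
    · exact ⟨-u ^ 2, v, flip_cube hu, hv, Or.inl (fun x hx =>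
        H x (flip_root hu hx.1) hx.2)⟩
  by_cases m12 : X 1 * Y 2 - X 2 * Y 1 ≠ 0
  · obtain ⟨u, v, hu, hv, H | H⟩ := line_of_minor X Y hF 1 2 0 3 (by decide)
      (fun x => by rw [FF_eq]; ring) m12
    · exact ⟨u, -v ^ 2, hu, flip_cube hv, Or.inr (Or.inl (fun x hx =>
        H x hx.1 (flip_root hv hx.2)))⟩
    · exact ⟨u, -v ^ 2, hu, flip_cube hv, Or.inl (fun x hx =>
        H x hx.1 (flip_root hv hx.2))⟩
  by_cases m13 : X 1 * Y 3 - X 3 * Y 1 ≠ 0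
  · obtain ⟨u, v, hu, hv, H | H⟩ := line_of_minor X Y hF 1 3 0 2 (by decide)
      (fun x => by rw [FF_eq]; ring) m13
    · exact ⟨u, -v ^ 2, hu, flip_cube hv, Or.inr (Or.inr (fun x hx =>
        H x hx.1 (flip_root hv hx.2)))⟩
    · exact ⟨u, v, hu, hv, Or.inl (fun x hx => H x hx.1 hx.2)⟩
  by_cases m23 : X 2 * Y 3 - X 3 * Y 2 ≠ 0
  · obtain ⟨u, v, hu, hv, H | H⟩ := line_of_minor X Y hF 2 3 0 1 (by decide)
      (fun x => by rw [FF_eq]; ring) m23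
    · exact ⟨u, v, hu, hv, Or.inr (Or.inr (fun x hx => H x hx.1 hx.2))⟩
    · exact ⟨u, v, hu, hv, Or.inr (Or.inl (fun x hx => H x hx.1 hx.2))⟩
  exfalso
  push Not at m01 m02 m03 m12 m13 m23
  have hX : ∀ j, X j = 0 := by
    intro j
    have hz : (-(Y j)) • X + X j • Y = 0 := by
      funext m
      simp only [Pi.add_apply, Pi.smul_apply, smul_eq_mul, Pi.zero_apply]
      fin_cases j <;> fin_cases m <;> simp <;> grind
    exact (hind _ _ hz).2
  have := hind 1 0 (by funext m; simp [hX])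
  exact one_ne_zero this.1

/-- A binary quadratic form over an algebraically closed field has a nontrivial zero. -/
lemma quad_zero [IsAlgClosed K] [CharZero K] (α β γ : K) :
    ∃ s t : K, (s ≠ 0 ∨ t ≠ 0) ∧ α * s ^ 2 + β * s * t + γ * t ^ 2 = 0 := by
  by_cases h : α = 0
  · exact ⟨1, 0, Or.inl one_ne_zero, by rw [h]; ring⟩
  · obtain ⟨z, hz⟩ := IsAlgClosed.exists_pow_nat_eq (discrim α β γ) (n := 2) (by norm_num)
    obtain ⟨x, hx⟩ := exists_quadratic_eq_zero h ⟨z, by rw [← hz]; ring⟩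
    exact ⟨x, 1, Or.inr one_ne_zero, by linear_combination hx⟩

lemma left_ker2 (a b c d : K) (h : a * d - b * c = 0) :
    ∃ p q : K, (p ≠ 0 ∨ q ≠ 0) ∧ p * a + q * c = 0 ∧ p * b + q * d = 0 := by
  by_cases h1 : c ≠ 0 ∨ -a ≠ 0
  · exact ⟨c, -a, h1, by ring, by linear_combination -h⟩
  by_cases h2 : d ≠ 0 ∨ -b ≠ 0
  · exact ⟨d, -b, h2, by linear_combination h, by ring⟩
  push Not at h1 h2
  exact ⟨1, 0, Or.inl one_ne_zero, by linear_combination -h1.2, by linear_combination -h2.2⟩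

/-- There is a line of column type or of row type. -/
lemma exists_type [IsAlgClosed K] [CharZero K] (Φ : (Fin 4 → K) →ₗ[K] Matrix (Fin 3) (Fin 3) K)
    (hΦ : ∀ x, (Φ x).det = FF x) :
    Cty Φ (lnx (-1) (-1)) ∨ ∃ a b : K, a ^ 3 = -1 ∧ b ^ 3 = -1 ∧
      (Cty (tr Φ) (lnx a b) ∨ Cty (tr Φ) (lny a b) ∨ Cty (tr Φ) (lnz a b)) := by
  by_cases hC : Cty Φ (lnx (-1) (-1))
  · exact Or.inl hC
  by_cases hR : Cty (tr Φ) (lnx (-1) (-1))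
  · exact Or.inr ⟨-1, -1, by norm_num, by norm_num, Or.inl hR⟩
  right
  obtain ⟨P, hP⟩ : ∃ P : Fin 4 → K, P = ![-1, 1, 0, 0] := ⟨_, rfl⟩
  obtain ⟨Q, hQ⟩ : ∃ Q : Fin 4 → K, Q = ![0, 0, -1, 1] := ⟨_, rfl⟩
  have hsp : ∀ x : Fin 4 → K, lnx (-1) (-1) x → x = x 1 • P + x 3 • Q := by
    rintro x ⟨h1, h2⟩
    funext i
    rw [hP, hQ]
    fin_cases i <;> simp [h1, h2]
  have hFPQ : ∀ s t : K, FF (s • P + t • Q) = 0 := by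
    intro s t
    rw [FF_eq, hP, hQ]
    simp
    ring
  have hFP : FF P = 0 := by simpa using hFPQ 1 0
  obtain ⟨v0, hv0, hAv⟩ := Matrix.exists_mulVec_eq_zero_iff.mpr ((hΦ P).trans hFP)
  obtain ⟨w0, hw0, hAw⟩ := Matrix.exists_vecMul_eq_zero_iff.mpr ((hΦ P).trans hFP)
  obtain ⟨G, hG, hGv⟩ := exists_first_col v0 hv0
  obtain ⟨U', hU', hUw⟩ := exists_first_col w0 hw0
  obtain ⟨U, hU, hUw⟩ : ∃ U : Matrix (Fin 3) (Fin 3) K, U.det ≠ 0 ∧ ∀ i, U 0 i = w0 i :=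
    ⟨U'ᵀ, by rwa [Matrix.det_transpose], hUw⟩
  set ψ := conj2 U G Φ with hψ
  have hdψ : ∀ x, (ψ x).det = U.det * G.det * FF x := by
    intro x
    rw [hψ, conj2_apply, Matrix.det_mul, Matrix.det_mul, hΦ]
    ring
  have hcol : ∀ x i, ψ x i 0 = (U *ᵥ (Φ x *ᵥ v0)) i := by
    intro x i
    rw [hψ, conj2_apply, Matrix.mul_assoc, Matrix.mul_apply]
    simp only [Matrix.mulVec, dotProduct, Matrix.mul_apply, hGv]
  have hrow : ∀ x i, ψ x 0 i = ((w0 ᵥ* Φ x) ᵥ* G) i := by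
    intro x i
    rw [hψ, conj2_apply, Matrix.mul_apply]
    simp only [Matrix.vecMul, dotProduct, Matrix.mul_apply, hUw]
  have hA0 : ∀ i, ψ P i 0 = 0 := by intro i; rw [hcol, hAv]; simp
  have hA1 : ∀ i, ψ P 0 i = 0 := by intro i; rw [hrow, hAw]; simp
  have hA' : ψ P 1 1 * ψ P 2 2 - ψ P 1 2 * ψ P 2 1 ≠ 0 := by
    intro h0
    obtain ⟨p, q, hpq, e1, e2⟩ := left_ker2 (ψ P 1 1) (ψ P 2 1) (ψ P 1 2) (ψ P 2 2)
      (by linear_combination h0)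
    have hker : ψ P *ᵥ ![0, p, q] = 0 := by
      funext i
      fin_cases i
      · simp [Matrix.mulVec, dotProduct, Fin.sum_univ_three, hA1]
      · simp [Matrix.mulVec, dotProduct, Fin.sum_univ_three]; linear_combination e1
      · simp [Matrix.mulVec, dotProduct, Fin.sum_univ_three]; linear_combination e2
    have hker2 : Φ P *ᵥ (G *ᵥ ![0, p, q]) = 0 := by
      have : U⁻¹ *ᵥ (ψ P *ᵥ ![0, p, q]) = 0 := by rw [hker, Matrix.mulVec_zero]
      rw [hψ, conj2_apply, Matrix.mulVec_mulVec, Matrix.mul_assoc, ← Matrix.mul_assoc U⁻¹,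
        Matrix.nonsing_inv_mul _ (by simpa using hU), Matrix.one_mul] at this
      rw [Matrix.mulVec_mulVec]
      exact this
    have hP0 : P = 0 := by
      refine smooth_pt Φ hΦ P v0 _ hv0 ?_ hAv hker2
      intro k hk
      have hv0' : v0 = G *ᵥ ![1, 0, 0] := by
        funext i
        simp [Matrix.mulVec, dotProduct, Fin.sum_univ_three, hGv]
      rw [hv0', ← Matrix.mulVec_smul] at hk
      have : G⁻¹ *ᵥ (G *ᵥ ![0, p, q]) = G⁻¹ *ᵥ (G *ᵥ (k • ![1, 0, 0])) := by rw [hk]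
      rw [Matrix.mulVec_mulVec, Matrix.mulVec_mulVec, Matrix.nonsing_inv_mul _ (by simpa using hG),
        Matrix.one_mulVec, Matrix.one_mulVec] at this
      have e1 := congrFun this 1
      have e2 := congrFun this 2
      simp at e1 e2
      rcases hpq with h | h
      · exact h e1
      · exact h e2
    have := congrFun hP0 1
    rw [hP] at this
    simp at this
  -- consequences of the vanishing determinant on the line
  have hdet : ∀ s t : K, (s • ψ P + t • ψ Q).det = 0 := by
    intro s t
    rw [← map_smul, ← map_smul, ← map_add, hdψ, hFPQ, mul_zero]
  have hd1 := hdet 1 1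
  have hd2 := hdet 1 (-1)
  have hd3 := hdet 0 1
  have hd4 := hdet 1 2
  simp only [Matrix.det_fin_three, Matrix.add_apply, Matrix.smul_apply, smul_eq_mul, hA0, hA1] at hd1 hd2 hd3 hd4
  have h2 : (2 : K) ≠ 0 := two_ne_zero
  have b00 : ψ Q 0 0 = 0 := by
    have : 2 * ((ψ P 1 1 * ψ P 2 2 - ψ P 1 2 * ψ P 2 1) * ψ Q 0 0) = 0 := by
      linear_combination hd1 - hd2 - 2 * hd3
    simpa [hA'] using this
  obtain ⟨c1, hc1⟩ : ∃ c, c = ψ Q 1 0 := ⟨_, rfl⟩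
  obtain ⟨c2, hc2⟩ : ∃ c, c = ψ Q 2 0 := ⟨_, rfl⟩
  obtain ⟨x1, hx1⟩ : ∃ c, c = ψ P 2 2 * c1 - ψ P 1 2 * c2 := ⟨_, rfl⟩
  obtain ⟨x2, hx2⟩ : ∃ c, c = ψ P 1 1 * c2 - ψ P 2 1 * c1 := ⟨_, rfl⟩
  have hrx : ψ Q 0 1 * x1 + ψ Q 0 2 * x2 = 0 := by
    have : 2 * (ψ Q 0 1 * x1 + ψ Q 0 2 * x2) = 0 := by
      rw [hx1, hx2, hc1, hc2]
      rw [b00] at hd1 hd2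
      linear_combination -hd1 - hd2
    exact (mul_eq_zero.mp this).resolve_left h2
  have hry : ψ Q 0 1 * (ψ Q 2 2 * c1 - ψ Q 1 2 * c2) + ψ Q 0 2 * (ψ Q 1 1 * c2 - ψ Q 2 1 * c1) = 0 := by
    rw [b00] at hd3
    rw [hc1, hc2]
    linear_combination -hd3
  have hcn : c1 ≠ 0 ∨ c2 ≠ 0 := by
    by_contra hcon
    push Not at hcon
    apply hC
    refine ⟨v0, hv0, fun x hx => ?_⟩
    have hz : U *ᵥ (Φ Q *ᵥ v0) = 0 := by
      funext i
      rw [← hcol]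
      fin_cases i
      · exact b00
      · exact hc1 ▸ hcon.1
      · exact hc2 ▸ hcon.2
    have hz2 : Φ Q *ᵥ v0 = 0 := by
      have : U⁻¹ *ᵥ (U *ᵥ (Φ Q *ᵥ v0)) = 0 := by rw [hz, Matrix.mulVec_zero]
      rwa [Matrix.mulVec_mulVec, Matrix.nonsing_inv_mul _ (by simpa using hU), Matrix.one_mulVec] at this
    rw [hsp x hx, map_add, map_smul, map_smul, Matrix.add_mulVec, Matrix.smul_mulVec,
      Matrix.smul_mulVec, hAv, hz2]
    simp
  have hrn : ψ Q 0 1 ≠ 0 ∨ ψ Q 0 2 ≠ 0 := by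
    by_contra hcon
    push Not at hcon
    apply hR
    refine ⟨w0, hw0, fun x hx => ?_⟩
    have hz : (w0 ᵥ* Φ Q) ᵥ* G = 0 := by
      funext i
      rw [← hrow]
      fin_cases i
      · exact b00
      · exact hcon.1
      · exact hcon.2
    have hz2 : w0 ᵥ* Φ Q = 0 := by
      by_contra hne
      exact vecMul_ne_zero' G hG _ hne hz
    rw [tr_apply, Matrix.mulVec_transpose, hsp x hx, map_add, map_smul, map_smul, Matrix.vecMul_add,
      Matrix.vecMul_smul, Matrix.vecMul_smul, hAw, hz2]
    simp
  have hpar : (ψ Q 2 2 * c1 - ψ Q 1 2 * c2) * x2 - (ψ Q 1 1 * c2 - ψ Q 2 1 * c1) * x1 = 0 := by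
    rcases hrn with h | h
    · apply mul_left_cancel₀ h
      linear_combination x2 * hry - (ψ Q 1 1 * c2 - ψ Q 2 1 * c1) * hrx
    · apply mul_left_cancel₀ h
      linear_combination -x1 * hry + (ψ Q 2 2 * c1 - ψ Q 1 2 * c2) * hrx
  have hxn : x1 ≠ 0 ∨ x2 ≠ 0 := by
    by_contra hcon
    push Not at hcon
    have e1 : (ψ P 1 1 * ψ P 2 2 - ψ P 1 2 * ψ P 2 1) * c1 = 0 := by
      linear_combination ψ P 1 1 * (hcon.1 - hx1) + ψ P 1 2 * (hcon.2 - hx2)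
    have e2 : (ψ P 1 1 * ψ P 2 2 - ψ P 1 2 * ψ P 2 1) * c2 = 0 := by
      linear_combination ψ P 2 1 * (hcon.1 - hx1) + ψ P 2 2 * (hcon.2 - hx2)
    rcases hcn with h | h
    · exact h ((mul_eq_zero.mp e1).resolve_left hA')
    · exact h ((mul_eq_zero.mp e2).resolve_left hA')
  -- the 2 by 2 block vanishing on the line
  obtain ⟨n11, hn11⟩ : ∃ n : (Fin 4 → K) →ₗ[K] K, ∀ x, n x = ψ x 0 0 := ⟨ent ψ 0 0, fun _ => rfl⟩
  obtain ⟨n12, hn12⟩ : ∃ n : (Fin 4 → K) →ₗ[K] K, ∀ x, n x = ψ x 0 1 * x1 + ψ x 0 2 * x2 :=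
    ⟨x1 • ent ψ 0 1 + x2 • ent ψ 0 2, fun x => by simp [ent_apply]; ring⟩
  obtain ⟨n21, hn21⟩ : ∃ n : (Fin 4 → K) →ₗ[K] K, ∀ x, n x = c1 * ψ x 2 0 - c2 * ψ x 1 0 :=
    ⟨c1 • ent ψ 2 0 - c2 • ent ψ 1 0, fun x => by simp [ent_apply]⟩
  obtain ⟨n22, hn22⟩ : ∃ n : (Fin 4 → K) →ₗ[K] K, ∀ x, n x =
      c1 * (ψ x 2 1 * x1 + ψ x 2 2 * x2) - c2 * (ψ x 1 1 * x1 + ψ x 1 2 * x2) :=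
    ⟨c1 • (x1 • ent ψ 2 1 + x2 • ent ψ 2 2) - c2 • (x1 • ent ψ 1 1 + x2 • ent ψ 1 2),
      fun x => by simp [ent_apply]; ring⟩
  obtain ⟨s, t, hst, hq⟩ := quad_zero
    (n11 ![1, 0, 0, 0] * n22 ![1, 0, 0, 0] - n12 ![1, 0, 0, 0] * n21 ![1, 0, 0, 0])
    (n11 ![1, 0, 0, 0] * n22 ![0, 0, 1, 0] + n11 ![0, 0, 1, 0] * n22 ![1, 0, 0, 0]
      - n12 ![1, 0, 0, 0] * n21 ![0, 0, 1, 0] - n12 ![0, 0, 1, 0] * n21 ![1, 0, 0, 0])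
    (n11 ![0, 0, 1, 0] * n22 ![0, 0, 1, 0] - n12 ![0, 0, 1, 0] * n21 ![0, 0, 1, 0])
  obtain ⟨z, hz⟩ : ∃ z : Fin 4 → K, z = s • ![1, 0, 0, 0] + t • ![0, 0, 1, 0] := ⟨_, rfl⟩
  have hNz : n11 z * n22 z - n12 z * n21 z = 0 := by
    rw [hz]
    simp only [map_add, map_smul, smul_eq_mul]
    linear_combination hq
  obtain ⟨l, m, hlm, k1, k2⟩ := left_ker2 _ _ _ _ hNz
  obtain ⟨w, hw⟩ : ∃ w : Fin 3 → K, w = ![l, -(m * c2), m * c1] := ⟨_, rfl⟩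
  have hwn : w ≠ 0 := by
    intro h0
    rw [hw] at h0
    have e0 := congrFun h0 0
    have e1 := congrFun h0 1
    have e2 := congrFun h0 2
    simp at e0 e1 e2
    rcases hlm with h | h
    · exact h e0
    · rcases hcn with h' | h'
      · exact h' (e2.resolve_left h)
      · exact h' (e1.resolve_left h)
  have goodP : l * n11 P + m * n21 P = 0 ∧ l * n12 P + m * n22 P = 0 := by
    rw [hn11, hn12, hn21, hn22, hA0, hA0, hA0, hA1, hA1, hx1, hx2]
    constructor <;> ring
  have goodQ : l * n11 Q + m * n21 Q = 0 ∧ l * n12 Q + m * n22 Q = 0 := by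
    rw [hn11, hn12, hn21, hn22, b00, hrx, ← hc1, ← hc2]
    constructor
    · ring
    · linear_combination m * hpar
  have good : ∀ a b c : K, l * n11 (a • P + b • Q + c • z) + m * n21 (a • P + b • Q + c • z) = 0 ∧
      l * n12 (a • P + b • Q + c • z) + m * n22 (a • P + b • Q + c • z) = 0 := by
    intro a b c
    simp only [map_add, map_smul, smul_eq_mul]
    constructor
    · linear_combination a * goodP.1 + b * goodQ.1 + c * k1
    · linear_combination a * goodP.2 + b * goodQ.2 + c * k2
  obtain ⟨ζ, hζ⟩ : ∃ ζ : (Fin 4 → K) →ₗ[K] K, ∀ a b c : K, ζ (a • P + b • Q + c • z) = 0 →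
      w ᵥ* ψ (a • P + b • Q + c • z) = 0 := by
    have fin : ∀ y, l * n11 y + m * n21 y = 0 →
        (w ᵥ* ψ y) 1 = 0 → (w ᵥ* ψ y) 2 = 0 → w ᵥ* ψ y = 0 := by
      intro y h0 h1 h2
      funext i
      fin_cases i
      · rw [hn11, hn21] at h0
        simp [hw, Matrix.vecMul, dotProduct, Fin.sum_univ_three]
        linear_combination h0
      · exact h1
      · exact h2
    have rel : ∀ y, l * n12 y + m * n22 y = 0 → (w ᵥ* ψ y) 1 * x1 + (w ᵥ* ψ y) 2 * x2 = 0 := by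
      intro y h
      rw [hn12, hn22] at h
      simp [hw, Matrix.vecMul, dotProduct, Fin.sum_univ_three]
      linear_combination h
    have comp : ∀ j y, (w 0 • ent ψ 0 j + w 1 • ent ψ 1 j + w 2 • ent ψ 2 j) y = (w ᵥ* ψ y) j := by
      intro j y
      simp [Matrix.vecMul, dotProduct, Fin.sum_univ_three, ent_apply]
    by_cases hx : x1 = 0
    · have hx2n : x2 ≠ 0 := hxn.resolve_left (fun h => h hx)
      refine ⟨w 0 • ent ψ 0 1 + w 1 • ent ψ 1 1 + w 2 • ent ψ 2 1, fun a b c h => ?_⟩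
      rw [comp] at h
      obtain ⟨g1, g2⟩ := good a b c
      refine fin _ g1 h ?_
      have := rel _ g2
      rw [h] at this
      simpa [hx2n] using this
    · refine ⟨w 0 • ent ψ 0 2 + w 1 • ent ψ 1 2 + w 2 • ent ψ 2 2, fun a b c h => ?_⟩
      rw [comp] at h
      obtain ⟨g1, g2⟩ := good a b c
      refine fin _ g1 ?_ h
      have := rel _ g2
      rw [h] at this
      simpa [hx] using this
  have hindep : ∀ a b c : K, a • P + b • Q + c • z = 0 → a = 0 ∧ b = 0 ∧ c = 0 := by
    intro a b c h
    have e0 := congrFun h 0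
    have e1 := congrFun h 1
    have e2 := congrFun h 2
    have e3 := congrFun h 3
    rw [hP, hQ, hz] at e0 e1 e2 e3
    simp at e0 e1 e2 e3
    refine ⟨e1, e3, ?_⟩
    rw [e1] at e0
    rw [e3] at e2
    simp at e0 e2
    rcases hst with h | h
    · exact e0.resolve_right h
    · exact e2.resolve_right h
  -- conclude from two independent vectors in the kernel
  have finish : ∀ X Y : Fin 4 → K, (∀ s t : K, s • X + t • Y = 0 → s = 0 ∧ t = 0) →
      (∀ s t : K, w ᵥ* ψ (s • X + t • Y) = 0) → ∃ a b : K, a ^ 3 = -1 ∧ b ^ 3 = -1 ∧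
      (Cty (tr Φ) (lnx a b) ∨ Cty (tr Φ) (lny a b) ∨ Cty (tr Φ) (lnz a b)) := by
    intro X Y hi hker
    have hF : ∀ s t : K, FF (s • X + t • Y) = 0 := by
      intro s t
      have := Matrix.exists_vecMul_eq_zero_iff.mp ⟨w, hwn, hker s t⟩
      rw [hdψ] at this
      exact (mul_eq_zero.mp this).resolve_left (mul_ne_zero hU hG)
    have mk : ∀ L : (Fin 4 → K) → Prop, (∀ x, L x → Sp X Y x) → Cty (tr Φ) L := by
      intro L hL
      refine ⟨w ᵥ* U, vecMul_ne_zero' U hU w hwn, fun x hx => ?_⟩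
      obtain ⟨s, t, rfl⟩ := hL x hx
      rw [tr_apply]
      exact left_kernel_back U G _ hG w (hker s t)
    obtain ⟨a, b, ha, hb, h | h | h⟩ := line_class X Y hi hF
    · exact ⟨a, b, ha, hb, Or.inl (mk _ h)⟩
    · exact ⟨a, b, ha, hb, Or.inr (Or.inl (mk _ h))⟩
    · exact ⟨a, b, ha, hb, Or.inr (Or.inr (mk _ h))⟩
  by_cases hp : ζ P = 0
  · by_cases hq : ζ Q = 0
    · refine finish P Q (fun a b h => ?_) (fun a b => ?_)
      · obtain ⟨e1, e2, -⟩ := hindep a b 0 (by rw [h]; simp)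
        exact ⟨e1, e2⟩
      · have := hζ a b 0 (by simp [hp, hq])
        simpa using this
    · refine finish P (ζ z • Q - ζ Q • z) (fun a b h => ?_) (fun a b => ?_)
      · obtain ⟨e1, e2, e3⟩ := hindep a (b * ζ z) (-(b * ζ Q)) (by rw [← h]; module)
        refine ⟨e1, ?_⟩
        simpa [hq] using e3
      · have e : a • P + b • (ζ z • Q - ζ Q • z) = a • P + (b * ζ z) • Q + (-(b * ζ Q)) • z := by module
        rw [e]
        apply hζ
        simp only [map_add, map_smul, smul_eq_mul, hp]
        ring
  · refine finish (ζ Q • P - ζ P • Q) (ζ z • P - ζ P • z) (fun a b h => ?_) (fun a b => ?_)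
    · obtain ⟨e1, e2, e3⟩ := hindep (a * ζ Q + b * ζ z) (-(a * ζ P)) (-(b * ζ P)) (by rw [← h]; module)
      constructor
      · simpa [hp] using e2
      · simpa [hp] using e3
    · have e : a • (ζ Q • P - ζ P • Q) + b • (ζ z • P - ζ P • z)
          = (a * ζ Q + b * ζ z) • P + (-(a * ζ P)) • Q + (-(b * ζ P)) • z := by module
      rw [e]
      apply hζ
      simp only [map_add, map_smul, smul_eq_mul]
      ring

end Existence

section NormalForm
variable {K : Type} [Field K]

/-- The Fermat cubic does not vanish on a hyperplane. -/
lemma FF_hyper [CharZero K] (l : (Fin 4 → K) →ₗ[K] K) : ∃ x, l x = 0 ∧ FF x ≠ 0 := by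
  by_contra hcon
  push Not at hcon
  obtain ⟨l0, h0⟩ : ∃ c, c = l ![1, 0, 0, 0] := ⟨_, rfl⟩
  obtain ⟨l1, h1⟩ : ∃ c, c = l ![0, 1, 0, 0] := ⟨_, rfl⟩
  obtain ⟨l2, h2⟩ : ∃ c, c = l ![0, 0, 1, 0] := ⟨_, rfl⟩
  have key : ∀ a b c : K, a * l0 + b * l1 + c * l2 = 0 → a ^ 3 + b ^ 3 + c ^ 3 = 0 := by
    intro a b c h
    have e : (![a, b, c, 0] : Fin 4 → K) = a • ![1, 0, 0, 0] + b • ![0, 1, 0, 0] + c • ![0, 0, 1, 0] := by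
      funext i; fin_cases i <;> simp
    have := hcon ![a, b, c, 0] (by
      rw [e]; simp only [map_add, map_smul, smul_eq_mul, ← h0, ← h1, ← h2]; exact h)
    rw [FF_eq] at this
    simpa using this
  by_cases hz : l0 = 0
  · have := key 1 0 0 (by rw [hz]; ring)
    simp at this
  have k1 := key l1 (-l0) 0 (by ring)
  have k2 := key l2 0 (-l0) (by ring)
  have k3 := key (l1 * l2) (l0 * l2) (-(2 * l0 * l1)) (by ring)
  have e1 : l1 ^ 3 = l0 ^ 3 := by linear_combination k1
  have e2 : l2 ^ 3 = l0 ^ 3 := by linear_combination k2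
  have : (6 : K) * l0 ^ 6 = 0 := by
    have : l1 ^ 3 * l2 ^ 3 + l0 ^ 3 * l2 ^ 3 - 8 * l0 ^ 3 * l1 ^ 3 = 0 := by linear_combination k3
    rw [e1, e2] at this
    linear_combination -this
  simp [hz] at this

lemma rank2_aux (Ψ : (Fin 4 → K) →ₗ[K] Matrix (Fin 3) (Fin 3) K)
    (hn : ∀ l : (Fin 4 → K) →ₗ[K] K, ∃ x, l x = 0 ∧ (Ψ x).det ≠ 0) (p q : K) (hpq : p ≠ 0 ∨ q ≠ 0)
    (h0 : ∀ x, Ψ x 0 0 = 0) (h : ∀ x, p * Ψ x 0 1 + q * Ψ x 0 2 = 0) : False := by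
  rcases hpq with hp | hq
  · obtain ⟨x, hx, hd⟩ := hn (ent Ψ 0 2)
    rw [ent_apply] at hx
    have := h x
    rw [hx, mul_zero, add_zero] at this
    apply hd
    rw [Matrix.det_fin_three, h0, hx, (mul_eq_zero.mp this).resolve_left hp]
    ring
  · obtain ⟨x, hx, hd⟩ := hn (ent Ψ 0 1)
    rw [ent_apply] at hx
    have := h x
    rw [hx, mul_zero, zero_add] at this
    apply hd
    rw [Matrix.det_fin_three, h0, hx, (mul_eq_zero.mp this).resolve_left hq]
    ring

lemma decomp4 {W : Type} [AddCommGroup W] [Module K W] (f : (Fin 4 → K) →ₗ[K] W) (y : Fin 4 → K) :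
    f y = y 0 • f ![1, 0, 0, 0] + y 1 • f ![0, 1, 0, 0] + y 2 • f ![0, 0, 1, 0]
      + y 3 • f ![0, 0, 0, 1] := by
  have e : y = y 0 • ![1, 0, 0, 0] + y 1 • ![0, 1, 0, 0] + y 2 • ![0, 0, 1, 0] + y 3 • ![0, 0, 0, 1] := by
    funext i; fin_cases i <;> simp
  conv_lhs => rw [e]
  simp only [map_add, map_smul]

/-- Right multiplication normalizing the first row. -/
lemma row_norm (Ψ : (Fin 4 → K) →ₗ[K] Matrix (Fin 3) (Fin 3) K) (i j : Fin 4)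
    (hn : ∀ l : (Fin 4 → K) →ₗ[K] K, ∃ x, l x = 0 ∧ (Ψ x).det ≠ 0)
    (h0 : ∀ x, Ψ x 0 0 = 0) (a b c d : K) (h1 : ∀ x, Ψ x 0 1 = x i * a + x j * b)
    (h2 : ∀ x, Ψ x 0 2 = x i * c + x j * d) :
    ∃ G : Matrix (Fin 3) (Fin 3) K, G.det ≠ 0 ∧ ∀ x, (Ψ x * G) 0 0 = 0 ∧ (Ψ x * G) 0 1 = x i ∧
      (Ψ x * G) 0 2 = x j ∧ ∀ k, (Ψ x * G) k 0 = Ψ x k 0 := by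
  have hd : a * d - b * c ≠ 0 := by
    intro h
    obtain ⟨p, q, hpq, e1, e2⟩ := left_ker2 a b c d h
    exact rank2_aux Ψ hn p q hpq h0 (fun x => by
      rw [h1, h2]; linear_combination x i * e1 + x j * e2)
  obtain ⟨D, hD⟩ : ∃ D : K, D * (a * d - b * c) = 1 := ⟨_, inv_mul_cancel₀ hd⟩
  refine ⟨!![1, 0, 0; 0, D * d, -(D * c); 0, -(D * b), D * a], ?_, fun x => ⟨?_, ?_, ?_, ?_⟩⟩
  · have : (!![1, 0, 0; 0, D * d, -(D * c); 0, -(D * b), D * a] : Matrix (Fin 3) (Fin 3) K).det = D := by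
      simp [Matrix.det_fin_three]
      linear_combination D * hD
    rw [this]
    rintro rfl
    simp at hD
  · simp [Matrix.mul_apply, Fin.sum_univ_three, h0]
  · simp [Matrix.mul_apply, Fin.sum_univ_three, h1, h2]
    linear_combination x i * hD
  · simp [Matrix.mul_apply, Fin.sum_univ_three, h1, h2]
    linear_combination x j * hD
  · intro k
    simp [Matrix.mul_apply, Fin.sum_univ_three]

lemma diff_coeffs [CharZero K] (D11 D12 D21 D22 : (Fin 4 → K) →ₗ[K] K)
    (h : ∀ y : Fin 4 → K, y 0 * y 2 * D22 y - y 0 * y 3 * D12 y - y 1 * y 2 * D21 y + y 1 * y 3 * D11 y = 0) :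
    ∃ H J A B : K, ∀ y : Fin 4 → K, D11 y = H * y 0 + J * y 2 ∧ D12 y = H * y 1 + B * y 2 ∧
      D21 y = A * y 0 + J * y 3 ∧ D22 y = A * y 1 + B * y 3 := by
  have h2 : (2 : K) ≠ 0 := two_ne_zero
  have h' : ∀ a b c d : K, a * c * (a * D22 ![1, 0, 0, 0] + b * D22 ![0, 1, 0, 0] + c * D22 ![0, 0, 1, 0] + d * D22 ![0, 0, 0, 1])
     - a * d * (a * D12 ![1, 0, 0, 0] + b * D12 ![0, 1, 0, 0] + c * D12 ![0, 0, 1, 0] + d * D12 ![0, 0, 0, 1])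
     - b * c * (a * D21 ![1, 0, 0, 0] + b * D21 ![0, 1, 0, 0] + c * D21 ![0, 0, 1, 0] + d * D21 ![0, 0, 0, 1])
     + b * d * (a * D11 ![1, 0, 0, 0] + b * D11 ![0, 1, 0, 0] + c * D11 ![0, 0, 1, 0] + d * D11 ![0, 0, 0, 1]) = 0 := by
    intro a b c d
    have := h ![a, b, c, d]
    rw [decomp4 D11, decomp4 D12, decomp4 D21, decomp4 D22] at this
    simpa using this
  refine ⟨D11 ![1, 0, 0, 0], D11 ![0, 0, 1, 0], D21 ![1, 0, 0, 0], D12 ![0, 0, 1, 0], fun y => ?_⟩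
  rw [decomp4 D11 y, decomp4 D12 y, decomp4 D21 y, decomp4 D22 y]
  simp only [smul_eq_mul]
  generalize D11 ![1, 0, 0, 0] = a0, D11 ![0, 1, 0, 0] = a1, D11 ![0, 0, 1, 0] = a2, D11 ![0, 0, 0, 1] = a3 at *
  generalize D12 ![1, 0, 0, 0] = b0, D12 ![0, 1, 0, 0] = b1, D12 ![0, 0, 1, 0] = b2, D12 ![0, 0, 0, 1] = b3 at *
  generalize D21 ![1, 0, 0, 0] = c0, D21 ![0, 1, 0, 0] = c1, D21 ![0, 0, 1, 0] = c2, D21 ![0, 0, 0, 1] = c3 at *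
  generalize D22 ![1, 0, 0, 0] = d0, D22 ![0, 1, 0, 0] = d1, D22 ![0, 0, 1, 0] = d2, D22 ![0, 0, 0, 1] = d3 at *
  have half : ∀ u v : K, u + v = 0 → u - v = 0 → u = 0 ∧ v = 0 := by
    intro u v e1 e2
    constructor
    · apply mul_left_cancel₀ h2; linear_combination e1 + e2
    · apply mul_left_cancel₀ h2; linear_combination e1 - e2
  obtain ⟨hd0, hd2⟩ := half d0 d2 (by linear_combination h' 1 0 1 0) (by linear_combination -h' 1 0 (-1) 0)
  obtain ⟨hb0, hb3⟩ := half b0 b3 (by linear_combination -h' 1 0 0 1) (by linear_combination h' 1 0 0 (-1))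
  obtain ⟨hc1, hc2⟩ := half c1 c2 (by linear_combination -h' 0 1 1 0) (by linear_combination h' 0 1 (-1) 0)
  obtain ⟨ha1, ha3⟩ := half a1 a3 (by linear_combination h' 0 1 0 1) (by linear_combination -h' 0 1 0 (-1))
  subst hd0 hd2 hb0 hb3 hc1 hc2 ha1 ha3
  have e1 : d1 = c0 := by linear_combination h' 1 1 1 0
  have e2 : d3 = b2 := by linear_combination h' 1 0 1 1
  have e3 : b1 = a0 := by linear_combination -h' 1 1 0 1
  have e4 : c3 = a2 := by linear_combination -h' 0 1 1 1
  rw [e1, e2, e3, e4]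
  refine ⟨?_, ?_, ?_, ?_⟩ <;> ring

/-- `Ψ` and `T` are equivalent under constant invertible matrices. -/
def Eqv {V : Type} [AddCommGroup V] [Module K V] (Ψ T : V →ₗ[K] Matrix (Fin 3) (Fin 3) K) : Prop :=
  ∃ U G : Matrix (Fin 3) (Fin 3) K, U.det ≠ 0 ∧ G.det ≠ 0 ∧ ∀ x, U * Ψ x * G = T x

lemma Eqv.trans {V : Type} [AddCommGroup V] [Module K V] {A B D : V →ₗ[K] Matrix (Fin 3) (Fin 3) K}
    (h1 : Eqv A B) (h2 : Eqv B D) : Eqv A D := by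
  obtain ⟨U, G, hU, hG, h⟩ := h1
  obtain ⟨U', G', hU', hG', h'⟩ := h2
  refine ⟨U' * U, G * G', by rw [Matrix.det_mul]; exact mul_ne_zero hU' hU,
    by rw [Matrix.det_mul]; exact mul_ne_zero hG hG', fun x => ?_⟩
  rw [← h', ← h]
  simp only [Matrix.mul_assoc]

lemma Eqv.tr {V : Type} [AddCommGroup V] [Module K V] {A B : V →ₗ[K] Matrix (Fin 3) (Fin 3) K}
    (h1 : Eqv A B) : Eqv (tr A) (tr B) := by
  obtain ⟨U, G, hU, hG, h⟩ := h1
  refine ⟨Gᵀ, Uᵀ, by rwa [Matrix.det_transpose], by rwa [Matrix.det_transpose], fun x => ?_⟩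
  rw [tr_apply, tr_apply, ← h x, Matrix.transpose_mul, Matrix.transpose_mul, Matrix.mul_assoc]

lemma eqv_conj {V : Type} [AddCommGroup V] [Module K V] (A : V →ₗ[K] Matrix (Fin 3) (Fin 3) K)
    (U G : Matrix (Fin 3) (Fin 3) K) (hU : U.det ≠ 0) (hG : G.det ≠ 0) : Eqv A (conj2 U G A) :=
  ⟨U, G, hU, hG, fun _ => rfl⟩

lemma conj_hn (Ψ : (Fin 4 → K) →ₗ[K] Matrix (Fin 3) (Fin 3) K) (U G : Matrix (Fin 3) (Fin 3) K)
    (hU : U.det ≠ 0) (hG : G.det ≠ 0)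
    (hn : ∀ l : (Fin 4 → K) →ₗ[K] K, ∃ x, l x = 0 ∧ (Ψ x).det ≠ 0) :
    ∀ l : (Fin 4 → K) →ₗ[K] K, ∃ x, l x = 0 ∧ (conj2 U G Ψ x).det ≠ 0 := by
  intro l
  obtain ⟨x, hx, hd⟩ := hn l
  refine ⟨x, hx, ?_⟩
  rw [conj2_apply, Matrix.det_mul, Matrix.det_mul]
  exact mul_ne_zero (mul_ne_zero hU hd) hG

/-- The shape of the normal form. -/
def Shp (T : (Fin 4 → K) →ₗ[K] Matrix (Fin 3) (Fin 3) K) : Prop :=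
  ∀ y, T y 0 0 = 0 ∧ T y 0 1 = y 0 ∧ T y 0 2 = y 1 ∧ T y 1 0 = y 2 ∧ T y 2 0 = y 3

lemma to_shape (Ψ : (Fin 4 → K) →ₗ[K] Matrix (Fin 3) (Fin 3) K)
    (hn : ∀ l : (Fin 4 → K) →ₗ[K] K, ∃ x, l x = 0 ∧ (Ψ x).det ≠ 0)
    (hr : Cty (tr Ψ) (fun y => y 0 = 0 ∧ y 1 = 0)) (hc : Cty Ψ (fun y => y 2 = 0 ∧ y 3 = 0)) :
    ∃ T, Eqv Ψ T ∧ Shp T := by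
  obtain ⟨v0, hv0, hAv⟩ := hc
  obtain ⟨w0, hw0, hAw⟩ := hr
  obtain ⟨G, hG, hGv⟩ := exists_first_col v0 hv0
  obtain ⟨U', hU', hUw⟩ := exists_first_col w0 hw0
  obtain ⟨U, hU, hUw⟩ : ∃ U : Matrix (Fin 3) (Fin 3) K, U.det ≠ 0 ∧ ∀ i, U 0 i = w0 i :=
    ⟨U'ᵀ, by rwa [Matrix.det_transpose], hUw⟩
  have hcol : ∀ x i, conj2 U G Ψ x i 0 = (U *ᵥ (Ψ x *ᵥ v0)) i := by
    intro x i
    rw [conj2_apply, Matrix.mul_assoc, Matrix.mul_apply]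
    simp only [Matrix.mulVec, dotProduct, Matrix.mul_apply, hGv]
  have hrow : ∀ x i, conj2 U G Ψ x 0 i = ((w0 ᵥ* Ψ x) ᵥ* G) i := by
    intro x i
    rw [conj2_apply, Matrix.mul_apply]
    simp only [Matrix.vecMul, dotProduct, Matrix.mul_apply, hUw]
  have hcol0 : ∀ x : Fin 4 → K, x 2 = 0 → x 3 = 0 → ∀ i, conj2 U G Ψ x i 0 = 0 := by
    intro x h1 h2 i
    rw [hcol, hAv x ⟨h1, h2⟩]; simp
  have hrow0 : ∀ x : Fin 4 → K, x 0 = 0 → x 1 = 0 → ∀ i, conj2 U G Ψ x 0 i = 0 := by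
    intro x h1 h2 i
    have := hAw x ⟨h1, h2⟩
    rw [tr_apply, Matrix.mulVec_transpose] at this
    rw [hrow, this]; simp
  have hn1 := conj_hn Ψ U G hU hG hn
  have E1 := eqv_conj Ψ U G hU hG
  generalize conj2 U G Ψ = ψ at *
  have hR : ∀ i x, ψ x 0 i = x 0 * ψ ![1, 0, 0, 0] 0 i + x 1 * ψ ![0, 1, 0, 0] 0 i := by
    intro i x
    have := decomp4 (ent ψ 0 i) x
    simp only [ent_apply, smul_eq_mul] at this
    rw [this, hrow0 ![0, 0, 1, 0] rfl rfl, hrow0 ![0, 0, 0, 1] rfl rfl]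
    ring
  have hC : ∀ i x, ψ x i 0 = x 2 * ψ ![0, 0, 1, 0] i 0 + x 3 * ψ ![0, 0, 0, 1] i 0 := by
    intro i x
    have := decomp4 (ent ψ i 0) x
    simp only [ent_apply, smul_eq_mul] at this
    rw [this, hcol0 ![1, 0, 0, 0] rfl rfl, hcol0 ![0, 1, 0, 0] rfl rfl]
    ring
  have h00 : ∀ x, ψ x 0 0 = 0 := by
    intro x
    rw [hR, hcol0 ![1, 0, 0, 0] rfl rfl, hcol0 ![0, 1, 0, 0] rfl rfl]
    ring
  obtain ⟨G1, hG1, H1⟩ := row_norm ψ 0 1 hn1 h00 _ _ _ _ (hR 1) (hR 2)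
  have hone : (1 : Matrix (Fin 3) (Fin 3) K).det ≠ 0 := by simp
  have E2 := eqv_conj ψ 1 G1 hone hG1
  have hn2 := conj_hn ψ 1 G1 hone hG1 hn1
  have H2 : ∀ x, conj2 1 G1 ψ x = ψ x * G1 := by intro x; rw [conj2_apply, Matrix.one_mul]
  simp only [← H2] at H1
  generalize conj2 1 G1 ψ = χ at *
  have hn3 : ∀ l : (Fin 4 → K) →ₗ[K] K, ∃ x, l x = 0 ∧ (tr χ x).det ≠ 0 := by
    intro l
    obtain ⟨x, hx, hd⟩ := hn2 l
    exact ⟨x, hx, by rwa [tr_apply, Matrix.det_transpose]⟩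
  obtain ⟨U1, hU1, H3⟩ := row_norm (tr χ) 2 3 hn3 (fun x => (H1 x).1) _ _ _ _
    (fun x => by rw [tr_apply, Matrix.transpose_apply, (H1 x).2.2.2, hC 1])
    (fun x => by rw [tr_apply, Matrix.transpose_apply, (H1 x).2.2.2, hC 2])
  have hU1' : U1ᵀ.det ≠ 0 := by rwa [Matrix.det_transpose]
  refine ⟨conj2 U1ᵀ 1 χ, E1.trans (E2.trans (eqv_conj χ U1ᵀ 1 hU1' hone)), fun y => ?_⟩
  have e : conj2 U1ᵀ 1 χ y = (tr χ y * U1)ᵀ := by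
    rw [conj2_apply, Matrix.mul_one, Matrix.transpose_mul, tr_apply, Matrix.transpose_transpose]
  obtain ⟨a1, a2, a3, a4⟩ := H3 y
  obtain ⟨b1, b2, b3, -⟩ := H1 y
  rw [e]
  refine ⟨a1, ?_, ?_, a2, a3⟩
  · rw [Matrix.transpose_apply, a4, tr_apply, Matrix.transpose_apply, b2]
  · rw [Matrix.transpose_apply, a4, tr_apply, Matrix.transpose_apply, b3]

lemma shape_unique [CharZero K] (Ψ T : (Fin 4 → K) →ₗ[K] Matrix (Fin 3) (Fin 3) K) (h1 : Shp Ψ) (h2 : Shp T)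
    (hd : ∀ y, (Ψ y).det = (T y).det) : Eqv Ψ T := by
  obtain ⟨H, J, A, B, h⟩ := diff_coeffs (ent Ψ 1 1 - ent T 1 1) (ent Ψ 1 2 - ent T 1 2)
    (ent Ψ 2 1 - ent T 2 1) (ent Ψ 2 2 - ent T 2 2) (fun y => by
      have := hd y
      obtain ⟨a1, a2, a3, a4, a5⟩ := h1 y
      obtain ⟨b1, b2, b3, b4, b5⟩ := h2 y
      rw [Matrix.det_fin_three, Matrix.det_fin_three, a1, a2, a3, a4, a5, b1, b2, b3, b4, b5] at this
      simp only [LinearMap.sub_apply, ent_apply]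
      linear_combination -this)
  refine ⟨!![1, 0, 0; -H, 1, 0; -A, 0, 1], !![1, -J, -B; 0, 1, 0; 0, 0, 1], by simp [Matrix.det_fin_three],
    by simp [Matrix.det_fin_three], fun y => ?_⟩
  obtain ⟨a1, a2, a3, a4, a5⟩ := h1 y
  obtain ⟨b1, b2, b3, b4, b5⟩ := h2 y
  obtain ⟨c1, c2, c3, c4⟩ := h y
  simp only [LinearMap.sub_apply, ent_apply] at c1 c2 c3 c4
  ext i j
  fin_cases i <;> fin_cases j <;>
    simp [Matrix.mul_apply, Matrix.vecMul, dotProduct, Fin.sum_univ_three, a1, a2, a3, a4, a5, b1, b2, b3, b4, b5]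
  · linear_combination c1
  · linear_combination c2
  · linear_combination c3
  · linear_combination c4

lemma normal_coord [CharZero K] (Ψ T : (Fin 4 → K) →ₗ[K] Matrix (Fin 3) (Fin 3) K)
    (hn : ∀ l : (Fin 4 → K) →ₗ[K] K, ∃ x, l x = 0 ∧ (Ψ x).det ≠ 0)
    (hr : Cty (tr Ψ) (fun y => y 0 = 0 ∧ y 1 = 0)) (hc : Cty Ψ (fun y => y 2 = 0 ∧ y 3 = 0))
    (hT : Shp T) (hd : ∀ y, (Ψ y).det = (T y).det) : Eqv Ψ T := by
  obtain ⟨T', ⟨U, G, hU, hG, h⟩, hs⟩ := to_shape Ψ hn hr hc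
  have hk : U.det * G.det ≠ 0 := mul_ne_zero hU hG
  obtain ⟨κ, hκ⟩ : ∃ κ, κ = U.det * G.det := ⟨_, rfl⟩
  rw [← hκ] at hk
  have hd' : ∀ y, (T' y).det = κ * (Ψ y).det := by
    intro y
    rw [← h, Matrix.det_mul, Matrix.det_mul, hκ]; ring
  have dU : (!![1, 0, 0; 0, κ⁻¹, 0; 0, 0, κ⁻¹] : Matrix (Fin 3) (Fin 3) K).det = κ⁻¹ * κ⁻¹ := by
    simp [Matrix.det_fin_three]
  have dG : (!![κ, 0, 0; 0, 1, 0; 0, 0, 1] : Matrix (Fin 3) (Fin 3) K).det = κ := by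
    simp [Matrix.det_fin_three]
  refine Eqv.trans ⟨U, G, hU, hG, h⟩ (Eqv.trans (eqv_conj T' !![1, 0, 0; 0, κ⁻¹, 0; 0, 0, κ⁻¹]
    !![κ, 0, 0; 0, 1, 0; 0, 0, 1] (by rw [dU]; simp [hk]) (by rw [dG]; exact hk))
    (shape_unique _ _ ?_ hT ?_))
  · intro y
    obtain ⟨a1, a2, a3, a4, a5⟩ := hs y
    rw [conj2_apply]
    refine ⟨?_, ?_, ?_, ?_, ?_⟩ <;>
      simp [Matrix.mul_apply, Matrix.vecMul, dotProduct, Fin.sum_univ_three, a1, a2, a3, a4, a5] <;>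
      field_simp
  · intro y
    rw [conj2_apply, Matrix.det_mul, Matrix.det_mul, hd', dU, dG, ← hd]
    field_simp

lemma normal_form [CharZero K] (Φ T : (Fin 4 → K) →ₗ[K] Matrix (Fin 3) (Fin 3) K)
    (hΦ : ∀ x, (Φ x).det = FF x) (hT : ∀ x, (T x).det = FF x)
    (p1 p2 q1 q2 : (Fin 4 → K) →ₗ[K] K)
    (hinj : ∀ x, p1 x = 0 → p2 x = 0 → q1 x = 0 → q2 x = 0 → x = 0)
    (hs : ∀ x, T x 0 0 = 0 ∧ T x 0 1 = p1 x ∧ T x 0 2 = p2 x ∧ T x 1 0 = q1 x ∧ T x 2 0 = q2 x)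
    (hr : Cty (tr Φ) (fun x => p1 x = 0 ∧ p2 x = 0)) (hc : Cty Φ (fun x => q1 x = 0 ∧ q2 x = 0)) :
    Eqv Φ T := by
  obtain ⟨L, hL⟩ : ∃ L : (Fin 4 → K) →ₗ[K] (Fin 4 → K), L = LinearMap.pi ![p1, p2, q1, q2] := ⟨_, rfl⟩
  have l0 : ∀ x, L x 0 = p1 x := by intro x; rw [hL]; rfl
  have l1 : ∀ x, L x 1 = p2 x := by intro x; rw [hL]; rfl
  have l2 : ∀ x, L x 2 = q1 x := by intro x; rw [hL]; rfl
  have l3 : ∀ x, L x 3 = q2 x := by intro x; rw [hL]; rfl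
  have Linj : Function.Injective L := by
    rw [← LinearMap.ker_eq_bot, LinearMap.ker_eq_bot']
    intro x hx
    exact hinj x (by rw [← l0, hx]; rfl) (by rw [← l1, hx]; rfl) (by rw [← l2, hx]; rfl)
      (by rw [← l3, hx]; rfl)
  obtain ⟨e, he⟩ : ∃ e : (Fin 4 → K) ≃ₗ[K] (Fin 4 → K), ∀ x, e x = L x :=
    ⟨LinearEquiv.ofInjectiveEndo L Linj, fun x => rfl⟩
  have hes : ∀ y, L (e.symm y) = y := by intro y; rw [← he]; simp
  have main : Eqv (Φ ∘ₗ e.symm.toLinearMap) (T ∘ₗ e.symm.toLinearMap) := by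
    apply normal_coord
    · intro l
      obtain ⟨x, hx, hd⟩ := FF_hyper (l ∘ₗ e.toLinearMap)
      refine ⟨e x, hx, ?_⟩
      simpa [hΦ] using hd
    · obtain ⟨w, hw, H⟩ := hr
      refine ⟨w, hw, fun y hy => H (e.symm y) ⟨?_, ?_⟩⟩
      · rw [← l0, hes]; exact hy.1
      · rw [← l1, hes]; exact hy.2
    · obtain ⟨w, hw, H⟩ := hc
      refine ⟨w, hw, fun y hy => H (e.symm y) ⟨?_, ?_⟩⟩
      · rw [← l2, hes]; exact hy.1
      · rw [← l3, hes]; exact hy.2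
    · intro y
      obtain ⟨a1, a2, a3, a4, a5⟩ := hs (e.symm y)
      refine ⟨a1, ?_, ?_, ?_, ?_⟩
      · exact a2.trans (by rw [← l0, hes])
      · exact a3.trans (by rw [← l1, hes])
      · exact a4.trans (by rw [← l2, hes])
      · exact a5.trans (by rw [← l3, hes])
    · intro y
      simp [hΦ, hT]
  obtain ⟨U, G, hU, hG, h⟩ := main
  refine ⟨U, G, hU, hG, fun x => ?_⟩
  have := h (e x)
  simpa using this

end NormalForm

section Comb

/-- A 3 by 3 array with vanishing row and column sums. -/
def mkM (a b c d : ℤ) (i j : Fin 3) : ℤ :=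
  match i, j with
  | 0, 0 => a
  | 0, 1 => b
  | 0, 2 => -a - b
  | 1, 0 => c
  | 1, 1 => d
  | 1, 2 => -c - d
  | 2, 0 => -a - c
  | 2, 1 => -b - d
  | 2, 2 => a + b + c + d

/-- Admissible values. -/
def okv (a : ℤ) : Prop := a = 1 ∨ a = 0 ∨ a = -1

instance (a : ℤ) : Decidable (okv a) := by unfold okv; infer_instance

/-- The possible conclusions. -/
def Concl (x y z : Fin 3 → Fin 3 → ℤ) : Prop :=
  (∃ i j m n, x i j = 1 ∧ z m n = -1 ∧ m ≠ n + i + j) ∨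
  (∃ i j m n, x i j = -1 ∧ z m n = 1 ∧ m ≠ n + i + j) ∨
  (∃ j i' j', x 0 j = -1 ∧ x i' j' = 1 ∧ i' ≠ 0 ∧ j' ≠ j) ∨
  (∃ j j', y 0 j = -1 ∧ y (2 * j + j') j' = 1 ∧ j' ≠ j)

instance (x y z : Fin 3 → Fin 3 → ℤ) : Decidable (Concl x y z) := by unfold Concl; infer_instance

/-- The third array, determined by the first two. -/
def mkZ (x y : Fin 3 → Fin 3 → ℤ) (m n : Fin 3) : ℤ := -x (2 * n) m - y 0 (n + m)

/-- Innermost part of the enumeration. -/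
def EnumIn (a b c d a' b' c' d' : ℤ) : Prop :=
  (∀ i j k, mkM a b c d i j + mkM a' b' c' d' k (2 * i + j + k)
      + mkZ (mkM a b c d) (mkM a' b' c' d') (j + k) (2 * i + k) = 0) →
    ¬ (a = 0 ∧ b = 0 ∧ c = 0 ∧ d = 0 ∧ a' = 0 ∧ b' = 0 ∧ c' = 0 ∧ d' = 0) →
    Concl (mkM a b c d) (mkM a' b' c' d') (mkZ (mkM a b c d) (mkM a' b' c' d'))

instance (a b c d a' b' c' d' : ℤ) : Decidable (EnumIn a b c d a' b' c' d') := by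
  unfold EnumIn; infer_instance

/-- EnumMid part of the enumeration. -/
def EnumMid (a b c d a' b' : ℤ) : Prop :=
  (∀ m n, okv (mkZ (mkM a b c d) (mkM a' b' 0 0) m n)) →
    ∀ c' ∈ [(1 : ℤ), 0, -1], okv (-a' - c') → ∀ d' ∈ [(1 : ℤ), 0, -1], okv (-b' - d') → okv (-c' - d') →
    okv (a' + b' + c' + d') → EnumIn a b c d a' b' c' d'

instance (a b c d a' b' : ℤ) : Decidable (EnumMid a b c d a' b') := by
  unfold EnumMid; infer_instance

/-- EnumOut part of the enumeration. -/
def EnumOut (a b c d : ℤ) : Prop :=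
  ∀ a' ∈ [(1 : ℤ), 0, -1], ∀ b' ∈ [(1 : ℤ), 0, -1], okv (-a' - b') → EnumMid a b c d a' b'

instance (a b c d : ℤ) : Decidable (EnumOut a b c d) := by
  unfold EnumOut; infer_instance

lemma comb_dec : ∀ a ∈ [(1 : ℤ), 0, -1], ∀ b ∈ [(1 : ℤ), 0, -1], okv (-a - b) →
    ∀ c ∈ [(1 : ℤ), 0, -1], okv (-a - c) → ∀ d ∈ [(1 : ℤ), 0, -1], okv (-b - d) → okv (-c - d) →
    okv (a + b + c + d) → EnumOut a b c d := by
  decide +kernel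

lemma mkM_eq (x : Fin 3 → Fin 3 → ℤ) (hr : ∀ i, x i 0 + x i 1 + x i 2 = 0)
    (hc : ∀ j, x 0 j + x 1 j + x 2 j = 0) : x = mkM (x 0 0) (x 0 1) (x 1 0) (x 1 1) := by
  funext i j
  have r0 := hr 0
  have r1 := hr 1
  have r2 := hr 2
  have c0 := hc 0
  have c1 := hc 1
  have c2 := hc 2
  fin_cases i <;> fin_cases j <;> simp [mkM] <;> omega

lemma okv_mem {a : ℤ} (h : okv a) : a ∈ [(1 : ℤ), 0, -1] := by
  rcases h with h | h | h <;> simp [h]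

lemma comb (x y z : Fin 3 → Fin 3 → ℤ) (hx : ∀ i j, okv (x i j)) (hy : ∀ i j, okv (y i j))
    (hz : ∀ i j, okv (z i j))
    (xr : ∀ i, x i 0 + x i 1 + x i 2 = 0) (xc : ∀ j, x 0 j + x 1 j + x 2 j = 0)
    (yr : ∀ i, y i 0 + y i 1 + y i 2 = 0) (yc : ∀ j, y 0 j + y 1 j + y 2 j = 0)
    (hcross : ∀ i j k, x i j + y k (2 * i + j + k) + z (j + k) (2 * i + k) = 0)
    (hne : ∃ i j, x i j ≠ 0 ∨ y i j ≠ 0 ∨ z i j ≠ 0) : Concl x y z := by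
  have hzz : z = mkZ x y := by
    funext m n
    have e1 : 2 * (2 * n) + m + 0 = n + m := by revert m n; decide
    have e2 : 2 * (2 * n) + 0 = n := by clear e1; revert n; decide
    have := hcross (2 * n) m 0
    rw [e1, e2, add_zero] at this
    rw [mkZ]
    omega
  have ex := mkM_eq x xr xc
  have ey := mkM_eq y yr yc
  have hyz : mkZ x (mkM (y 0 0) (y 0 1) 0 0) = mkZ x y := by
    funext m n
    rw [mkZ, mkZ]
    conv_rhs => rw [ey]
    generalize n + m = t
    fin_cases t <;> rfl
  have key := comb_dec (x 0 0) (okv_mem (hx 0 0)) (x 0 1) (okv_mem (hx 0 1))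
    (by have := hx 0 2; have h := xr 0; unfold okv at *; omega)
    (x 1 0) (okv_mem (hx 1 0)) (by have := hx 2 0; have h := xc 0; unfold okv at *; omega)
    (x 1 1) (okv_mem (hx 1 1)) (by have := hx 2 1; have h := xc 1; unfold okv at *; omega)
    (by have := hx 1 2; have h := xr 1; unfold okv at *; omega)
    (by have := hx 2 2; have h := xr 2; have h0 := xc 0; have h1 := xc 1; unfold okv at *; omega)
    (y 0 0) (okv_mem (hy 0 0)) (y 0 1) (okv_mem (hy 0 1))
    (by have := hy 0 2; have h := yr 0; unfold okv at *; omega)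
    (by rw [← ex, hyz, ← hzz]; exact hz)
    (y 1 0) (okv_mem (hy 1 0)) (by have := hy 2 0; have h := yc 0; unfold okv at *; omega)
    (y 1 1) (okv_mem (hy 1 1)) (by have := hy 2 1; have h := yc 1; unfold okv at *; omega)
    (by have := hy 1 2; have h := yr 1; unfold okv at *; omega)
    (by have := hy 2 2; have h := yr 2; have h0 := yc 0; have h1 := yc 1; unfold okv at *; omega)
    (by rw [← ex, ← ey, ← hzz]; exact hcross)
    (by
      rintro ⟨a1, a2, a3, a4, b1, b2, b3, b4⟩
      rw [a1, a2, a3, a4] at ex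
      rw [b1, b2, b3, b4] at ey
      have zx : ∀ i j, x i j = 0 := by
        intro i j; rw [ex]; revert i j; decide
      have zy : ∀ i j, y i j = 0 := by
        intro i j; rw [ey]; revert i j; decide
      obtain ⟨i, j, h | h | h⟩ := hne
      · exact h (zx i j)
      · exact h (zy i j)
      · apply h; rw [hzz, mkZ, zx, zy]; rfl)
  rwa [← ex, ← ey, ← hzz] at key

end Comb

section Bridge
variable {K : Type} [Field K]

lemma hom_lin (p : S K) (hp : p.IsHomogeneous 1) :
    (∀ x y : Fin 4 → K, eval (x + y) p = eval x p + eval y p) ∧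
    (∀ (c : K) (x : Fin 4 → K), eval (c • x) p = c * eval x p) := by
  have hm : p ∈ homogeneousSubmodule (Fin 4) K 1 := hp
  clear hp
  rw [homogeneousSubmodule_one_eq_span_X] at hm
  induction hm using Submodule.span_induction with
  | mem q hq =>
    obtain ⟨i, rfl⟩ := hq
    simp
  | zero => simp
  | add p q _ _ h1 h2 =>
    constructor
    · intro x y; rw [map_add, map_add, map_add, h1.1, h2.1]; ring
    · intro c x; rw [map_add, map_add, h1.2, h2.2]; ring
  | smul a p _ h1 =>
    constructor
    · intro x y; simp only [smul_eval, h1.1]; ring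
    · intro c x; simp only [smul_eval, h1.2]; ring

/-- The linear family of matrices given by a matrix of linear forms. -/
def evL (M : Matrix (Fin 3) (Fin 3) (S K)) (h : ∀ k l, (M k l).IsHomogeneous 1) :
    (Fin 4 → K) →ₗ[K] Matrix (Fin 3) (Fin 3) K where
  toFun x := M.map (eval x)
  map_add' x y := by ext i j; simp [(hom_lin _ (h i j)).1]
  map_smul' c x := by ext i j; simp [(hom_lin _ (h i j)).2]

lemma evL_apply (M : Matrix (Fin 3) (Fin 3) (S K)) (h : ∀ k l, (M k l).IsHomogeneous 1) (x : Fin 4 → K)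
    (i j : Fin 3) : evL M h x i j = eval x (M i j) := rfl

lemma eval_f4 (x : Fin 4 → K) : eval x (f4 K) = FF x := by
  rw [FF_eq]; simp [f4, Yv]

lemma evL_det (M : Matrix (Fin 3) (Fin 3) (S K)) (h : ∀ k l, (M k l).IsHomogeneous 1)
    (hd : M.det = f4 K) (x : Fin 4 → K) : (evL M h x).det = FF x := by
  rw [← eval_f4, ← hd, RingHom.map_det]
  rfl

lemma coker_iso [CharZero K] (M N : Matrix (Fin 3) (Fin 3) (S K)) (hM : ∀ k l, (M k l).IsHomogeneous 1)
    (hN : ∀ k l, (N k l).IsHomogeneous 1) (h : Eqv (evL M hM) (evL N hN)) :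
    Nonempty (coker K M ≃ₗ[R4 K] coker K N) := by
  obtain ⟨U, G, hU, hG, h⟩ := h
  have hmat : U.map (C : K →+* S K) * M * G.map (C : K →+* S K) = N := by
    ext1 i j
    apply MvPolynomial.funext
    intro x
    have := congrFun (congrFun (h x) i) j
    rw [evL_apply] at this
    rw [← this]
    simp [Matrix.mul_apply, evL_apply]
  obtain ⟨ρ, hρ⟩ : ∃ ρ : K →+* R4 K, ρ = (proj K).comp C := ⟨_, rfl⟩
  have hmat2 : U.map ρ * M.map (proj K) * G.map ρ = N.map (proj K) := by
    rw [← hmat, Matrix.map_mul, Matrix.map_mul, hρ]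
    rfl
  have u1 : U.map ρ * U⁻¹.map ρ = 1 := by
    rw [← Matrix.map_mul, Matrix.mul_nonsing_inv _ (by simpa using hU), Matrix.map_one _ (map_zero ρ) (map_one ρ)]
  have u2 : U⁻¹.map ρ * U.map ρ = 1 := by
    rw [← Matrix.map_mul, Matrix.nonsing_inv_mul _ (by simpa using hU), Matrix.map_one _ (map_zero ρ) (map_one ρ)]
  have g1 : G.map ρ * G⁻¹.map ρ = 1 := by
    rw [← Matrix.map_mul, Matrix.mul_nonsing_inv _ (by simpa using hG), Matrix.map_one _ (map_zero ρ) (map_one ρ)]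
  generalize U.map ρ = u at *
  generalize U⁻¹.map ρ = u' at *
  generalize G.map ρ = g at *
  generalize G⁻¹.map ρ = g' at *
  obtain ⟨e, he⟩ : ∃ e : (Fin 3 → R4 K) ≃ₗ[R4 K] (Fin 3 → R4 K), ∀ v, e v = u *ᵥ v :=
    ⟨LinearEquiv.ofLinearMap (Matrix.mulVecLin u) (Matrix.mulVecLin u')
      (by rw [← Matrix.mulVecLin_mul, u1, Matrix.mulVecLin_one])
      (by rw [← Matrix.mulVecLin_mul, u2, Matrix.mulVecLin_one]), fun v => rfl⟩
  refine ⟨Submodule.Quotient.equiv _ _ e ?_⟩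
  ext v
  simp only [Submodule.mem_map, LinearMap.mem_range, Matrix.mulVecLin_apply]
  constructor
  · rintro ⟨_, ⟨y, rfl⟩, rfl⟩
    refine ⟨g' *ᵥ y, ?_⟩
    rw [← hmat2, Matrix.mulVec_mulVec, Matrix.mul_assoc, g1, Matrix.mul_one]
    change _ = e (M.map (proj K) *ᵥ y)
    rw [he, Matrix.mulVec_mulVec]
  · rintro ⟨y, rfl⟩
    refine ⟨M.map (proj K) *ᵥ (g *ᵥ y), ⟨g *ᵥ y, rfl⟩, ?_⟩
    change e (M.map (proj K) *ᵥ (g *ᵥ y)) = _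
    rw [he, ← hmat2, Matrix.mulVec_mulVec, Matrix.mulVec_mulVec, Matrix.mul_assoc]

lemma hX (i : Fin 4) : (X i : S K).IsHomogeneous 1 := isHomogeneous_X _ _

lemma hCX (a : K) (i : Fin 4) : (C a * X i : S K).IsHomogeneous 1 := isHomogeneous_C_mul_X _ _

lemma hNeg {p : S K} (h : p.IsHomogeneous 1) : (-p).IsHomogeneous 1 := h.neg

lemma hZero : (0 : S K).IsHomogeneous 1 := isHomogeneous_zero _ _ _

lemma alpha_hom (b c d ε : K) (k l : Fin 3) : (alphaM K b c d ε k l).IsHomogeneous 1 := by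
  fin_cases k <;> fin_cases l
  · exact hZero
  · exact (hX 0).sub (hCX _ 3)
  · exact (hX 1).sub (hCX _ 2)
  · exact (hX 0).sub (hCX _ 1)
  · exact (hNeg (hCX _ 2)).sub (hCX _ 3)
  · exact (hCX _ 2).sub (hCX _ 3)
  · exact (hX 2).sub (hCX _ 3)
  · exact ((hCX _ 1).add (hCX _ 2)).add (hCX _ 3)
  · exact ((hNeg (hX 0)).sub (hCX _ 1)).sub (hCX _ 3)

lemma beta_hom (b c d ε : K) (k l : Fin 3) : (betaM K b c d ε k l).IsHomogeneous 1 :=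
  alpha_hom b c d ε l k

lemma eta_hom (a b c ε : K) (k l : Fin 3) : (etaM K a b c ε k l).IsHomogeneous 1 := by
  fin_cases k <;> fin_cases l
  · exact hZero
  · exact (hX 0).add (hX 1)
  · exact (hX 2).sub (hCX _ 3)
  · exact (hX 0).add (hCX _ 1)
  · exact (hNeg (hX 2)).add (hCX _ 3)
  · exact hZero
  · exact (hX 2).sub (hCX _ 3)
  · exact hZero
  · exact (hNeg (hX 0)).sub (hCX _ 1)

lemma theta_hom (a b c : K) (k l : Fin 3) : (thetaM K a b c k l).IsHomogeneous 1 := by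
  fin_cases k <;> fin_cases l
  · exact hZero
  · exact (hX 0).add (hX 2)
  · exact (hX 1).sub (hCX _ 3)
  · exact (hX 0).sub (hCX _ 2)
  · exact (hNeg (hX 1)).add (hCX _ 3)
  · exact hZero
  · exact (hX 1).sub (hCX _ 3)
  · exact hZero
  · exact (hNeg (hX 0)).add (hCX _ 2)

/-- The difference `x i - a * x j` as a functional. -/
def df (i j : Fin 4) (a : K) : (Fin 4 → K) →ₗ[K] K where
  toFun x := x i - a * x j
  map_add' x y := by simp; ring
  map_smul' c x := by simp; ring

lemma df_apply (i j : Fin 4) (a : K) (x : Fin 4 → K) : df i j a x = x i - a * x j := rfl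

lemma cty_congr {V : Type} [AddCommGroup V] [Module K V] (Φ : V →ₗ[K] Matrix (Fin 3) (Fin 3) K)
    {P Q : V → Prop} (h : ∀ x, Q x → P x) (hP : Cty Φ P) : Cty Φ Q := by
  obtain ⟨v, hv, H⟩ := hP
  exact ⟨v, hv, fun x hx => H x (h x hx)⟩

lemma cube_ne {a : K} (ha : a ^ 3 = -1) : a ≠ 0 := by
  rintro rfl
  simp at ha

lemma alpha_det (b c d ε : K) (hb : b ^ 3 = -1) (hc : c ^ 3 = -1) (hd : d ^ 3 = -1)
    (he : ε ^ 2 + ε + 1 = 0) (x : Fin 4 → K) : (evL _ (alpha_hom b c d ε) x).det = FF x := by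
  rw [Matrix.det_fin_three, FF_eq]
  simp only [evL_apply, alphaM, Yv]
  simp
  generalize x 0 = x0
  generalize x 1 = x1
  generalize x 2 = x2
  generalize x 3 = x3
  grind

lemma alpha_case [CharZero K] (Φ : (Fin 4 → K) →ₗ[K] Matrix (Fin 3) (Fin 3) K)
    (hΦ : ∀ x, (Φ x).det = FF x) (a b c d : K) (ha : a ^ 3 = -1) (hb : b ^ 3 = -1) (hc : c ^ 3 = -1)
    (hd : d ^ 3 = -1) (hne : a ≠ b * c * d) (hr : Cty (tr Φ) (lnz a b)) (hcol : Cty Φ (lnx c d)) :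
    ∃ ε : K, ε ^ 3 = 1 ∧ ε ≠ 1 ∧ Eqv Φ (evL _ (alpha_hom b c d ε)) := by
  have hb0 := cube_ne hb
  have hc0 := cube_ne hc
  have hd0 := cube_ne hd
  obtain ⟨t, ht⟩ : ∃ t : K, t = -(a * b ^ 2 * c ^ 2 * d ^ 2) := ⟨_, rfl⟩
  have hta : t * (b * c * d) = a := by
    rw [ht]
    linear_combination (-a * c ^ 3 * d ^ 3) * hb + a * d ^ 3 * hc - a * hd
  have ht3 : t ^ 3 = 1 := by
    have h1 : (t * (b * c * d)) ^ 3 = -1 := by rw [hta, ha]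
    have h2 : (t * (b * c * d)) ^ 3 = t ^ 3 * (b ^ 3 * c ^ 3 * d ^ 3) := by ring
    rw [h2, hb, hc, hd] at h1
    linear_combination -h1
  have ht1 : t ≠ 1 := by
    rintro rfl
    exact hne (by rw [← hta]; ring)
  have hq : t ^ 2 + t + 1 = 0 := by
    have : (t - 1) * (t ^ 2 + t + 1) = 0 := by linear_combination ht3
    exact (mul_eq_zero.mp this).resolve_left (sub_ne_zero.mpr ht1)
  have ea : (t ^ 2) ^ 2 * b * c * d = a := by
    rw [← hta]; linear_combination (t * b * c * d) * ht3
  refine ⟨t ^ 2, by linear_combination (t ^ 3 + 1) * ht3, ?_, ?_⟩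
  · intro h
    apply ht1
    linear_combination ht3 - t * h
  · refine normal_form Φ _ hΦ (alpha_det b c d (t ^ 2) hb hc hd
      (by linear_combination (t ^ 2 - t + 1) * hq)) (df 0 3 a) (df 1 2 b) (df 0 1 c) (df 2 3 d) ?_ ?_ ?_ ?_
    · intro x h1 h2 h3 h4
      simp only [df_apply] at h1 h2 h3 h4
      have : (a - b * c * d) * x 3 = 0 := by
        linear_combination -h1 + h3 + c * h2 + b * c * h4
      have x3 : x 3 = 0 := (mul_eq_zero.mp this).resolve_left (sub_ne_zero.mpr hne)
      have x2 : x 2 = 0 := by linear_combination h4 + d * x3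
      have x1 : x 1 = 0 := by linear_combination h2 + b * x2
      have x0 : x 0 = 0 := by linear_combination h1 + a * x3
      funext i
      fin_cases i
      · exact x0
      · exact x1
      · exact x2
      · exact x3
    · intro x
      refine ⟨?_, ?_, ?_, ?_, ?_⟩ <;> rw [evL_apply] <;> simp [alphaM, Yv, df_apply] <;> left <;> exact ea
    · exact cty_congr _ (fun x hx => ⟨sub_eq_zero.mp hx.1, sub_eq_zero.mp hx.2⟩) hr
    · exact cty_congr _ (fun x hx => ⟨sub_eq_zero.mp hx.1, sub_eq_zero.mp hx.2⟩) hcol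

lemma eta_det (a b c ε : K) (h1 : a + b + c = 0) (h2 : a * b + b * c + c * a = 0) (h3 : a * b * c = -1)
    (he : ε ^ 2 + ε + 1 = 0) (x : Fin 4 → K) : (evL _ (eta_hom a b c ε) x).det = FF x := by
  rw [Matrix.det_fin_three, FF_eq]
  simp only [evL_apply, etaM, Yv]
  simp
  generalize x 0 = x0
  generalize x 1 = x1
  generalize x 2 = x2
  generalize x 3 = x3
  grind

lemma theta_det (a b c : K) (h1 : a + b + c = 0) (h2 : a * b + b * c + c * a = 0) (h3 : a * b * c = -1)
    (ha : a ^ 3 = -1) (hb : b ^ 3 = -1) (x : Fin 4 → K) : (evL _ (theta_hom a b c) x).det = FF x := by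
  rw [Matrix.det_fin_three, FF_eq]
  simp only [evL_apply, thetaM, Yv]
  simp
  generalize x 0 = x0
  generalize x 1 = x1
  generalize x 2 = x2
  generalize x 3 = x3
  grind

lemma sym_roots (a b c : K) (h : cubePerm K a b c) :
    a + b + c = 0 ∧ a * b + b * c + c * a = 0 ∧ a * b * c = -1 := by
  obtain ⟨ha, hb, hc, hab, hac, hbc⟩ := h
  have e1 : a ^ 2 + a * b + b ^ 2 = 0 := by
    have : (a - b) * (a ^ 2 + a * b + b ^ 2) = 0 := by linear_combination ha - hb
    exact (mul_eq_zero.mp this).resolve_left (sub_ne_zero.mpr hab)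
  have e2 : a ^ 2 + a * c + c ^ 2 = 0 := by
    have : (a - c) * (a ^ 2 + a * c + c ^ 2) = 0 := by linear_combination ha - hc
    exact (mul_eq_zero.mp this).resolve_left (sub_ne_zero.mpr hac)
  have e3 : a + b + c = 0 := by
    have : (b - c) * (a + b + c) = 0 := by linear_combination e1 - e2
    exact (mul_eq_zero.mp this).resolve_left (sub_ne_zero.mpr hbc)
  have ec : c = -a - b := by linear_combination e3
  refine ⟨e3, ?_, ?_⟩
  · rw [ec]; linear_combination -e1
  · rw [ec]; linear_combination -a * e1 + ha

lemma eta_case [CharZero K] (Φ : (Fin 4 → K) →ₗ[K] Matrix (Fin 3) (Fin 3) K)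
    (hΦ : ∀ x, (Φ x).det = FF x) (a b c ε : K) (h : cubePerm K a b c) (he : ε ^ 3 = 1) (he1 : ε ≠ 1)
    (hr : Cty (tr Φ) (lnx (-1) a)) (hcol : Cty Φ (lnx (-ε) b)) :
    Eqv Φ (evL _ (eta_hom a b c ε)) := by
  have hq : ε ^ 2 + ε + 1 = 0 := by
    have : (ε - 1) * (ε ^ 2 + ε + 1) = 0 := by linear_combination he
    exact (mul_eq_zero.mp this).resolve_left (sub_ne_zero.mpr he1)
  obtain ⟨s1, s2, s3⟩ := sym_roots a b c h
  obtain ⟨ha, hb, hc, hab, hac, hbc⟩ := h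
  refine normal_form Φ _ hΦ (eta_det a b c ε s1 s2 s3 hq)
    (df 0 1 (-1)) (df 2 3 a) (df 0 1 (-ε)) (df 2 3 b) ?_ ?_ ?_ ?_
  · intro x h1 h2 h3 h4
    simp only [df_apply] at h1 h2 h3 h4
    have e1 : (ε - 1) * x 1 = 0 := by linear_combination h3 - h1
    have e2 : (a - b) * x 3 = 0 := by linear_combination h4 - h2
    have x1 : x 1 = 0 := (mul_eq_zero.mp e1).resolve_left (sub_ne_zero.mpr he1)
    have x3 : x 3 = 0 := (mul_eq_zero.mp e2).resolve_left (sub_ne_zero.mpr hab)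
    have x2 : x 2 = 0 := by linear_combination h2 + a * x3
    have x0 : x 0 = 0 := by linear_combination h1 - x1
    funext i
    fin_cases i
    · exact x0
    · exact x1
    · exact x2
    · exact x3
  · intro x
    refine ⟨?_, ?_, ?_, ?_, ?_⟩ <;> rw [evL_apply] <;> simp [etaM, Yv, df_apply]
  · exact cty_congr _ (fun x hx => ⟨sub_eq_zero.mp hx.1, sub_eq_zero.mp hx.2⟩) hr
  · exact cty_congr _ (fun x hx => ⟨sub_eq_zero.mp hx.1, sub_eq_zero.mp hx.2⟩) hcol

lemma theta_case [CharZero K] (Φ : (Fin 4 → K) →ₗ[K] Matrix (Fin 3) (Fin 3) K)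
    (hΦ : ∀ x, (Φ x).det = FF x) (a b c : K) (h : cubePerm K a b c)
    (hr : Cty (tr Φ) (lny (-1) a)) (hcol : Cty Φ (lny (a ^ 2 * b) b)) :
    Eqv Φ (evL _ (theta_hom a b c)) := by
  obtain ⟨s1, s2, s3⟩ := sym_roots a b c h
  obtain ⟨ha, hb, hc, hab, hac, hbc⟩ := h
  refine normal_form Φ _ hΦ (theta_det a b c s1 s2 s3 ha hb)
    (df 0 2 (-1)) (df 1 3 a) (df 0 2 (a ^ 2 * b)) (df 1 3 b) ?_ ?_ ?_ ?_
  · intro x h1 h2 h3 h4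
    simp only [df_apply] at h1 h2 h3 h4
    have e1 : a ^ 2 * ((a - b) * x 2) = 0 := by linear_combination h3 - h1 + x 2 * ha
    have e2 : (a - b) * x 3 = 0 := by linear_combination h4 - h2
    have x2 : x 2 = 0 := (mul_eq_zero.mp ((mul_eq_zero.mp e1).resolve_left
      (pow_ne_zero 2 (cube_ne ha)))).resolve_left (sub_ne_zero.mpr hab)
    have x3 : x 3 = 0 := (mul_eq_zero.mp e2).resolve_left (sub_ne_zero.mpr hab)
    have x1 : x 1 = 0 := by linear_combination h2 + a * x3
    have x0 : x 0 = 0 := by linear_combination h1 - x2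
    funext i
    fin_cases i
    · exact x0
    · exact x1
    · exact x2
    · exact x3
  · intro x
    refine ⟨?_, ?_, ?_, ?_, ?_⟩ <;> rw [evL_apply] <;> simp [thetaM, Yv, df_apply]
  · exact cty_congr _ (fun x hx => ⟨sub_eq_zero.mp hx.1, sub_eq_zero.mp hx.2⟩) hr
  · exact cty_congr _ (fun x hx => ⟨sub_eq_zero.mp hx.1, sub_eq_zero.mp hx.2⟩) hcol

end Bridge

section Final
variable {K : Type} [Field K]

/-- The cube roots of `-1`. -/
def rt (ω : K) (i : Fin 3) : K := ![-1, -ω, -ω ^ 2] i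

lemma rt_add (ω : K) (hω : ω ^ 2 + ω + 1 = 0) (i j : Fin 3) : rt ω (i + j) = -(rt ω i * rt ω j) := by
  have h3 : ω ^ 3 = 1 := by linear_combination (ω - 1) * hω
  fin_cases i <;> fin_cases j <;> simp [rt]
  · ring
  · linear_combination -h3
  · linear_combination -h3
  · linear_combination -ω * h3

lemma rt_two (ω : K) (hω : ω ^ 2 + ω + 1 = 0) (i : Fin 3) : rt ω (2 * i) = -(rt ω i ^ 2) := by
  have e : 2 * i = i + i := by revert i; decide
  rw [e, rt_add ω hω, sq]

lemma rt_cube (ω : K) (hω : ω ^ 2 + ω + 1 = 0) (i : Fin 3) : rt ω i ^ 3 = -1 := by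
  have h3 : ω ^ 3 = 1 := by linear_combination (ω - 1) * hω
  fin_cases i <;> simp [rt]
  · norm_num
  · linear_combination -h3
  · linear_combination (-ω ^ 3 - 1) * h3

lemma rt_fact (ω : K) (hω : ω ^ 2 + ω + 1 = 0) (u v : K) :
    u ^ 3 + v ^ 3 = (u - rt ω 0 * v) * (u - rt ω 1 * v) * (u - rt ω 2 * v) := by
  simp only [rt, Matrix.cons_val]
  linear_combination (-u ^ 2 * v - ω * u * v ^ 2 - (ω - 1) * v ^ 3) * hω

lemma rt_inj [CharZero K] (ω : K) (hω : ω ^ 2 + ω + 1 = 0) (i j : Fin 3) (h : i ≠ j) : rt ω i ≠ rt ω j := by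
  have h1 : ω ≠ 1 := by
    rintro rfl
    have : (3 : K) = 0 := by linear_combination hω
    exact three_ne_zero this
  have h0 : ω ≠ 0 := by
    rintro rfl
    simp at hω
  have h2 : ω ^ 2 ≠ 1 := by
    intro h
    have h3 : ω + 2 = 0 := by linear_combination hω - h
    have h4 : (3 : K) = 0 := by linear_combination hω - (ω - 1) * h3
    exact three_ne_zero h4
  have h3 : ω ^ 2 ≠ ω := by
    intro h
    apply h1
    have : ω * (ω - 1) = 0 := by linear_combination h
    rcases mul_eq_zero.mp this with h | h
    · exact absurd h h0
    · linear_combination h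
  fin_cases i <;> fin_cases j <;> simp_all [rt, eq_comm]

lemma rt_surj (ω : K) (hω : ω ^ 2 + ω + 1 = 0) (a : K) (ha : a ^ 3 = -1) : ∃ i, a = rt ω i := by
  have h := rt_fact ω hω a 1
  have h' : (a - rt ω 0 * 1) * (a - rt ω 1 * 1) * (a - rt ω 2 * 1) = 0 := by
    rw [← h]; linear_combination ha
  rcases mul_eq_zero.mp h' with h' | h'
  · rcases mul_eq_zero.mp h' with h' | h'
    · exact ⟨0, by linear_combination h'⟩
    · exact ⟨1, by linear_combination h'⟩
  · exact ⟨2, by linear_combination h'⟩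

lemma exists_omega [IsAlgClosed K] [CharZero K] : ∃ ω : K, ω ^ 2 + ω + 1 = 0 := by
  obtain ⟨s, hs⟩ := IsAlgClosed.exists_pow_nat_eq (-3 : K) (n := 2) (by norm_num)
  refine ⟨(s - 1) / 2, ?_⟩
  field_simp
  linear_combination hs

lemma dd_congr {V : Type} [AddCommGroup V] [Module K V] (Φ : V →ₗ[K] Matrix (Fin 3) (Fin 3) K)
    (P Q : V → Prop) (h : ∀ x, P x ↔ Q x) : dd Φ P = dd Φ Q := by
  have : P = Q := funext fun x => propext (h x)
  rw [this]

lemma dd_ok {V : Type} [AddCommGroup V] [Module K V] (Φ : V →ₗ[K] Matrix (Fin 3) (Fin 3) K)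
    (P : V → Prop) : okv (dd Φ P) := by
  unfold dd okv
  split_ifs <;> simp

lemma dd_pos {V : Type} [AddCommGroup V] [Module K V] (Φ : V →ₗ[K] Matrix (Fin 3) (Fin 3) K)
    (P : V → Prop) (h : dd Φ P = 1) : Cty Φ P := by
  by_contra hc
  unfold dd at h
  rw [if_neg hc] at h
  split_ifs at h <;> simp at h

lemma dd_negv {V : Type} [AddCommGroup V] [Module K V] (Φ : V →ₗ[K] Matrix (Fin 3) (Fin 3) K)
    (P : V → Prop) (h : dd Φ P = -1) : Cty (tr Φ) P := by
  by_contra hc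
  unfold dd at h
  rw [if_neg hc] at h
  split_ifs at h <;> simp at h

lemma dd_ne {V : Type} [AddCommGroup V] [Module K V] (Φ : V →ₗ[K] Matrix (Fin 3) (Fin 3) K)
    (P : V → Prop) (h : Cty Φ P ∨ Cty (tr Φ) P) : dd Φ P ≠ 0 := by
  unfold dd
  split_ifs with h1 h2
  · simp
  · simp
  · tauto

lemma classify [IsAlgClosed K] [CharZero K] (Φ : (Fin 4 → K) →ₗ[K] Matrix (Fin 3) (Fin 3) K)
    (hΦ : ∀ x, (Φ x).det = FF x) :
    (∃ b c d ε : K, b ^ 3 = -1 ∧ c ^ 3 = -1 ∧ d ^ 3 = -1 ∧ ε ^ 3 = 1 ∧ ε ≠ 1 ∧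
      (Eqv Φ (evL _ (alpha_hom b c d ε)) ∨ Eqv Φ (evL _ (beta_hom b c d ε)))) ∨
    (∃ a b c ε : K, cubePerm K a b c ∧ ε ^ 3 = 1 ∧ ε ≠ 1 ∧ Eqv Φ (evL _ (eta_hom a b c ε))) ∨
    (∃ a b c : K, cubePerm K a b c ∧ Eqv Φ (evL _ (theta_hom a b c))) := by
  obtain ⟨ω, hω⟩ := exists_omega (K := K)
  have hc := rt_cube ω hω
  have hi := rt_inj ω hω
  have hs := rt_surj ω hω
  have ha := rt_add ω hω
  have h2 := rt_two ω hω
  have hf := rt_fact ω hω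
  have r0 : rt ω 0 = -1 := rfl
  have ES : ∀ (σ : Equiv.Perm (Fin 4)) (i : Fin 3), dd Φ (Ln σ (rt ω i) (rt ω 0)) +
      dd Φ (Ln σ (rt ω i) (rt ω 1)) + dd Φ (Ln σ (rt ω i) (rt ω 2)) = 0 := fun σ i =>
    eck_sum Φ hΦ σ (rt ω i) (rt ω 0) (rt ω 1) (rt ω 2) (hc i) hf (hi 0 1 (by decide))
      (hi 1 2 (by decide)) (hi 0 2 (by decide))
  obtain ⟨r, hrr⟩ : ∃ r, r = rt ω := ⟨_, rfl⟩
  simp only [← hrr] at hc hi hs ha h2 hf r0 ES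
  clear hrr
  have third : ∀ j j' : Fin 3, j' ≠ j → ∃ c, cubePerm K (r j) (r j') c := by
    intro j j' h
    obtain ⟨k, hk1, hk2⟩ : ∃ k : Fin 3, j ≠ k ∧ j' ≠ k := by revert j j'; decide
    exact ⟨r k, hc _, hc _, hc _, hi _ _ h.symm, hi _ _ hk1, hi _ _ hk2⟩
  have hne : ∀ i j m n : Fin 3, m ≠ n + i + j → r m ≠ r n * r i * r j := by
    intro i j m n h
    have := hi _ _ h
    rw [ha, ha] at this
    intro h'
    apply this
    rw [h']; ring
  have key := comb (fun i j => dd Φ (lnx (r i) (r j))) (fun i j => dd Φ (lny (r i) (r j)))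
    (fun i j => dd Φ (lnz (r i) (r j))) (fun i j => dd_ok _ _) (fun i j => dd_ok _ _)
    (fun i j => dd_ok _ _) ?_ ?_ ?_ ?_ ?_ ?_
  · rcases key with ⟨i, j, m, n, h1, h3, h4⟩ | ⟨i, j, m, n, h1, h3, h4⟩ | ⟨j, i', j', h1, h3, h4, h5⟩ |
      ⟨j, j', h1, h3, h4⟩
    · left
      obtain ⟨ε, e1, e2, e3⟩ := alpha_case Φ hΦ (r m) (r n) (r i) (r j) (hc _) (hc _) (hc _) (hc _)
        (hne _ _ _ _ h4) (dd_negv _ _ h3) (dd_pos _ _ h1)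
      exact ⟨r n, r i, r j, ε, hc _, hc _, hc _, e1, e2, Or.inl e3⟩
    · left
      obtain ⟨ε, e1, e2, e3⟩ := alpha_case (tr Φ)
        (fun x => by rw [tr_apply, Matrix.det_transpose, hΦ])
        (r m) (r n) (r i) (r j) (hc _) (hc _) (hc _) (hc _)
        (hne _ _ _ _ h4) (by rw [tr_tr]; exact dd_pos _ _ h3) (dd_negv _ _ h1)
      refine ⟨r n, r i, r j, ε, hc _, hc _, hc _, e1, e2, Or.inr ?_⟩
      have := e3.tr
      rw [tr_tr] at this
      exact this
    · right; left
      obtain ⟨c, hp⟩ := third j j' h5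
      have e1 : (-(r i')) ^ 3 = 1 := by linear_combination -(hc i')
      have e2 : -(r i') ≠ 1 := by
        intro h
        apply hi _ _ h4
        rw [r0]; linear_combination -h
      refine ⟨r j, r j', c, -(r i'), hp, e1, e2, eta_case Φ hΦ _ _ _ _ hp e1 e2 ?_ ?_⟩
      · rw [← r0]; exact dd_negv _ _ h1
      · rw [neg_neg]; exact dd_pos _ _ h3
    · right; right
      obtain ⟨c, hp⟩ := third j j' h4
      refine ⟨r j, r j', c, hp, theta_case Φ hΦ _ _ _ hp ?_ ?_⟩
      · rw [← r0]; exact dd_negv _ _ h1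
      · have e : r j ^ 2 * r j' = r (2 * j + j') := by rw [ha, h2]; ring
        rw [e]; exact dd_pos _ _ h3
  · intro i
    exact ES 1 i
  · intro j
    have e : ∀ i, dd Φ (lnx (r i) (r j)) =
        dd Φ (Ln (Equiv.swap 0 2 * Equiv.swap 1 3) (r j) (r i)) := fun i => dd_congr _ _ _ fun x => by
      have s0 : (Equiv.swap 0 2 * Equiv.swap 1 3 : Equiv.Perm (Fin 4)) 0 = 2 := by decide
      have s1 : (Equiv.swap 0 2 * Equiv.swap 1 3 : Equiv.Perm (Fin 4)) 1 = 3 := by decide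
      have s2 : (Equiv.swap 0 2 * Equiv.swap 1 3 : Equiv.Perm (Fin 4)) 2 = 0 := by decide
      have s3 : (Equiv.swap 0 2 * Equiv.swap 1 3 : Equiv.Perm (Fin 4)) 3 = 1 := by decide
      unfold lnx Ln
      rw [s0, s1, s2, s3, and_comm]
    simp only [e]
    exact ES _ j
  · intro i
    have e : ∀ j, dd Φ (lny (r i) (r j)) =
        dd Φ (Ln (Equiv.swap 1 2) (r i) (r j)) := fun j => dd_congr _ _ _ fun x => by
      have s0 : (Equiv.swap 1 2 : Equiv.Perm (Fin 4)) 0 = 0 := by decide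
      have s1 : (Equiv.swap 1 2 : Equiv.Perm (Fin 4)) 1 = 2 := by decide
      have s2 : (Equiv.swap 1 2 : Equiv.Perm (Fin 4)) 2 = 1 := by decide
      have s3 : (Equiv.swap 1 2 : Equiv.Perm (Fin 4)) 3 = 3 := by decide
      unfold lny Ln
      rw [s0, s1, s2, s3]
    simp only [e]
    exact ES _ i
  · intro j
    have e : ∀ i, dd Φ (lny (r i) (r j)) =
        dd Φ (Ln (Equiv.swap 0 1 * Equiv.swap 1 3 * Equiv.swap 3 2) (r j) (r i)) :=
      fun i => dd_congr _ _ _ fun x => by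
      have s0 : (Equiv.swap 0 1 * Equiv.swap 1 3 * Equiv.swap 3 2 : Equiv.Perm (Fin 4)) 0 = 1 := by decide
      have s1 : (Equiv.swap 0 1 * Equiv.swap 1 3 * Equiv.swap 3 2 : Equiv.Perm (Fin 4)) 1 = 3 := by decide
      have s2 : (Equiv.swap 0 1 * Equiv.swap 1 3 * Equiv.swap 3 2 : Equiv.Perm (Fin 4)) 2 = 0 := by decide
      have s3 : (Equiv.swap 0 1 * Equiv.swap 1 3 * Equiv.swap 3 2 : Equiv.Perm (Fin 4)) 3 = 2 := by decide
      unfold lny Ln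
      rw [s0, s1, s2, s3, and_comm]
    simp only [e]
    exact ES _ j
  · intro i j k
    have := cross_sum Φ hΦ (r i) (r j) (r k) (hc _) (hc _) (hc _)
    have e1 : -(r i ^ 2 * r j * r k) = r (2 * i + j + k) := by rw [ha, ha, h2]; ring
    have e2 : -(r j * r k) = r (j + k) := by rw [ha]
    have e3 : r i ^ 2 * r k = r (2 * i + k) := by rw [ha, h2]; ring
    rw [e1, e2, e3] at this
    exact this
  · rcases exists_type Φ hΦ with h | ⟨a, b, h3, h4, h⟩
    · exact ⟨0, 0, Or.inl (dd_ne _ _ (Or.inl (by rw [r0]; exact h)))⟩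
    · obtain ⟨i, rfl⟩ := hs a h3
      obtain ⟨j, rfl⟩ := hs b h4
      refine ⟨i, j, ?_⟩
      rcases h with h | h | h
      · exact Or.inl (dd_ne _ _ (Or.inr h))
      · exact Or.inr (Or.inl (dd_ne _ _ (Or.inr h)))
      · exact Or.inr (Or.inr (dd_ne _ _ (Or.inr h)))

end Final

theorem stmt14 (K : Type) [Field K] [IsAlgClosed K] [CharZero K]
    (φ : Matrix (Fin 3) (Fin 3) (S K))
    (hhom : ∀ k l, (φ k l).IsHomogeneous 1) (hdet : φ.det = f4 K) :
    (∃ b c d ε : K, b ^ 3 = -1 ∧ c ^ 3 = -1 ∧ d ^ 3 = -1 ∧ ε ^ 3 = 1 ∧ ε ≠ 1 ∧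
      (Nonempty (coker K φ ≃ₗ[R4 K] coker K (alphaM K b c d ε)) ∨
        Nonempty (coker K φ ≃ₗ[R4 K] coker K (betaM K b c d ε)))) ∨
    (∃ a b c ε : K, cubePerm K a b c ∧ ε ^ 3 = 1 ∧ ε ≠ 1 ∧
      Nonempty (coker K φ ≃ₗ[R4 K] coker K (etaM K a b c ε))) ∨
    (∃ a b c : K, cubePerm K a b c ∧
      Nonempty (coker K φ ≃ₗ[R4 K] coker K (thetaM K a b c))) := by
  rcases classify (evL φ hhom) (evL_det φ hhom hdet) with
    ⟨b, c, d, ε, h1, h2, h3, h4, h5, h6⟩ | ⟨a, b, c, ε, h1, h2, h3, h4⟩ | ⟨a, b, c, h1, h2⟩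
  · refine Or.inl ⟨b, c, d, ε, h1, h2, h3, h4, h5, ?_⟩
    rcases h6 with h | h
    · exact Or.inl (coker_iso _ _ _ _ h)
    · exact Or.inr (coker_iso _ _ _ _ h)
  · exact Or.inr (Or.inl ⟨a, b, c, ε, h1, h2, h3, coker_iso _ _ _ _ h4⟩)
  · exact Or.inr (Or.inr ⟨a, b, c, h1, coker_iso _ _ _ _ h2⟩)
end
end

section
/- For parameters b³ = c³ = d³ = −1, ε³ = 1, ε ≠ 1 and n³ = p³ = q³ = −1, y³ = 1, y ≠ 1: Coker α(b,c,d,ε) ≅ Coker α(n,p,q,y) as R₄-modules if and only if (n,p,q,y) = (b,c,d,ε) or (n,p,q,y) = (bε, cε, dε, ε²); the same equivalence holds with β in place of α; and Coker α(b,c,d,ε) is never isomorphic to Coker β(n,p,q,y). -/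
open MvPolynomial Matrix TensorProduct

set_option maxHeartbeats 1000000
set_option synthInstance.maxHeartbeats 400000

noncomputable section

/-- The matrix of linear forms with the given coefficient matrices. -/
def lin3 (K : Type) [Field K] (A : Fin 4 → Matrix (Fin 3) (Fin 3) K) :
    Matrix (Fin 3) (Fin 3) (S K) :=
  fun r s => ∑ i, C (A i r s) * X i

/-- Coefficient matrices of `alphaM`. -/
def acoef (K : Type) [Field K] (b c d ε : K) : Fin 4 → Matrix (Fin 3) (Fin 3) K :=
  ![!![0, 1, 0; 1, 0, 0; 0, 0, -1],
    !![0, 0, 1; -c, 0, 0; 0, c ^ 2, -c],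
    !![0, 0, -b; 0, -b ^ 2, b ^ 2 * c ^ 2; 1, b * c ^ 2, 0],
    !![0, -(ε ^ 2 * b * c * d), 0;
       0, -(ε ^ 2 * b * c * d * b * c ^ 2 * ε ^ 2), -(ε ^ 2 * b * c * d * b * c * ε ^ 2);
       -d, ε ^ 2 * b * c * d * c, -(ε ^ 2 * b * c * d)]]

theorem alphaM_eq (K : Type) [Field K] (b c d ε : K) :
    alphaM K b c d ε = lin3 K (acoef K b c d ε) := by
  ext1 r s
  fin_cases r <;> fin_cases s <;>
    simp [alphaM, lin3, acoef, Fin.sum_univ_four, Yv] <;> ring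

theorem betaM_eq (K : Type) [Field K] (b c d ε : K) :
    betaM K b c d ε = lin3 K (fun i => (acoef K b c d ε i)ᵀ) := by
  rw [betaM, alphaM_eq]
  rfl

theorem proj_lift (K : Type) [Field K] (w : Fin 3 → R4 K) :
    ∃ w' : Fin 3 → S K, (fun i => proj K (w' i)) = w := by
  choose f hf using fun i => Ideal.Quotient.mk_surjective (w i)
  exact ⟨f, funext hf⟩

theorem mbar_proj (K : Type) [Field K] (M : Matrix (Fin 3) (Fin 3) (S K)) (w : Fin 3 → S K) :
    mbar K M (fun i => proj K (w i)) = fun i => proj K ((M *ᵥ w) i) := by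
  ext i
  simp [Matrix.mulVec, dotProduct]

theorem lift_hom (K : Type) [Field K] (M N : Matrix (Fin 3) (Fin 3) (S K))
    (φ : coker K M →ₗ[R4 K] coker K N) :
    ∃ U : Matrix (Fin 3) (Fin 3) (S K), ∀ v : Fin 3 → S K,
      φ (Submodule.Quotient.mk (fun i => proj K (v i))) =
        Submodule.Quotient.mk (fun i => proj K ((U *ᵥ v) i)) := by
  have h : ∀ j : Fin 3, ∃ u : Fin 3 → S K,
      (Submodule.Quotient.mk (fun i => proj K (u i)) : coker K N) =
        φ (Submodule.Quotient.mk (Pi.single j 1)) := by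
    intro j
    obtain ⟨w, hw⟩ := Submodule.Quotient.mk_surjective _ (φ (Submodule.Quotient.mk (Pi.single j 1)))
    obtain ⟨w', rfl⟩ := proj_lift K w
    exact ⟨w', hw⟩
  choose u hu using h
  refine ⟨fun i j => u j i, fun v => ?_⟩
  have e1 : (fun i => proj K (v i)) =
      ∑ j, proj K (v j) • (Pi.single j 1 : Fin 3 → R4 K) := by
    ext i
    fin_cases i <;> simp [Fin.sum_univ_three]
  have e2 : (fun i => proj K (((fun i j => u j i : Matrix (Fin 3) (Fin 3) (S K)) *ᵥ v) i)) =
      ∑ j, proj K (v j) • (fun i => proj K (u j i)) := by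
    ext i
    simp [Matrix.mulVec, dotProduct, mul_comm]
  rw [e1, e2]
  simp only [← Submodule.mkQ_apply, map_sum, map_smul] at hu ⊢
  simp only [hu]

theorem exists_of_mk_eq (K : Type) [Field K] (N : Matrix (Fin 3) (Fin 3) (S K))
    (v w : Fin 3 → S K)
    (h : (Submodule.Quotient.mk (fun i => proj K (v i)) : coker K N) =
      Submodule.Quotient.mk (fun i => proj K (w i))) :
    ∃ x g : Fin 3 → S K, ∀ i, v i = w i + (N *ᵥ x) i + f4 K * g i := by
  rw [Submodule.Quotient.eq] at h
  obtain ⟨x, hx⟩ := h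
  obtain ⟨x, rfl⟩ := proj_lift K x
  rw [mbar_proj] at hx
  have : ∀ i, ∃ g, v i - w i - (N *ᵥ x) i = f4 K * g := by
    intro i
    have := congrFun hx i
    simp only [Pi.sub_apply] at this
    rw [← map_sub, eq_comm, Ideal.Quotient.eq, Ideal.mem_span_singleton] at this
    exact this
  choose g hg using this
  refine ⟨x, g, fun i => ?_⟩
  rw [← hg]; ring

theorem cc_f4 (K : Type) [Field K] : constantCoeff (f4 K) = 0 := by
  simp [f4, Yv]

theorem pd_f4 (K : Type) [Field K] (k : Fin 4) : constantCoeff (pderiv k (f4 K)) = 0 := by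
  simp [f4, Yv, Derivation.leibniz_pow]

theorem cc_lin3 (K : Type) [Field K] (A : Fin 4 → Matrix (Fin 3) (Fin 3) K) (r s : Fin 3) :
    constantCoeff (lin3 K A r s) = 0 := by
  simp [lin3]

theorem pd_lin3 (K : Type) [Field K] (A : Fin 4 → Matrix (Fin 3) (Fin 3) K) (r s : Fin 3)
    (k : Fin 4) : constantCoeff (pderiv k (lin3 K A r s)) = A k r s := by
  simp [lin3, pderiv_X, Pi.single_apply, Fin.sum_univ_four]
  fin_cases k <;> simp

theorem hom_rel (K : Type) [Field K] (A B : Fin 4 → Matrix (Fin 3) (Fin 3) K)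
    (φ : coker K (lin3 K A) →ₗ[R4 K] coker K (lin3 K B))
    (U : Matrix (Fin 3) (Fin 3) (S K)) (hU : ∀ v : Fin 3 → S K,
      φ (Submodule.Quotient.mk (fun i => proj K (v i))) =
        Submodule.Quotient.mk (fun i => proj K ((U *ᵥ v) i))) :
    ∃ V : Matrix (Fin 3) (Fin 3) K, ∀ k, U.map constantCoeff * A k = B k * V := by
  have h : ∀ j : Fin 3, ∃ x g : Fin 3 → S K, ∀ i,
      (U *ᵥ (fun r => lin3 K A r j)) i = (0 : Fin 3 → S K) i + (lin3 K B *ᵥ x) i + f4 K * g i := by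
    intro j
    apply exists_of_mk_eq
    rw [← hU]
    have z : (Submodule.Quotient.mk (fun i => proj K (lin3 K A i j)) : coker K (lin3 K A)) = 0 := by
      rw [Submodule.Quotient.mk_eq_zero]
      refine ⟨fun i => proj K ((Pi.single j 1 : Fin 3 → S K) i), ?_⟩
      rw [mbar_proj]
      ext i
      simp
    have z' : (fun i => proj K ((0 : Fin 3 → S K) i)) = 0 := by ext i; simp
    rw [z, z', map_zero, Submodule.Quotient.mk_zero]
  choose x g hx using h
  refine ⟨Matrix.of fun i j => constantCoeff (x j i), fun k => ?_⟩
  ext i j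
  have := congrArg (fun t => constantCoeff (pderiv k t)) (hx j i)
  simp only [Matrix.mulVec, dotProduct, Fin.sum_univ_three, Pi.zero_apply, map_add, map_zero,
    Derivation.leibniz, smul_eq_mul, map_mul, cc_f4, pd_f4, cc_lin3, pd_lin3] at this
  simp only [Matrix.mul_apply, Fin.sum_univ_three, Matrix.map_apply, Matrix.of_apply]
  linear_combination this

theorem hom_inv (K : Type) [Field K] (A : Fin 4 → Matrix (Fin 3) (Fin 3) K)
    (U U' : Matrix (Fin 3) (Fin 3) (S K))
    (h : ∀ v : Fin 3 → S K,
      (Submodule.Quotient.mk (fun i => proj K ((U' *ᵥ (U *ᵥ v)) i)) : coker K (lin3 K A)) =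
        Submodule.Quotient.mk (fun i => proj K (v i))) :
    U'.map constantCoeff * U.map constantCoeff = 1 := by
  ext i j
  obtain ⟨x, g, hx⟩ := exists_of_mk_eq K _ _ _ (h (Pi.single j 1))
  have := congrArg constantCoeff (hx i)
  rw [Matrix.mulVec_mulVec] at this
  simp only [Matrix.mulVec, dotProduct, map_add, map_mul, cc_f4, cc_lin3, map_sum,
    Matrix.mul_apply] at this
  simp only [Matrix.mul_apply, Matrix.map_apply, Matrix.one_apply]
  simp [Pi.single_apply] at this
  rw [this]

theorem iso_mats (K : Type) [Field K] (A B : Fin 4 → Matrix (Fin 3) (Fin 3) K)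
    (e : coker K (lin3 K A) ≃ₗ[R4 K] coker K (lin3 K B)) :
    ∃ U V U' V' : Matrix (Fin 3) (Fin 3) K, (∀ k, U * A k = B k * V) ∧
      (∀ k, U' * B k = A k * V') ∧ U' * U = 1 ∧ U * U' = 1 := by
  obtain ⟨U, hU⟩ := lift_hom K _ _ e.toLinearMap
  obtain ⟨U', hU'⟩ := lift_hom K _ _ e.symm.toLinearMap
  obtain ⟨V, hV⟩ := hom_rel K A B _ U hU
  obtain ⟨V', hV'⟩ := hom_rel K B A _ U' hU'
  refine ⟨_, V, _, V', hV, hV', hom_inv K A U U' fun v => ?_, hom_inv K B U' U fun v => ?_⟩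
  · rw [← hU', ← hU]; simp
  · rw [← hU, ← hU']; simp

/-- consequences for first rows and columns -/
theorem iso_vecs (K : Type) [Field K] (A B : Fin 4 → Matrix (Fin 3) (Fin 3) K)
    (e : coker K (lin3 K A) ≃ₗ[R4 K] coker K (lin3 K B))
    (k1 : Fin 4) (hk : ∃ i, B k1 i 0 ≠ 0) :
    (∃ u : Fin 3 → K, u ≠ 0 ∧ ∀ (k l : Fin 4) (t : K),
      (∀ j, B k 0 j + t * B l 0 j = 0) → u ᵥ* (A k + t • A l) = 0) ∧
    (∃ v : Fin 3 → K, v ≠ 0 ∧ ∀ (k l : Fin 4) (t : K),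
      (∀ j, B k j 0 + t * B l j 0 = 0) → (A k + t • A l) *ᵥ v = 0) := by
  obtain ⟨U, V, U', V', hV, hV', h1, h2⟩ := iso_mats K A B e
  constructor
  · refine ⟨Pi.single 0 1 ᵥ* U, ?_, ?_⟩
    · intro h
      have h3 : (Pi.single 0 1 ᵥ* U) ᵥ* U' = 0 := by rw [h, Matrix.zero_vecMul]
      rw [Matrix.vecMul_vecMul, h2, Matrix.vecMul_one] at h3
      simpa using congrFun h3 0
    · intro k l t h
      have e0 : U * (A k + t • A l) = (B k + t • B l) * V := by
        rw [mul_add, add_mul, hV, Matrix.mul_smul, Matrix.smul_mul, hV]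
      rw [Matrix.vecMul_vecMul, e0, ← Matrix.vecMul_vecMul]
      have : Pi.single 0 1 ᵥ* (B k + t • B l) = 0 := by
        ext j
        simpa using h j
      rw [this, Matrix.zero_vecMul]
  · refine ⟨V' *ᵥ Pi.single 0 1, ?_, ?_⟩
    · intro h
      obtain ⟨i, hi⟩ := hk
      apply hi
      have h3 : B k1 *ᵥ Pi.single 0 1 = 0 := by
        have : (U * (U' * B k1)) *ᵥ Pi.single 0 1 = 0 := by
          rw [hV', ← Matrix.mulVec_mulVec, ← Matrix.mulVec_mulVec, h]; simp
        rwa [← Matrix.mul_assoc, h2, Matrix.one_mul] at this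
      simpa using congrFun h3 i
    · intro k l t h
      have e0 : (A k + t • A l) * V' = U' * (B k + t • B l) := by
        rw [mul_add, add_mul, hV', Matrix.mul_smul, Matrix.smul_mul, hV']
      rw [Matrix.mulVec_mulVec, e0, ← Matrix.mulVec_mulVec]
      have : (B k + t • B l) *ᵥ Pi.single 0 1 = 0 := by
        ext j
        simpa using h j
      rw [this, Matrix.mulVec_zero]

theorem vec3_ne (K : Type) [Field K] (u : Fin 3 → K) (h : u ≠ 0) :
    ¬ (u 0 = 0 ∧ u 1 = 0 ∧ u 2 = 0) := by
  rintro ⟨h0, h1, h2⟩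
  apply h
  ext i
  fin_cases i <;> assumption

theorem ne_of_cube (K : Type) [Field K] (b : K) (hb : b ^ 3 = -1) : b ≠ 0 := by
  rintro rfl
  simp at hb

theorem eps_rel (K : Type) [Field K] (ε : K) (he : ε ^ 3 = 1) (hne : ε ≠ 1) :
    ε ^ 2 + ε + 1 = 0 := by
  have : (ε - 1) * (ε ^ 2 + ε + 1) = 0 := by linear_combination he
  rcases mul_eq_zero.mp this with h | h
  · exact absurd (sub_eq_zero.mp h) hne
  · exact h

theorem left14 (K : Type) [Field K] [CharZero K] (b c d ε a' n : K)
    (hb : b ^ 3 = -1) (hc : c ^ 3 = -1) (hd : d ^ 3 = -1) (he : ε ^ 2 + ε + 1 = 0) (hne : ε ≠ 1)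
    (u : Fin 3 → K) (hu : u ≠ 0)
    (h1 : u ᵥ* (acoef K b c d ε 3 + a' • acoef K b c d ε 0) = 0)
    (h2 : u ᵥ* (acoef K b c d ε 2 + n • acoef K b c d ε 1) = 0) :
    (a' = ε ^ 2 * b * c * d ∧ n = b) ∨ (a' = ε ^ 2 * b * c * d * ε ^ 2 ∧ n = b * ε) := by
  have hu := vec3_ne K u hu
  have hb0 := ne_of_cube K b hb
  have hc0 := ne_of_cube K c hc
  have hd0 := ne_of_cube K d hd
  have e10 := congrFun h1 0
  have e11 := congrFun h1 1
  have e12 := congrFun h1 2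
  have e20 := congrFun h2 0
  have e21 := congrFun h2 1
  have e22 := congrFun h2 2
  simp [acoef, Matrix.vecMul, dotProduct, Fin.sum_univ_three, -mul_eq_zero] at e10 e11 e12 e20 e21 e22
  generalize u 0 = u1 at *
  generalize u 1 = u2 at *
  generalize u 2 = u3 at *
  clear h1 h2
  have h3 : u3 = n * c * u2 := by linear_combination e20
  subst h3
  by_cases hz : u2 = 0
  · subst hz
    have : u1 ≠ 0 := by intro h; apply hu; simp [h]
    left
    constructor
    · apply mul_left_cancel₀ this; linear_combination e11
    · apply mul_left_cancel₀ this; linear_combination e22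
  · right
    have k1 : a' = n * c * d := by apply mul_left_cancel₀ hz; linear_combination e10
    have k2 : n ^ 2 + n * b + b ^ 2 = 0 := by
      apply mul_left_cancel₀ hz
      linear_combination -e21 + u2 * (n * b + n ^ 2) * hc
    have k3 : ε * b ^ 2 + ε ^ 2 * b * n + n ^ 2 = 0 := by
      apply mul_left_cancel₀ hz
      apply mul_left_cancel₀ hd0
      apply mul_left_cancel₀ hc0
      apply mul_left_cancel₀ hc0
      rw [k1] at e12
      have he3 : ε ^ 3 = 1 := by linear_combination (ε - 1) * he
      linear_combination -e12 - u2 * b ^ 2 * c ^ 2 * d * ε * he3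
    have k4 : n = b * ε := by
      apply mul_left_cancel₀ (sub_ne_zero.mpr hne)
      apply mul_left_cancel₀ hb0
      grind
    refine ⟨?_, k4⟩
    rw [k1, k4]
    grind

theorem right12 (K : Type) [Field K] [CharZero K] (b c d ε p q : K)
    (hb : b ^ 3 = -1) (hc : c ^ 3 = -1) (hd : d ^ 3 = -1) (he : ε ^ 2 + ε + 1 = 0) (hne : ε ≠ 1)
    (v : Fin 3 → K) (hv : v ≠ 0) (hq0 : q ≠ 0)
    (h1 : (acoef K b c d ε 1 + p • acoef K b c d ε 0) *ᵥ v = 0)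
    (h2 : (acoef K b c d ε 3 + q • acoef K b c d ε 2) *ᵥ v = 0) :
    (p = c ∧ q = d) ∨ (p = c * ε ∧ q = d * ε) := by
  have hv := vec3_ne K v hv
  have hb0 := ne_of_cube K b hb
  have hc0 := ne_of_cube K c hc
  have hd0 := ne_of_cube K d hd
  have e10 := congrFun h1 0
  have e11 := congrFun h1 1
  have e12 := congrFun h1 2
  have e20 := congrFun h2 0
  have e21 := congrFun h2 1
  have e22 := congrFun h2 2
  simp [acoef, Matrix.mulVec, dotProduct, Fin.sum_univ_three, -mul_eq_zero] at e10 e11 e12 e20 e21 e22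
  generalize v 0 = v1 at *
  generalize v 1 = v2 at *
  generalize v 2 = v3 at *
  clear h1 h2
  have h3 : v3 = - p * v2 := by linear_combination e10
  subst h3
  by_cases hz : v2 = 0
  · subst hz
    have : v1 ≠ 0 := by intro h; apply hv; simp [h]
    left
    constructor
    · grind
    · apply mul_left_cancel₀ this; linear_combination e22
  · right
    have k1 : ε ^ 2 * c * d = q * p := by
      apply mul_left_cancel₀ hz
      apply mul_left_cancel₀ hb0
      linear_combination -e20
    have k2 : p ^ 2 + p * c + c ^ 2 = 0 := by
      apply mul_left_cancel₀ hz
      linear_combination e12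
    have k3 : -(ε ^ 2 * c * d * b ^ 2 * c ^ 2 * ε ^ 2) - q * b ^ 2
        + p * (ε ^ 2 * c * d * b ^ 2 * c * ε ^ 2 - q * b ^ 2 * c ^ 2) = 0 := by
      apply mul_left_cancel₀ hz
      linear_combination e21
    have k4 : -(p * c ^ 2 * ε ^ 2) - 1 + p * (p * c * ε ^ 2 - c ^ 2) = 0 := by
      apply mul_left_cancel₀ hq0
      apply mul_left_cancel₀ hb0
      apply mul_left_cancel₀ hb0
      rw [k1] at k3
      linear_combination k3
    have k5 : p = c * ε := by
      apply mul_left_cancel₀ (sub_ne_zero.mpr hne)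
      grind
    refine ⟨k5, ?_⟩
    apply mul_left_cancel₀ hc0
    grind

theorem left12 (K : Type) [Field K] [CharZero K] (b c d ε p q : K)
    (hb : b ^ 3 = -1) (hc : c ^ 3 = -1) (hd : d ^ 3 = -1) (he : ε ^ 2 + ε + 1 = 0)
    (u : Fin 3 → K) (hu : u ≠ 0)
    (h1 : u ᵥ* (acoef K b c d ε 1 + p • acoef K b c d ε 0) = 0)
    (h2 : u ᵥ* (acoef K b c d ε 3 + q • acoef K b c d ε 2) = 0) :
    p * q = c * d * ε := by
  have hu := vec3_ne K u hu
  have hb0 := ne_of_cube K b hb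
  have hc0 := ne_of_cube K c hc
  have hd0 := ne_of_cube K d hd
  have e10 := congrFun h1 0
  have e11 := congrFun h1 1
  have e12 := congrFun h1 2
  have e20 := congrFun h2 0
  have e21 := congrFun h2 1
  have e22 := congrFun h2 2
  simp [acoef, Matrix.vecMul, dotProduct, Fin.sum_univ_three, -mul_eq_zero] at e10 e11 e12 e20 e21 e22
  generalize u 0 = u1 at *
  generalize u 1 = u2 at *
  generalize u 2 = u3 at *
  clear h1 h2
  have h3 : u1 = (c + p) * u3 := by linear_combination e12
  subst h3
  by_cases hz : u3 = 0
  · subst hz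
    have h0 : u2 ≠ 0 := by intro h; apply hu; simp [h]
    have k1 : p = c := by apply mul_left_cancel₀ h0; linear_combination e10
    have k2 : q = ε * d := by
      apply mul_left_cancel₀ h0
      apply mul_left_cancel₀ hb0
      apply mul_left_cancel₀ hb0
      grind
    rw [k1, k2]; ring
  · have k0 : q = d := by apply mul_left_cancel₀ hz; linear_combination e20
    have k2 : p ^ 2 + p * c + c ^ 2 = 0 := by
      apply mul_left_cancel₀ hz
      linear_combination e11
    have k3 : p ≠ c := by
      rintro rfl
      have : p ^ 2 = 0 := by linear_combination k2 / 3
      exact hc0 (by simpa using this)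
    have k4 : u2 = 0 := by
      apply mul_left_cancel₀ (sub_ne_zero.mpr k3); linear_combination e10
    subst k4 k0
    have k5 : ε ^ 2 * p = c := by
      apply mul_left_cancel₀ hz
      apply mul_left_cancel₀ hb0
      apply mul_left_cancel₀ hd0
      apply mul_left_cancel₀ hc0
      linear_combination -e21
    grind

theorem right14 (K : Type) [Field K] [CharZero K] (b c d ε a' n : K)
    (hb : b ^ 3 = -1) (hc : c ^ 3 = -1) (hd : d ^ 3 = -1) (he : ε ^ 2 + ε + 1 = 0)
    (v : Fin 3 → K) (hv : v ≠ 0)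
    (h1 : (acoef K b c d ε 3 + a' • acoef K b c d ε 0) *ᵥ v = 0)
    (h2 : (acoef K b c d ε 2 + n • acoef K b c d ε 1) *ᵥ v = 0) :
    (a' = ε ^ 2 * b * c * d ∧ n = b * ε) ∨ (a' = ε ^ 2 * b * c * d * ε ^ 2 ∧ n = b) := by
  have hv := vec3_ne K v hv
  have hb0 := ne_of_cube K b hb
  have hc0 := ne_of_cube K c hc
  have hd0 := ne_of_cube K d hd
  have he0 : ε ≠ 0 := by rintro rfl; simp at he
  have e10 := congrFun h1 0
  have e11 := congrFun h1 1
  have e12 := congrFun h1 2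
  have e20 := congrFun h2 0
  have e21 := congrFun h2 1
  have e22 := congrFun h2 2
  simp [acoef, Matrix.mulVec, dotProduct, Fin.sum_univ_three, -mul_eq_zero] at e10 e11 e12 e20 e21 e22
  generalize v 0 = v1 at *
  generalize v 1 = v2 at *
  generalize v 2 = v3 at *
  clear h1 h2
  have h3 : v1 = n * c * v3 - (b * c ^ 2 + n * c ^ 2) * v2 := by linear_combination e22
  subst h3
  by_cases hz : v2 = 0
  · subst hz
    have h0 : v3 ≠ 0 := by intro h; apply hv; simp [h]
    have k1 : n = b := by
      apply mul_left_cancel₀ h0; linear_combination e20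
    subst k1
    right
    refine ⟨?_, rfl⟩
    apply mul_left_cancel₀ h0
    apply mul_left_cancel₀ hb0
    apply mul_left_cancel₀ hc0
    linear_combination e11
  · have k1 : a' = ε ^ 2 * b * c * d := by
      apply mul_left_cancel₀ hz; linear_combination e10
    by_cases hy : v3 = 0
    · subst hy
      left
      refine ⟨k1, ?_⟩
      subst k1
      have : -(b + n) = b * ε ^ 2 := by
        apply mul_left_cancel₀ hz
        apply mul_left_cancel₀ (pow_ne_zero 2 he0)
        apply mul_left_cancel₀ hb0
        apply mul_left_cancel₀ hd0
        apply mul_left_cancel₀ hc0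
        apply mul_left_cancel₀ hc0
        apply mul_left_cancel₀ hc0
        linear_combination e11
      grind
    · exfalso
      have k1 : n = b := by
        apply mul_left_cancel₀ hy; linear_combination e20
      subst k1
      have : v2 * n ^ 2 = 0 := by
        grind
      simp [hz, hb0] at this

theorem lin3_mul (K : Type) [Field K] (A B : Fin 4 → Matrix (Fin 3) (Fin 3) K)
    (U V : Matrix (Fin 3) (Fin 3) K) (h : ∀ k, U * A k = B k * V) :
    U.map C * lin3 K A = lin3 K B * V.map C := by
  ext1 i j
  have h' : ∀ k, C ((U * A k) i j) * X k = (C ((B k * V) i j) * X k : S K) := by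
    intro k; rw [h]
  have h0 := h' 0
  have h1 := h' 1
  have h2 := h' 2
  have h3 := h' 3
  simp only [Matrix.mul_apply, Fin.sum_univ_three, map_add, map_mul] at h0 h1 h2 h3
  simp only [Matrix.mul_apply, Fin.sum_univ_three, lin3, Fin.sum_univ_four, Matrix.map_apply]
  linear_combination h0 + h1 + h2 + h3

theorem mk_iso (K : Type) [Field K] (M N : Matrix (Fin 3) (Fin 3) (S K))
    (U V U' V' : Matrix (Fin 3) (Fin 3) (S K)) (h : U * M = N * V) (h' : U' * N = M * V')
    (h1 : U' * U = 1) (h2 : U * U' = 1) :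
    Nonempty (coker K M ≃ₗ[R4 K] coker K N) := by
  have key : ∀ (M N U V : Matrix (Fin 3) (Fin 3) (S K)), U * M = N * V →
      LinearMap.range (mbar K M) ≤ (LinearMap.range (mbar K N)).comap (mbar K U) := by
    intro M N U V h
    rintro _ ⟨x, rfl⟩
    refine ⟨mbar K V x, ?_⟩
    simp only [Matrix.mulVecLin_apply, Matrix.mulVec_mulVec, ← Matrix.map_mul, h]
  have one : ∀ (P Q : Matrix (Fin 3) (Fin 3) (S K)), P * Q = 1 → ∀ x,
      mbar K P (mbar K Q x) = x := by
    intro P Q h x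
    simp only [Matrix.mulVecLin_apply, Matrix.mulVec_mulVec, ← Matrix.map_mul, h]
    simp
  refine ⟨LinearEquiv.ofLinearMap (Submodule.mapQ _ _ (mbar K U) (key M N U V h))
    (Submodule.mapQ _ _ (mbar K U') (key N M U' V' h')) ?_ ?_⟩
  · apply Submodule.linearMap_qext
    apply LinearMap.ext
    intro x
    simp only [LinearMap.comp_apply, Submodule.mkQ_apply, Submodule.mapQ_apply, one _ _ h2,
      LinearMap.id_apply]
  · apply Submodule.linearMap_qext
    apply LinearMap.ext
    intro x
    simp only [LinearMap.comp_apply, Submodule.mkQ_apply, Submodule.mapQ_apply, one _ _ h1,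
      LinearMap.id_apply]

theorem mk_iso3 (K : Type) [Field K] [CharZero K] (A B : Fin 4 → Matrix (Fin 3) (Fin 3) K)
    (U V U' V' : Matrix (Fin 3) (Fin 3) K) (h : ∀ k, U * A k = B k * V)
    (h' : ∀ k, U' * B k = A k * V')
    (h1 : U' * U = (3 : K) • 1) :
    Nonempty (coker K (lin3 K A) ≃ₗ[R4 K] coker K (lin3 K B)) := by
  have e1 : ((3 : K)⁻¹ • U') * U = 1 := by
    rw [Matrix.smul_mul, h1, smul_smul, inv_mul_cancel₀ (by norm_num), one_smul]
  have e2 : U * ((3 : K)⁻¹ • U') = 1 := mul_eq_one_comm.mp e1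
  refine mk_iso K _ _ (U.map C) (V.map C) (((3 : K)⁻¹ • U').map C) (((3 : K)⁻¹ • V').map C)
    (lin3_mul K A B _ _ h) (lin3_mul K B A _ _ ?_) ?_ ?_
  · intro k
    rw [Matrix.smul_mul, h', Matrix.mul_smul]
  · rw [← Matrix.map_mul, e1]; exact Matrix.map_one _ (map_zero _) (map_one _)
  · rw [← Matrix.map_mul, e2]; exact Matrix.map_one _ (map_zero _) (map_one _)

/-- Left transition matrix. -/
def tU (K : Type) [Field K] (b c ε : K) : Matrix (Fin 3) (Fin 3) K :=
  !![-ε ^ 2, b ^ 2 * c, -(c ^ 2 * ε); b * c ^ 2 * (1 - ε), 0, b * c * ε * (ε - 1);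
     -(c * ε), b ^ 2 * c ^ 2, 1]

/-- Right transition matrix. -/
def tV (K : Type) [Field K] (b c ε : K) : Matrix (Fin 3) (Fin 3) K :=
  !![0, b * c ^ 2 * (1 - ε), b * c * ε * (1 - ε); b ^ 2 * c, -ε ^ 2, c ^ 2 * ε;
     -(b ^ 2 * c ^ 2), c * ε, 1]

theorem tUV (K : Type) [Field K] (b c d ε : K)
    (hb : b ^ 3 = -1) (hc : c ^ 3 = -1) (he : ε ^ 2 + ε + 1 = 0) (k : Fin 4) :
    tU K b c ε * acoef K b c d ε k =
      acoef K (b * ε) (c * ε) (d * ε) (ε ^ 2) k * tV K b c ε := by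
  have he2 : ε ^ 2 = - ε - 1 := by linear_combination he
  ext i j
  fin_cases k <;> fin_cases i <;> fin_cases j <;>
    simp [acoef, tU, tV, Matrix.mul_apply, Fin.sum_univ_three] <;> grind

theorem tUU (K : Type) [Field K] (b c ε : K)
    (hb : b ^ 3 = -1) (hc : c ^ 3 = -1) (he : ε ^ 2 + ε + 1 = 0) :
    tU K (b * ε) (c * ε) (ε ^ 2) * tU K b c ε = (3 : K) • 1 := by
  ext i j
  fin_cases i <;> fin_cases j <;>
    simp [tU, Matrix.mul_apply, Fin.sum_univ_three] <;> grind

theorem tVV (K : Type) [Field K] (b c ε : K)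
    (hb : b ^ 3 = -1) (hc : c ^ 3 = -1) (he : ε ^ 2 + ε + 1 = 0) :
    tV K (b * ε) (c * ε) (ε ^ 2) * tV K b c ε = (3 : K) • 1 := by
  ext i j
  fin_cases i <;> fin_cases j <;>
    simp [tV, Matrix.mul_apply, Fin.sum_univ_three] <;> grind

theorem tUV' (K : Type) [Field K] (b c d ε : K)
    (hb : b ^ 3 = -1) (hc : c ^ 3 = -1) (he : ε ^ 2 + ε + 1 = 0) (k : Fin 4) :
    tU K (b * ε) (c * ε) (ε ^ 2) * acoef K (b * ε) (c * ε) (d * ε) (ε ^ 2) k =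
      acoef K b c d ε k * tV K (b * ε) (c * ε) (ε ^ 2) := by
  have he3 : ε ^ 3 = 1 := by linear_combination (ε - 1) * he
  have h := tUV K (b * ε) (c * ε) (d * ε) (ε ^ 2) (by rw [mul_pow, hb, he3, mul_one])
    (by rw [mul_pow, hc, he3, mul_one]) (by linear_combination he + ε * he3) k
  have z : ∀ x : K, x * ε * ε ^ 2 = x := fun x => by linear_combination x * he3
  have z' : (ε ^ 2) ^ 2 = ε := by linear_combination ε * he3
  rwa [z, z, z, z'] at h

theorem back_alpha (K : Type) [Field K] [CharZero K] (b c d ε : K)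
    (hb : b ^ 3 = -1) (hc : c ^ 3 = -1) (he : ε ^ 2 + ε + 1 = 0) :
    Nonempty (coker K (alphaM K b c d ε) ≃ₗ[R4 K]
      coker K (alphaM K (b * ε) (c * ε) (d * ε) (ε ^ 2))) := by
  rw [alphaM_eq, alphaM_eq]
  exact mk_iso3 K _ _ _ _ _ _ (tUV K b c d ε hb hc he) (tUV' K b c d ε hb hc he)
    (tUU K b c ε hb hc he)

theorem back_beta (K : Type) [Field K] [CharZero K] (b c d ε : K)
    (hb : b ^ 3 = -1) (hc : c ^ 3 = -1) (he : ε ^ 2 + ε + 1 = 0) :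
    Nonempty (coker K (betaM K b c d ε) ≃ₗ[R4 K]
      coker K (betaM K (b * ε) (c * ε) (d * ε) (ε ^ 2))) := by
  rw [betaM_eq, betaM_eq]
  refine mk_iso3 K _ _ (tV K (b * ε) (c * ε) (ε ^ 2))ᵀ (tU K (b * ε) (c * ε) (ε ^ 2))ᵀ
    (tV K b c ε)ᵀ (tU K b c ε)ᵀ (fun k => ?_) (fun k => ?_) ?_
  · rw [← Matrix.transpose_mul, ← Matrix.transpose_mul, tUV' K b c d ε hb hc he]
  · rw [← Matrix.transpose_mul, ← Matrix.transpose_mul, tUV K b c d ε hb hc he]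
  · rw [← Matrix.transpose_mul, tVV K b c ε hb hc he]
    simp

theorem params (K : Type) [Field K] (b c d ε n p q y : K)
    (hb0 : b ≠ 0) (hc0 : c ≠ 0) (hd0 : d ≠ 0)
    (he : ε ^ 3 = 1) (hy : y ^ 3 = 1) (hyne : y ≠ 1)
    (h1 : (y ^ 2 * n * p * q = ε ^ 2 * b * c * d ∧ n = b) ∨
      (y ^ 2 * n * p * q = ε ^ 2 * b * c * d * ε ^ 2 ∧ n = b * ε))
    (h2 : (p = c ∧ q = d) ∨ (p = c * ε ∧ q = d * ε)) :
    (n, p, q, y) = (b, c, d, ε) ∨ (n, p, q, y) = (b * ε, c * ε, d * ε, ε ^ 2) := by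
  have hbcd : b * c * d ≠ 0 := mul_ne_zero (mul_ne_zero hb0 hc0) hd0
  have hno : y ^ 2 ≠ 1 := by
    intro h; apply hyne; linear_combination hy - y * h
  rcases h1 with ⟨h1, rfl⟩ | ⟨h1, rfl⟩ <;> rcases h2 with ⟨rfl, rfl⟩ | ⟨rfl, rfl⟩
  · left
    have : y ^ 2 = ε ^ 2 := by
      apply mul_left_cancel₀ hbcd; linear_combination h1
    have : y = ε := by
      linear_combination (y ^ 2 + ε ^ 2) * this - y * hy + ε * he
    rw [this]
  · exfalso
    apply hno
    have : y ^ 2 * ε ^ 2 = ε ^ 2 := by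
      apply mul_left_cancel₀ hbcd; linear_combination h1
    linear_combination ε * this - (y ^ 2 - 1) * he
  · exfalso
    apply hno
    have : y ^ 2 * ε = ε ^ 4 := by
      apply mul_left_cancel₀ hbcd; linear_combination h1
    linear_combination ε ^ 2 * this - (y ^ 2 - 1 - ε ^ 3) * he
  · right
    have : y ^ 2 * ε ^ 3 = ε ^ 4 := by
      apply mul_left_cancel₀ hbcd; linear_combination h1
    have : y ^ 2 = ε := by
      linear_combination this - (y ^ 2 - ε) * he
    have : y = ε ^ 2 := by
      linear_combination (y ^ 2 + ε) * this - y * hy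
    rw [this]

theorem params_no (K : Type) [Field K] (b c d ε n p q y : K)
    (hb0 : b ≠ 0) (hc0 : c ≠ 0) (hd0 : d ≠ 0)
    (he : ε ^ 3 = 1) (hy : y ^ 3 = 1) (hyne : y ≠ 1)
    (h1 : (y ^ 2 * n * p * q = ε ^ 2 * b * c * d ∧ n = b * ε) ∨
      (y ^ 2 * n * p * q = ε ^ 2 * b * c * d * ε ^ 2 ∧ n = b))
    (h2 : p * q = c * d * ε) : False := by
  have hbcd : b * c * d ≠ 0 := mul_ne_zero (mul_ne_zero hb0 hc0) hd0
  have hno : y ^ 2 ≠ 1 := by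
    intro h; apply hyne; linear_combination hy - y * h
  apply hno
  rcases h1 with ⟨h1, rfl⟩ | ⟨h1, rfl⟩
  · have : y ^ 2 * ε ^ 2 = ε ^ 2 := by
      apply mul_left_cancel₀ hbcd; linear_combination h1 - y ^ 2 * b * ε * h2
    linear_combination ε * this - (y ^ 2 - 1) * he
  · have : y ^ 2 * ε = ε ^ 4 := by
      apply mul_left_cancel₀ hbcd; linear_combination h1 - y ^ 2 * n * h2
    linear_combination ε ^ 2 * this - (y ^ 2 - 1 - ε ^ 3) * he

theorem stmt15 (K : Type) [Field K] [IsAlgClosed K] [CharZero K]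
    (b c d ε n p q y : K)
    (hb : b ^ 3 = -1) (hc : c ^ 3 = -1) (hd : d ^ 3 = -1) (he : ε ^ 3 = 1) (hne : ε ≠ 1)
    (hn : n ^ 3 = -1) (hp : p ^ 3 = -1) (hq : q ^ 3 = -1) (hy : y ^ 3 = 1) (hyne : y ≠ 1) :
    (Nonempty (coker K (alphaM K b c d ε) ≃ₗ[R4 K] coker K (alphaM K n p q y)) ↔
      ((n, p, q, y) = (b, c, d, ε) ∨ (n, p, q, y) = (b * ε, c * ε, d * ε, ε ^ 2))) ∧
    (Nonempty (coker K (betaM K b c d ε) ≃ₗ[R4 K] coker K (betaM K n p q y)) ↔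
      ((n, p, q, y) = (b, c, d, ε) ∨ (n, p, q, y) = (b * ε, c * ε, d * ε, ε ^ 2))) ∧
    ¬ Nonempty (coker K (alphaM K b c d ε) ≃ₗ[R4 K] coker K (betaM K n p q y)) := by
  have hb0 := ne_of_cube K b hb
  have hc0 := ne_of_cube K c hc
  have hd0 := ne_of_cube K d hd
  have hq0 := ne_of_cube K q hq
  have hr := eps_rel K ε he hne
  have r14 : ∀ j, acoef K n p q y 3 0 j + (y ^ 2 * n * p * q) * acoef K n p q y 0 0 j = 0 := by
    intro j; fin_cases j <;> simp [acoef]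
  have r23 : ∀ j, acoef K n p q y 2 0 j + n * acoef K n p q y 1 0 j = 0 := by
    intro j; fin_cases j <;> simp [acoef]
  have c12 : ∀ j, acoef K n p q y 1 j 0 + p * acoef K n p q y 0 j 0 = 0 := by
    intro j; fin_cases j <;> simp [acoef]
  have c34 : ∀ j, acoef K n p q y 3 j 0 + q * acoef K n p q y 2 j 0 = 0 := by
    intro j; fin_cases j <;> simp [acoef]
  have nz1 : ∃ i, acoef K n p q y 0 i 0 ≠ 0 := ⟨1, by simp [acoef]⟩
  have nz2 : ∃ i, (acoef K n p q y 0)ᵀ i 0 ≠ 0 := ⟨1, by simp [acoef]⟩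
  refine ⟨⟨?_, ?_⟩, ⟨?_, ?_⟩, ?_⟩
  · rintro ⟨e⟩
    rw [alphaM_eq, alphaM_eq] at e
    obtain ⟨⟨u, hu, hu'⟩, v, hv, hv'⟩ := iso_vecs K _ _ e 0 nz1
    exact params K b c d ε n p q y hb0 hc0 hd0 he hy hyne
      (left14 K b c d ε _ n hb hc hd hr hne u hu (hu' 3 0 _ r14) (hu' 2 1 _ r23))
      (right12 K b c d ε p q hb hc hd hr hne v hv hq0 (hv' 1 0 _ c12) (hv' 3 2 _ c34))
  · rintro (h | h) <;> simp only [Prod.mk.injEq] at h <;> obtain ⟨rfl, rfl, rfl, rfl⟩ := h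
    · exact ⟨LinearEquiv.refl _ _⟩
    · exact back_alpha K b c d ε hb hc hr
  · rintro ⟨e⟩
    rw [betaM_eq, betaM_eq] at e
    obtain ⟨⟨u, hu, hu'⟩, v, hv, hv'⟩ := iso_vecs K _ _ e 0 nz2
    have hu2 : ∀ (k l : Fin 4) (t : K),
        (∀ j, acoef K n p q y k j 0 + t * acoef K n p q y l j 0 = 0) →
        (acoef K b c d ε k + t • acoef K b c d ε l) *ᵥ u = 0 := by
      intro k l t h
      have := hu' k l t h
      rwa [← Matrix.transpose_smul, ← Matrix.transpose_add, Matrix.vecMul_transpose] at this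
    have hv2 : ∀ (k l : Fin 4) (t : K),
        (∀ j, acoef K n p q y k 0 j + t * acoef K n p q y l 0 j = 0) →
        v ᵥ* (acoef K b c d ε k + t • acoef K b c d ε l) = 0 := by
      intro k l t h
      have := hv' k l t h
      rwa [← Matrix.transpose_smul, ← Matrix.transpose_add, Matrix.mulVec_transpose] at this
    exact params K b c d ε n p q y hb0 hc0 hd0 he hy hyne
      (left14 K b c d ε _ n hb hc hd hr hne v hv (hv2 3 0 _ r14) (hv2 2 1 _ r23))
      (right12 K b c d ε p q hb hc hd hr hne u hu hq0 (hu2 1 0 _ c12) (hu2 3 2 _ c34))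
  · rintro (h | h) <;> simp only [Prod.mk.injEq] at h <;> obtain ⟨rfl, rfl, rfl, rfl⟩ := h
    · exact ⟨LinearEquiv.refl _ _⟩
    · exact back_beta K b c d ε hb hc hr
  · rintro ⟨e⟩
    rw [alphaM_eq, betaM_eq] at e
    obtain ⟨⟨u, hu, hu'⟩, v, hv, hv'⟩ := iso_vecs K _ _ e 0 nz2
    exact params_no K b c d ε n p q y hb0 hc0 hd0 he hy hyne
      (right14 K b c d ε _ n hb hc hd hr v hv (hv' 3 0 _ r14) (hv' 2 1 _ r23))
      (left12 K b c d ε p q hb hc hd hr u hu (hu' 1 0 _ c12) (hu' 3 2 _ c34))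
end
end
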